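/- Let θ₀ ∈ (0,1). There exists C > 0 depending only on θ₀ such that for all γ ∈ [1/3,1/2), α ∈ (0,1/2), θ ∈ [0,θ₀], M ≥ 8, x₀ ∈ ℝ with |x₀| ≤ M/4, every bounded measurable f on (−2M,2M), and every bounded measurable weak solution u of 𝓛_{γ,α}u = f(x)|x|^{−θ} in (−2M,2M) with Tail_α(u;x₀,3) < ∞: [u]²_{B_2(x₀)} ≤ C ‖u‖_{L^∞(B_3(x₀))} ( ‖u‖_{L^∞(B_3(x₀))} + ‖f‖_{L^∞(B_3(x₀))} + Tail_α(u;x₀,3) ). -/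

import Mathlib

open MeasureTheory Real
open scoped ENNReal

/-- The weighted CKN kernel `|x-y|^{-1-2γ} |x|^{-α} |y|^{-α}` in dimension one. -/
noncomputable def cknK (γ α x y : ℝ) : ℝ :=
  |x - y| ^ (-(1 + 2 * γ)) * (|x| ^ (-α) * |y| ^ (-α))

/-- `u` is a weak solution of `𝓛_{γ,α} u = F` in the open set `I ⊆ ℝ`: for every test
function `φ ∈ C_c^∞(I)`, the symmetrized double integral converges absolutely and
`(1/2) ∫∫ (u(x)-u(y))(φ(x)-φ(y)) K_{γ,α}(x,y) dx dy = ∫ F φ`. -/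
def IsWeakSol (γ α : ℝ) (u F : ℝ → ℝ) (I : Set ℝ) : Prop :=
  ∀ φ : ℝ → ℝ, ContDiff ℝ (⊤ : ℕ∞) φ → HasCompactSupport φ → tsupport φ ⊆ I →
    MeasureTheory.Integrable
      (fun q : ℝ × ℝ => (u q.1 - u q.2) * (φ q.1 - φ q.2) * cknK γ α q.1 q.2) ∧
    (1 / 2) * (∫ q : ℝ × ℝ, (u q.1 - u q.2) * (φ q.1 - φ q.2) * cknK γ α q.1 q.2) =
      ∫ x : ℝ, F x * φ x

/-- The interval `B_r(x₀) = (x₀ - r, x₀ + r)`. -/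
def ball1 (x₀ r : ℝ) : Set ℝ := Set.Ioo (x₀ - r) (x₀ + r)

/-- The localized seminorm `[u]²_S = ∫_S ∫_S (u(x)-u(y))² K_{γ,α}(x,y) dx dy`,
as an element of `[0,∞]`. -/
noncomputable def eSemi (γ α : ℝ) (u : ℝ → ℝ) (S : Set ℝ) : ℝ≥0∞ :=
  ∫⁻ x in S, ∫⁻ y in S, ENNReal.ofReal ((u x - u y) ^ 2 * cknK γ α x y)

/-- The tail `Tail_α(u;x₀,R) = R^{2γ+α} ∫_{|x-x₀|≥R} |u(x)| |x-x₀|^{-1-2γ} |x|^{-α} dx`,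
as an element of `[0,∞]`. -/
noncomputable def eTail (γ α : ℝ) (u : ℝ → ℝ) (x₀ R : ℝ) : ℝ≥0∞ :=
  ENNReal.ofReal (R ^ (2 * γ + α)) *
    ∫⁻ x in {x : ℝ | R ≤ |x - x₀|},
      ENNReal.ofReal (|u x| * |x - x₀| ^ (-(1 + 2 * γ)) * |x| ^ (-α))

/-- The `L^∞` norm of `u` on the set `S`, as an element of `[0,∞]`. -/
noncomputable def eSup (u : ℝ → ℝ) (S : Set ℝ) : ℝ≥0∞ :=
  eLpNorm u ⊤ (volume.restrict S)

lemma cknK_nonneg (γ α x y : ℝ) : 0 ≤ cknK γ α x y := by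
  unfold cknK; positivity

lemma cknK_symm (γ α x y : ℝ) : cknK γ α x y = cknK γ α y x := by
  unfold cknK; rw [abs_sub_comm, mul_comm (|x| ^ (-α))]

lemma cknK_meas (γ α : ℝ) : Measurable (fun q : ℝ × ℝ => cknK γ α q.1 q.2) := by
  unfold cknK; fun_prop

lemma cknK_meas_right (γ α x : ℝ) : Measurable (fun y : ℝ => cknK γ α x y) := by
  unfold cknK; fun_prop

lemma cknK_smul (γ α x y : ℝ) {l : ℝ} (hl : l ≠ 0) :
    cknK γ α (l * x) (l * y) = |l| ^ (-(1 + 2 * γ + 2 * α)) * cknK γ α x y := by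
  have h0 : 0 < |l| := abs_pos.mpr hl
  unfold cknK
  rw [← mul_sub, abs_mul, abs_mul, abs_mul, mul_rpow h0.le (abs_nonneg _),
    mul_rpow h0.le (abs_nonneg _), mul_rpow h0.le (abs_nonneg _)]
  have : |l| ^ (-(1 + 2 * γ + 2 * α)) = |l| ^ (-(1 + 2 * γ)) * |l| ^ (-α) * |l| ^ (-α) := by
    rw [← rpow_add h0, ← rpow_add h0]; congr 1; ring
  rw [this]; ring

lemma integrableOn_abs_rpow {s : ℝ} (hs : s < 1) (S : ℝ) :
    IntegrableOn (fun x : ℝ => |x| ^ (-s)) (Set.Icc (-S) S) := by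
  rcases lt_or_ge S 0 with h | h
  · rw [Set.Icc_eq_empty (by linarith)]; exact integrableOn_empty
  have h1 : IntervalIntegrable (fun x : ℝ => |x| ^ (-s)) volume 0 S := by
    refine (intervalIntegral.intervalIntegrable_rpow' (r := -s) (by linarith)
      (a := 0) (b := S)).congr ?_
    intro x hx
    rw [Set.uIoc_of_le h] at hx
    simp only [abs_of_pos hx.1]
  have h2 : IntervalIntegrable (fun x : ℝ => |x| ^ (-s)) volume (-S) 0 := by
    have := (IntervalIntegrable.iff_comp_neg (by simp)).mp h1
    simp only [abs_neg, neg_zero] at this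
    exact this.symm
  have h3 := h2.trans h1
  rwa [intervalIntegrable_iff_integrableOn_Icc_of_le (by linarith)] at h3

lemma lint_abs_rpow_small {s : ℝ} (hs : s < 1) (S : ℝ) :
    ∫⁻ x in {x : ℝ | |x| ≤ S}, ENNReal.ofReal (|x| ^ (-s)) ≠ ⊤ := by
  have h := integrableOn_abs_rpow hs S
  have e : {x : ℝ | |x| ≤ S} = Set.Icc (-S) S := by ext x; simp [abs_le]
  rw [e]
  rw [← ofReal_integral_eq_lintegral_ofReal h (ae_of_all _ fun x => by positivity)]
  exact ENNReal.ofReal_ne_top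

lemma lint_abs_rpow_large {s : ℝ} (hs : 1 < s) :
    ∫⁻ x in {x : ℝ | 1 ≤ |x|}, ENNReal.ofReal (|x| ^ (-s)) ≠ ⊤ := by
  have h1 : IntegrableOn (fun x : ℝ => |x| ^ (-s)) (Set.Ioi 1) := by
    refine (integrableOn_Ioi_rpow_of_lt (a := -s) (by linarith) zero_lt_one).congr_fun ?_
      measurableSet_Ioi
    intro x hx
    simp only [abs_of_pos (lt_trans zero_lt_one (Set.mem_Ioi.mp hx))]
  have h1' : IntegrableOn (fun x : ℝ => |x| ^ (-s)) (Set.Ici 1) :=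
    Iff.mpr integrableOn_Ici_iff_integrableOn_Ioi h1
  have h2 : IntegrableOn (fun x : ℝ => |x| ^ (-s)) (Set.Iic (-1)) := by
    rw [← integrable_indicator_iff measurableSet_Ici] at h1'
    have h := h1'.comp_neg
    rw [← integrable_indicator_iff measurableSet_Iic]
    refine h.congr (ae_of_all _ fun x => ?_)
    beta_reduce
    by_cases hx : x ≤ -1
    · rw [Set.indicator_of_mem (by simp; linarith), Set.indicator_of_mem (by exact hx), abs_neg]
    · rw [Set.indicator_of_notMem (by simp; linarith), Set.indicator_of_notMem (by exact hx)]
  have e : {x : ℝ | 1 ≤ |x|} = Set.Iic (-1) ∪ Set.Ici 1 := by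
    ext x; simp only [Set.mem_ofPred_eq, le_abs, Set.mem_union, Set.mem_Iic, Set.mem_Ici]
    constructor
    · rintro (h | h)
      · right; exact h
      · left; linarith
    · rintro (h | h)
      · right; linarith
      · left; exact h
  have h := h2.union h1'
  rw [e]
  rw [← ofReal_integral_eq_lintegral_ofReal h (ae_of_all _ fun x => by positivity)]
  exact ENNReal.ofReal_ne_top

/-- universal constants -/
noncomputable def cI0 (s : ℝ) : ℝ≥0∞ := ∫⁻ x in {x : ℝ | |x| ≤ 1}, ENNReal.ofReal (|x| ^ (-s))
noncomputable def cI1 (s : ℝ) : ℝ≥0∞ := ∫⁻ x in {x : ℝ | 1 ≤ |x|}, ENNReal.ofReal (|x| ^ (-s))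

lemma cI0_ne_top {s : ℝ} (hs : s < 1) : cI0 s ≠ ⊤ := lint_abs_rpow_small hs 1
lemma cI1_ne_top {s : ℝ} (hs : 1 < s) : cI1 s ≠ ⊤ := lint_abs_rpow_large hs

/-- `m(z) = min(1,|z|) |z|^{-1-2γ}` -/
noncomputable def mker (γ z : ℝ) : ℝ := min 1 |z| * |z| ^ (-(1 + 2 * γ))

lemma mker_nonneg (γ z : ℝ) : 0 ≤ mker γ z := by unfold mker; positivity
lemma mker_meas (γ : ℝ) : Measurable (mker γ) := by unfold mker; fun_prop

lemma lint_mker {γ : ℝ} (hγ : γ ∈ Set.Ico (1 / 3 : ℝ) (1 / 2)) :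
    ∫⁻ z, ENNReal.ofReal (mker γ z) ≠ ⊤ := by
  have key : ∫⁻ z, ENNReal.ofReal (mker γ z) ≤ cI0 (2 * γ) + cI1 (1 + 2 * γ) := by
    have hun : (Set.univ : Set ℝ) ⊆ {x : ℝ | |x| ≤ 1} ∪ {x : ℝ | 1 ≤ |x|} := by
      intro x _; exact le_total |x| 1
    rw [← setLIntegral_univ]
    refine (lintegral_mono_set hun).trans ((lintegral_union_le _ _ _).trans ?_)
    unfold cI0 cI1
    refine add_le_add ?_ ?_
    · refine setLIntegral_mono' (measurableSet_le (by fun_prop) (by fun_prop)) ?_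
      intro x hx
      apply ENNReal.ofReal_le_ofReal
      unfold mker
      rw [min_eq_right hx]
      rcases eq_or_ne x 0 with rfl | h0
      · simp; positivity
      have h0 := abs_pos.mpr h0
      nth_rewrite 1 [← rpow_one |x|]
      rw [← rpow_add h0]
      apply le_of_eq; congr 1; ring
    · refine setLIntegral_mono' (measurableSet_le (by fun_prop) (by fun_prop)) ?_
      intro x hx
      apply ENNReal.ofReal_le_ofReal
      unfold mker
      rw [min_eq_left hx, one_mul]
  refine ne_top_of_le_ne_top ?_ key
  exact ENNReal.add_ne_top.mpr ⟨cI0_ne_top (by linarith [hγ.2]), cI1_ne_top (by linarith [hγ.1])⟩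

lemma lint_mker_sub {γ : ℝ} (x : ℝ) :
    ∫⁻ y, ENNReal.ofReal (mker γ (x - y)) = ∫⁻ z, ENNReal.ofReal (mker γ z) :=
  lintegral_sub_left_eq_self (fun z => ENNReal.ofReal (mker γ z)) x

/-- main qualitative bound -/
lemma B1 {γ α δ : ℝ} (hγ : γ ∈ Set.Ico (1 / 3 : ℝ) (1 / 2)) (hα : α ∈ Set.Ioo (0 : ℝ) (1 / 2))
    (hδ : 0 < δ) : ∃ C : ℝ≥0∞, C ≠ ⊤ ∧ ∀ x : ℝ, δ ≤ |x| →
      ∫⁻ y, ENNReal.ofReal (min 1 |x - y| * cknK γ α x y) ≤ C := by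
  have hδ2 : 0 < δ / 2 := by positivity
  let A : ℝ := δ ^ (-α) * (δ / 2) ^ (-α)
  let B : ℝ := δ ^ (-α) * (δ / 2) ^ (-(1 + 2 * γ))
  refine ⟨ENNReal.ofReal A * (∫⁻ z, ENNReal.ofReal (mker γ z)) + ENNReal.ofReal B *
    (∫⁻ x in {x : ℝ | |x| ≤ δ / 2}, ENNReal.ofReal (|x| ^ (-α))), ?_, ?_⟩
  · exact ENNReal.add_ne_top.mpr ⟨ENNReal.mul_ne_top ENNReal.ofReal_ne_top (lint_mker hγ),
      ENNReal.mul_ne_top ENNReal.ofReal_ne_top (lint_abs_rpow_small (by linarith [hα.2]) _)⟩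
  intro x hx
  have hx0 : |x| ^ (-α) ≤ δ ^ (-α) :=
    rpow_le_rpow_of_nonpos hδ hx (by linarith [hα.1])
  have hms : MeasurableSet {x : ℝ | |x| ≤ δ / 2} := measurableSet_le (by fun_prop) (by fun_prop)
  rw [← lint_mker_sub x, ← lintegral_const_mul _ (by have := mker_meas γ; fun_prop),
    ← lintegral_const_mul _ (by fun_prop), ← lintegral_indicator hms,
    ← lintegral_add_left (by have := mker_meas γ; fun_prop)]
  refine lintegral_mono fun y => ?_
  by_cases hy : |y| ≤ δ / 2
  · rw [Set.indicator_of_mem (by exact hy)]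
    refine le_add_left ?_
    rw [← ENNReal.ofReal_mul (by positivity)]
    apply ENNReal.ofReal_le_ofReal
    have h1 : δ / 2 ≤ |x - y| := by
      have := abs_sub_abs_le_abs_sub x y; linarith
    have h2 : |x - y| ^ (-(1 + 2 * γ)) ≤ (δ / 2) ^ (-(1 + 2 * γ)) :=
      rpow_le_rpow_of_nonpos hδ2 h1 (by linarith [hγ.1])
    unfold cknK
    calc min 1 |x - y| * (|x - y| ^ (-(1 + 2 * γ)) * (|x| ^ (-α) * |y| ^ (-α)))
        ≤ 1 * ((δ / 2) ^ (-(1 + 2 * γ)) * (δ ^ (-α) * |y| ^ (-α))) := by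
          gcongr; exact min_le_left _ _
      _ = B * |y| ^ (-α) := by simp only [B]; ring
  · rw [Set.indicator_of_notMem (by exact hy), add_zero]
    rw [← ENNReal.ofReal_mul (by positivity)]
    apply ENNReal.ofReal_le_ofReal
    have h2 : |y| ^ (-α) ≤ (δ / 2) ^ (-α) :=
      rpow_le_rpow_of_nonpos hδ2 (not_le.mp hy).le (by linarith [hα.1])
    unfold cknK mker
    calc min 1 |x - y| * (|x - y| ^ (-(1 + 2 * γ)) * (|x| ^ (-α) * |y| ^ (-α)))
        ≤ min 1 |x - y| * (|x - y| ^ (-(1 + 2 * γ)) * (δ ^ (-α) * (δ / 2) ^ (-α))) := by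
          gcongr
      _ = A * (min 1 |x - y| * |x - y| ^ (-(1 + 2 * γ))) := by simp only [A]; ring

/-- Bounded measurable functions which are Lipschitz away from the origin. -/
def Reg (h : ℝ → ℝ) : Prop :=
  Measurable h ∧ (∃ K : ℝ, ∀ x, |h x| ≤ K) ∧
    ∀ δ > 0, ∃ M : ℝ, 0 ≤ M ∧ ∀ x y, δ ≤ |x| → |h x - h y| ≤ M * min 1 |x - y|

/-- Support in a compact subset of the punctured line. -/
def Supp0 (φ : ℝ → ℝ) : Prop :=
  ∃ δ > 0, ∃ S : ℝ, ∀ x, ¬ (δ ≤ |x| ∧ |x| ≤ S) → φ x = 0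

/-- Pointwise operator. -/
noncomputable def Lop (γ α : ℝ) (h : ℝ → ℝ) (x : ℝ) : ℝ :=
  ∫ y, (h x - h y) * cknK γ α x y

lemma measurableSet_ann (δ S : ℝ) : MeasurableSet {x : ℝ | δ ≤ |x| ∧ |x| ≤ S} := by
  have h1 : MeasurableSet {x : ℝ | δ ≤ |x|} := measurableSet_le measurable_const (by fun_prop)
  have h2 : MeasurableSet {x : ℝ | |x| ≤ S} := measurableSet_le (by fun_prop) measurable_const
  exact h1.inter h2

lemma volume_ann (δ S : ℝ) : volume {x : ℝ | δ ≤ |x| ∧ |x| ≤ S} ≠ ⊤ := by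
  refine ne_top_of_le_ne_top (b := volume (Set.Icc (-S) S)) (by simp) (measure_mono ?_)
  intro x hx; exact abs_le.mp hx.2

section
variable {γ α : ℝ} (hγ : γ ∈ Set.Ico (1 / 3 : ℝ) (1 / 2)) (hα : α ∈ Set.Ioo (0 : ℝ) (1 / 2))

lemma integrable_left (hγ : γ ∈ Set.Ico (1 / 3 : ℝ) (1 / 2)) (hα : α ∈ Set.Ioo (0 : ℝ) (1 / 2))
    {G : ℝ × ℝ → ℝ} (hG : Measurable G) {δ S M : ℝ} (hδ : 0 < δ) (hM : 0 ≤ M)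
    (hb : ∀ x y, δ ≤ |x| → |G (x, y)| ≤ M * (min 1 |x - y| * cknK γ α x y))
    (h0 : ∀ x y, ¬ (δ ≤ |x| ∧ |x| ≤ S) → G (x, y) = 0) : Integrable G := by
  obtain ⟨C, hC, hB⟩ := B1 hγ hα hδ
  refine ⟨hG.aestronglyMeasurable, ?_⟩
  rw [hasFiniteIntegral_iff_norm, Measure.volume_eq_prod, lintegral_prod _ (by fun_prop)]
  have hK := cknK_meas_right γ α
  calc ∫⁻ x, ∫⁻ y, ENNReal.ofReal ‖G (x, y)‖
      ≤ ∫⁻ x, ({x : ℝ | δ ≤ |x| ∧ |x| ≤ S}).indicator (fun _ => ENNReal.ofReal M * C) x := by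
        refine lintegral_mono fun x => ?_
        by_cases hx : δ ≤ |x| ∧ |x| ≤ S
        · rw [Set.indicator_of_mem (by exact hx)]
          calc ∫⁻ y, ENNReal.ofReal ‖G (x, y)‖
              ≤ ∫⁻ y, ENNReal.ofReal M * ENNReal.ofReal (min 1 |x - y| * cknK γ α x y) := by
                refine lintegral_mono fun y => ?_
                rw [← ENNReal.ofReal_mul hM]
                exact ENNReal.ofReal_le_ofReal (hb x y hx.1)
            _ = ENNReal.ofReal M * ∫⁻ y, ENNReal.ofReal (min 1 |x - y| * cknK γ α x y) := by
                have := hK x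
                rw [lintegral_const_mul _ (by fun_prop)]
            _ ≤ _ := by gcongr; exact hB x hx.1
        · rw [Set.indicator_of_notMem (by exact hx)]
          simp [h0 x _ hx]
    _ = ENNReal.ofReal M * C * volume {x : ℝ | δ ≤ |x| ∧ |x| ≤ S} := by
        rw [lintegral_indicator (measurableSet_ann δ S)]; simp
    _ < ⊤ := (ENNReal.mul_ne_top (ENNReal.mul_ne_top ENNReal.ofReal_ne_top hC)
        (volume_ann δ S)).lt_top

lemma Reg.integrable_y (hγ : γ ∈ Set.Ico (1 / 3 : ℝ) (1 / 2)) (hα : α ∈ Set.Ioo (0 : ℝ) (1 / 2))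
    {h : ℝ → ℝ} (hh : Reg h) {x : ℝ} (hx : x ≠ 0) :
    Integrable (fun y => (h x - h y) * cknK γ α x y) := by
  obtain ⟨hm, _, hL⟩ := hh
  obtain ⟨M, hM, hL⟩ := hL |x| (abs_pos.mpr hx)
  obtain ⟨C, hC, hB⟩ := B1 hγ hα (abs_pos.mpr hx)
  have hK := cknK_meas_right γ α x
  refine ⟨by fun_prop, ?_⟩
  rw [hasFiniteIntegral_iff_norm]
  calc ∫⁻ y, ENNReal.ofReal ‖(h x - h y) * cknK γ α x y‖
      ≤ ∫⁻ y, ENNReal.ofReal M * ENNReal.ofReal (min 1 |x - y| * cknK γ α x y) := by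
        refine lintegral_mono fun y => ?_
        rw [← ENNReal.ofReal_mul hM]
        refine ENNReal.ofReal_le_ofReal ?_
        rw [norm_mul, Real.norm_eq_abs, Real.norm_eq_abs, abs_of_nonneg (cknK_nonneg _ _ _ _),
          ← mul_assoc]
        exact mul_le_mul_of_nonneg_right (hL x y le_rfl) (cknK_nonneg _ _ _ _)
    _ = ENNReal.ofReal M * ∫⁻ y, ENNReal.ofReal (min 1 |x - y| * cknK γ α x y) := by
        rw [lintegral_const_mul _ (by fun_prop)]
    _ ≤ ENNReal.ofReal M * C := by gcongr; exact hB x le_rfl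
    _ < ⊤ := (ENNReal.mul_ne_top ENNReal.ofReal_ne_top hC).lt_top

lemma Reg.int_mul (hγ : γ ∈ Set.Ico (1 / 3 : ℝ) (1 / 2)) (hα : α ∈ Set.Ioo (0 : ℝ) (1 / 2))
    {h φ : ℝ → ℝ} (hh : Reg h) (hφ : Measurable φ) (hb : ∃ K, ∀ x, |φ x| ≤ K) (hs : Supp0 φ) :
    Integrable (fun q : ℝ × ℝ => φ q.1 * ((h q.1 - h q.2) * cknK γ α q.1 q.2)) := by
  obtain ⟨hm, _, hL⟩ := hh
  obtain ⟨K, hK⟩ := hb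
  obtain ⟨δ, hδ, S, hS⟩ := hs
  obtain ⟨M, hM, hL⟩ := hL δ hδ
  have hK0 : 0 ≤ K := (abs_nonneg _).trans (hK 0)
  have hKm := cknK_meas γ α
  refine integrable_left hγ hα (G := fun q : ℝ × ℝ => φ q.1 * ((h q.1 - h q.2) * cknK γ α q.1 q.2))
    (by fun_prop) (S := S) hδ (mul_nonneg hK0 hM) ?_ ?_
  · intro x y hx
    simp only [abs_mul, abs_of_nonneg (cknK_nonneg γ α x y)]
    have h1 := hL x y hx
    have h2 := hK x
    have := cknK_nonneg γ α x y
    calc |φ x| * (|h x - h y| * cknK γ α x y) ≤ K * ((M * min 1 |x - y|) * cknK γ α x y) := by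
          gcongr
      _ = _ := by ring
  · intro x y hx
    simp [hS x hx]

lemma Reg.int_diff (hγ : γ ∈ Set.Ico (1 / 3 : ℝ) (1 / 2)) (hα : α ∈ Set.Ioo (0 : ℝ) (1 / 2))
    {φ : ℝ → ℝ} (hh : Reg φ) (hs : Supp0 φ) :
    Integrable (fun q : ℝ × ℝ => (φ q.1 - φ q.2) * cknK γ α q.1 q.2) := by
  have hs' := hs
  obtain ⟨δ, hδ, S, hS⟩ := hs
  let χ : ℝ → ℝ := ({x : ℝ | δ ≤ |x| ∧ |x| ≤ S}).indicator (fun _ => 1)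
  have hχm : Measurable χ := measurable_const.indicator (measurableSet_ann δ S)
  have hχb : ∀ x, |χ x| ≤ 1 := by
    intro x; simp only [χ, Set.indicator]; split_ifs <;> simp
  have hχs : Supp0 χ := ⟨δ, hδ, S, fun x hx => Set.indicator_of_notMem (by exact hx) _⟩
  have h1 := hh.int_mul hγ hα hχm ⟨1, hχb⟩ hχs
  have h2 := h1.swap
  -- second piece
  have h3 : Integrable (fun q : ℝ × ℝ => (1 - χ q.1) *
      (χ q.2 * ((φ q.2 - φ q.1) * cknK γ α q.2 q.1))) := by
    refine (h2.bdd_mul (c := 2) (f := fun q : ℝ × ℝ => 1 - χ q.1)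
      (by have : Measurable (fun q : ℝ × ℝ => 1 - χ q.1) := by fun_prop
          exact this.aestronglyMeasurable) (ae_of_all _ fun q => ?_))
    have := abs_le.mp (hχb q.1)
    rw [Real.norm_eq_abs, abs_le]; constructor <;> linarith
  refine (h1.sub h3).congr (ae_of_all _ fun q => ?_)
  simp only [Pi.sub_apply]
  rw [cknK_symm γ α q.2 q.1]
  by_cases hx : δ ≤ |q.1| ∧ |q.1| ≤ S
  · have : χ q.1 = 1 := Set.indicator_of_mem (by exact hx) _
    rw [this]; ring
  · have e1 : χ q.1 = 0 := Set.indicator_of_notMem (by exact hx) _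
    rw [e1, hS _ hx]
    by_cases hy : δ ≤ |q.2| ∧ |q.2| ≤ S
    · have : χ q.2 = 1 := Set.indicator_of_mem (by exact hy) _
      rw [this]; ring
    · rw [hS _ hy]; ring

lemma Reg.int_diff_mul (hγ : γ ∈ Set.Ico (1 / 3 : ℝ) (1 / 2)) (hα : α ∈ Set.Ioo (0 : ℝ) (1 / 2))
    {w φ : ℝ → ℝ} (hw : Measurable w) (hb : ∃ K, ∀ x, |w x| ≤ K) (hh : Reg φ) (hs : Supp0 φ) :
    Integrable (fun q : ℝ × ℝ => w q.1 * ((φ q.1 - φ q.2) * cknK γ α q.1 q.2)) := by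
  obtain ⟨K, hK⟩ := hb
  exact (hh.int_diff hγ hα hs).bdd_mul (c := K) (f := fun q : ℝ × ℝ => w q.1)
    (hw.comp measurable_fst).aestronglyMeasurable
    (ae_of_all _ fun q => hK _)

lemma integral_swap_prod (F : ℝ × ℝ → ℝ) : ∫ q : ℝ × ℝ, F q.swap = ∫ q : ℝ × ℝ, F q := by
  rw [Measure.volume_eq_prod]
  exact integral_prod_swap F

lemma duality (hγ : γ ∈ Set.Ico (1 / 3 : ℝ) (1 / 2)) (hα : α ∈ Set.Ioo (0 : ℝ) (1 / 2))
    {w φ : ℝ → ℝ} (hw : Reg w) (hφ : Reg φ) (hs : Supp0 φ) :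
    ∫ q : ℝ × ℝ, φ q.1 * ((w q.1 - w q.2) * cknK γ α q.1 q.2) =
    ∫ q : ℝ × ℝ, w q.1 * ((φ q.1 - φ q.2) * cknK γ α q.1 q.2) := by
  have h1 := hw.int_mul hγ hα hφ.1 hφ.2.1 hs
  have h2 := hφ.int_diff_mul hγ hα hw.1 hw.2.1 hs
  rw [← sub_eq_zero, ← integral_sub h1 h2]
  have h3 := integral_swap_prod (fun q : ℝ × ℝ => φ q.1 * ((w q.1 - w q.2) * cknK γ α q.1 q.2) -
    w q.1 * ((φ q.1 - φ q.2) * cknK γ α q.1 q.2))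
  have h4 : ∀ q : ℝ × ℝ, (fun q : ℝ × ℝ => φ q.1 * ((w q.1 - w q.2) * cknK γ α q.1 q.2) -
    w q.1 * ((φ q.1 - φ q.2) * cknK γ α q.1 q.2)) q.swap = - (φ q.1 * ((w q.1 - w q.2) * cknK γ α q.1 q.2) -
    w q.1 * ((φ q.1 - φ q.2) * cknK γ α q.1 q.2)) := by
    intro q
    simp only [Prod.fst_swap, Prod.snd_swap]
    rw [cknK_symm γ α q.2 q.1]; ring
  simp_rw [h4] at h3
  rw [integral_neg] at h3
  linarith

lemma pair_left (hγ : γ ∈ Set.Ico (1 / 3 : ℝ) (1 / 2)) (hα : α ∈ Set.Ioo (0 : ℝ) (1 / 2))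
    {h φ : ℝ → ℝ} (hh : Reg h) (hφ : Measurable φ) (hb : ∃ K, ∀ x, |φ x| ≤ K) (hs : Supp0 φ) :
    ∫ q : ℝ × ℝ, φ q.1 * ((h q.1 - h q.2) * cknK γ α q.1 q.2) = ∫ x, φ x * Lop γ α h x := by
  have h1 := hh.int_mul hγ hα hφ hb hs
  rw [Measure.volume_eq_prod] at h1 ⊢
  rw [integral_prod _ h1]
  simp only [Lop, integral_const_mul]

lemma pair_right (hγ : γ ∈ Set.Ico (1 / 3 : ℝ) (1 / 2)) (hα : α ∈ Set.Ioo (0 : ℝ) (1 / 2))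
    {w φ : ℝ → ℝ} (hw : Measurable w) (hb : ∃ K, ∀ x, |w x| ≤ K) (hh : Reg φ) (hs : Supp0 φ) :
    ∫ q : ℝ × ℝ, w q.1 * ((φ q.1 - φ q.2) * cknK γ α q.1 q.2) = ∫ x, w x * Lop γ α φ x := by
  have h1 := hh.int_diff_mul hγ hα hw hb hs
  rw [Measure.volume_eq_prod] at h1 ⊢
  rw [integral_prod _ h1]
  simp only [Lop, integral_const_mul]

lemma Lop_meas {h : ℝ → ℝ} (hh : Measurable h) : Measurable (Lop γ α h) := by
  have hK := cknK_meas γ α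
  have : Measurable (fun q : ℝ × ℝ => (h q.1 - h q.2) * cknK γ α q.1 q.2) := by fun_prop
  exact (this.stronglyMeasurable.integral_prod_right (ν := (volume : Measure ℝ))).measurable

lemma Lop_bdd (hγ : γ ∈ Set.Ico (1 / 3 : ℝ) (1 / 2)) (hα : α ∈ Set.Ioo (0 : ℝ) (1 / 2))
    {h : ℝ → ℝ} (hh : Reg h) {δ : ℝ} (hδ : 0 < δ) : ∃ C : ℝ, ∀ x, δ ≤ |x| → |Lop γ α h x| ≤ C := by
  obtain ⟨hm, _, hL⟩ := hh
  obtain ⟨M, hM, hL⟩ := hL δ hδ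
  obtain ⟨C, hC, hB⟩ := B1 hγ hα hδ
  refine ⟨(ENNReal.ofReal M * C).toReal, fun x hx => ?_⟩
  have hK := cknK_meas_right γ α x
  have h1 := norm_integral_le_lintegral_norm (μ := volume) (fun y => (h x - h y) * cknK γ α x y)
  refine h1.trans (ENNReal.toReal_mono (ENNReal.mul_ne_top ENNReal.ofReal_ne_top hC) ?_)
  calc ∫⁻ y, ENNReal.ofReal ‖(h x - h y) * cknK γ α x y‖
      ≤ ∫⁻ y, ENNReal.ofReal M * ENNReal.ofReal (min 1 |x - y| * cknK γ α x y) := by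
        refine lintegral_mono fun y => ?_
        rw [← ENNReal.ofReal_mul hM]
        refine ENNReal.ofReal_le_ofReal ?_
        rw [norm_mul, Real.norm_eq_abs, Real.norm_eq_abs, abs_of_nonneg (cknK_nonneg _ _ _ _),
          ← mul_assoc]
        exact mul_le_mul_of_nonneg_right (hL x y hx) (cknK_nonneg _ _ _ _)
    _ = ENNReal.ofReal M * ∫⁻ y, ENNReal.ofReal (min 1 |x - y| * cknK γ α x y) := by
        rw [lintegral_const_mul _ (by fun_prop)]
    _ ≤ ENNReal.ofReal M * C := by gcongr; exact hB x hx
end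

/-- Dilation average. -/
noncomputable def Av (ε : ℝ) (u : ℝ → ℝ) (x : ℝ) : ℝ :=
  (1 / ε) * ∫ l in (1 : ℝ)..(1 + ε), u (l * x)

lemma Av_bdd {ε : ℝ} (hε : 0 < ε) {u : ℝ → ℝ} {K x : ℝ}
    (h : ∀ l ∈ Set.Icc 1 (1 + ε), |u (l * x)| ≤ K) : |Av ε u x| ≤ K := by
  have h1 : ‖∫ l in (1 : ℝ)..(1 + ε), u (l * x)‖ ≤ K * |1 + ε - 1| := by
    refine intervalIntegral.norm_integral_le_of_norm_le_const fun l hl => ?_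
    rw [Set.uIoc_of_le (by linarith)] at hl
    exact h l ⟨hl.1.le, hl.2⟩
  rw [Real.norm_eq_abs, add_sub_cancel_left, abs_of_pos hε] at h1
  rw [Av, abs_mul, abs_of_pos (by positivity : 0 < 1 / ε)]
  calc 1 / ε * |∫ l in (1 : ℝ)..(1 + ε), u (l * x)| ≤ 1 / ε * (K * ε) := by gcongr
    _ = K := by field_simp

lemma Av_meas {ε : ℝ} (hε : 0 < ε) {u : ℝ → ℝ} (hu : Measurable u) : Measurable (Av ε u) := by
  unfold Av
  refine Measurable.const_mul ?_ _
  simp_rw [intervalIntegral.integral_of_le (by linarith : (1 : ℝ) ≤ 1 + ε)]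
  have : Measurable (fun q : ℝ × ℝ => u (q.2 * q.1)) := by fun_prop
  exact (this.stronglyMeasurable.integral_prod_right
    (ν := (volume.restrict (Set.Ioc (1 : ℝ) (1 + ε))))).measurable

lemma bdd_intervalIntegrable {u : ℝ → ℝ} (hu : Measurable u) {K : ℝ} (hK : ∀ x, |u x| ≤ K)
    (a b : ℝ) : IntervalIntegrable u volume a b := by
  have : IntervalIntegrable (fun _ : ℝ => K) volume a b := by simp
  refine this.mono_fun hu.aestronglyMeasurable (ae_of_all _ fun x => ?_)
  exact (hK x).trans (le_abs_self _)

lemma Av_eq {ε : ℝ} (hε : 0 < ε) {u : ℝ → ℝ} (hu : Measurable u) {K : ℝ} (hK : ∀ x, |u x| ≤ K)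
    (x : ℝ) : ε * (x * Av ε u x) = (∫ t in (0 : ℝ)..((1 + ε) * x), u t) - ∫ t in (0 : ℝ)..x, u t := by
  have h1 := intervalIntegral.mul_integral_comp_mul_right (a := 1) (b := 1 + ε) (f := u) x
  have hI := bdd_intervalIntegrable hu hK
  rw [intervalIntegral.integral_interval_sub_left (hI _ _) (hI _ _), Av]
  rw [one_mul] at h1
  rw [← h1]; field_simp

lemma Av_lip {ε : ℝ} (hε : 0 < ε) {u : ℝ → ℝ} (hu : Measurable u) {K : ℝ} (hK : ∀ x, |u x| ≤ K)
    (x y : ℝ) : |x| * |Av ε u x - Av ε u y| ≤ K * (2 + 2 * ε) / ε * |x - y| := by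
  have hI := bdd_intervalIntegrable hu hK
  have hU : ∀ a b : ℝ, |(∫ t in (0 : ℝ)..a, u t) - ∫ t in (0 : ℝ)..b, u t| ≤ K * |a - b| := by
    intro a b
    rw [intervalIntegral.integral_interval_sub_left (hI _ _) (hI _ _)]
    exact intervalIntegral.norm_integral_le_of_norm_le_const (f := u) fun l _ => hK l
  have hy : |Av ε u y| ≤ K := Av_bdd hε fun l _ => hK _
  have e1 := Av_eq hε hu hK x
  have e2 := Av_eq hε hu hK y
  have h1 := hU ((1 + ε) * x) ((1 + ε) * y)
  have h2 := hU x y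
  rw [← mul_sub, abs_mul, abs_of_pos (by linarith : 0 < 1 + ε)] at h1
  have key : ε * (x * (Av ε u x - Av ε u y)) =
      ((∫ t in (0 : ℝ)..((1 + ε) * x), u t) - ∫ t in (0 : ℝ)..((1 + ε) * y), u t)
      - ((∫ t in (0 : ℝ)..x, u t) - ∫ t in (0 : ℝ)..y, u t) - ε * ((x - y) * Av ε u y) := by
    linear_combination e1 - e2
  have h3 : |ε * ((x - y) * Av ε u y)| ≤ ε * (|x - y| * K) := by
    rw [abs_mul, abs_mul, abs_of_pos hε]; gcongr
  have h4 : |ε * (x * (Av ε u x - Av ε u y))| ≤ K * (2 + 2 * ε) * |x - y| := by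
    rw [key]
    refine (abs_sub _ _).trans ?_
    refine (add_le_add_left (abs_sub _ _) _).trans ?_
    linarith
  rw [abs_mul, abs_mul, abs_of_pos hε] at h4
  rw [div_mul_eq_mul_div, le_div_iff₀ hε]
  linarith

lemma Reg.of_lip {h : ℝ → ℝ} (hm : Measurable h) {K : ℝ} (hK : ∀ x, |h x| ≤ K)
    (hL : ∀ δ > 0, ∃ Λ : ℝ, ∀ x y, δ ≤ |x| → |h x - h y| ≤ Λ * |x - y|) : Reg h := by
  refine ⟨hm, ⟨K, hK⟩, fun δ hδ => ?_⟩
  obtain ⟨Λ, hΛ⟩ := hL δ hδ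
  have hK0 : 0 ≤ K := (abs_nonneg _).trans (hK 0)
  refine ⟨max (2 * K) Λ, le_max_of_le_left (by positivity), fun x y hx => ?_⟩
  rcases le_total 1 |x - y| with h1 | h1
  · rw [min_eq_left h1, mul_one]
    refine le_max_of_le_left ((abs_sub _ _).trans ?_)
    linarith [hK x, hK y]
  · rw [min_eq_right h1]
    exact (hΛ x y hx).trans (mul_le_mul_of_nonneg_right (le_max_right _ _) (abs_nonneg _))

lemma Av_reg {ε : ℝ} (hε : 0 < ε) {u : ℝ → ℝ} (hu : Measurable u) {K : ℝ} (hK : ∀ x, |u x| ≤ K) :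
    Reg (Av ε u) := by
  refine Reg.of_lip (Av_meas hε hu) (K := K) (fun x => Av_bdd hε fun l _ => hK _) fun δ hδ => ?_
  refine ⟨K * (2 + 2 * ε) / ε / δ, fun x y hx => ?_⟩
  have h1 := Av_lip hε hu hK x y
  rw [div_mul_eq_mul_div, le_div_iff₀ hδ]
  refine le_trans ?_ h1
  rw [mul_comm]; gcongr

lemma Av_tendsto {u : ℝ → ℝ} (hu : Measurable u) {K : ℝ} (hK : ∀ x, |u x| ≤ K) :
    ∀ᵐ x : ℝ, Filter.Tendsto (fun ε => Av ε u x) (nhdsWithin 0 (Set.Ioi 0)) (nhds (u x)) := by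
  have hloc : LocallyIntegrable u volume := by
    refine (locallyIntegrable_const (K : ℝ)).mono hu.aestronglyMeasurable (ae_of_all _ fun x => ?_)
    rw [Real.norm_eq_abs, Real.norm_eq_abs]
    exact (hK x).trans (le_abs_self _)
  have h0 : ∀ᵐ x : ℝ, x ≠ 0 := by simp [ae_iff]
  filter_upwards [LocallyIntegrable.ae_hasDerivAt_integral hloc, h0] with x hx hx0
  have hd := hx 0
  rw [hasDerivAt_iff_tendsto_slope] at hd
  have hmap : Filter.Tendsto (fun ε : ℝ => (1 + ε) * x) (nhdsWithin 0 (Set.Ioi 0))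
      (nhdsWithin x {x}ᶜ) := by
    refine tendsto_nhdsWithin_iff.mpr ⟨?_, ?_⟩
    · have : Continuous (fun ε : ℝ => (1 + ε) * x) := by fun_prop
      have h2 := this.tendsto 0
      simp only [add_zero, one_mul] at h2
      exact h2.mono_left nhdsWithin_le_nhds
    · filter_upwards [self_mem_nhdsWithin] with ε hε
      have : ε ≠ 0 := ne_of_gt hε
      simp only [Set.mem_compl_iff, Set.mem_singleton_iff]
      intro h
      have : ε * x = 0 := by linarith
      simp_all
  refine (hd.comp hmap).congr' ?_
  filter_upwards [self_mem_nhdsWithin] with ε hε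
  have hε' : (0 : ℝ) < ε := hε
  have h2 := Av_eq hε' hu hK x
  simp only [Function.comp, slope, vsub_eq_sub, smul_eq_mul]
  rw [← h2]
  have : (1 + ε) * x - x = ε * x := by ring
  rw [this]; field_simp

section
variable {γ α : ℝ}

lemma smooth_reg {φ : ℝ → ℝ} (h1 : ContDiff ℝ (⊤ : ℕ∞) φ) (h2 : HasCompactSupport φ)
    (h3 : (0 : ℝ) ∉ tsupport φ) : Reg φ ∧ Supp0 φ := by
  obtain ⟨C, hC⟩ := h1.lipschitzWith_of_hasCompactSupport h2 (by simp)
  obtain ⟨K, hK⟩ := h2.exists_bound_of_continuous h1.continuous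
  refine ⟨Reg.of_lip h1.continuous.measurable (K := K) hK fun δ _ => ⟨C, fun x y _ => ?_⟩, ?_⟩
  · have := hC.dist_le_mul x y
    simpa [Real.dist_eq] using this
  · have hopen : IsOpen (tsupport φ)ᶜ := (isClosed_tsupport φ).isOpen_compl
    obtain ⟨δ, hδ, hball⟩ := Metric.isOpen_iff.mp hopen 0 h3
    obtain ⟨S, hS⟩ := h2.isCompact.isBounded.subset_closedBall 0
    refine ⟨δ, hδ, S, fun x hx => ?_⟩
    by_contra hne
    have hx' : x ∈ tsupport φ := subset_tsupport φ hne
    refine hx ⟨?_, ?_⟩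
    · by_contra hlt
      push Not at hlt
      exact hball (show x ∈ Metric.ball 0 δ by simpa [Real.dist_eq] using hlt) hx'
    · have := hS hx'
      simpa [Real.dist_eq] using this

lemma weak_dual (hγ : γ ∈ Set.Ico (1 / 3 : ℝ) (1 / 2)) (hα : α ∈ Set.Ioo (0 : ℝ) (1 / 2))
    {u F : ℝ → ℝ} {I : Set ℝ} (hu : Measurable u) (hb : ∃ K, ∀ x, |u x| ≤ K)
    (hw : IsWeakSol γ α u F I) {φ : ℝ → ℝ} (h1 : ContDiff ℝ (⊤ : ℕ∞) φ) (h2 : HasCompactSupport φ)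
    (h3 : (0 : ℝ) ∉ tsupport φ) (h4 : tsupport φ ⊆ I) :
    ∫ x, u x * Lop γ α φ x = ∫ x, F x * φ x := by
  obtain ⟨hr, hs⟩ := smooth_reg h1 h2 h3
  rw [← (hw φ h1 h2 h4).2, ← pair_right hγ hα hu hb hr hs]
  have hi := hr.int_diff_mul hγ hα hu hb hs
  have e : ∀ q : ℝ × ℝ, (u q.1 - u q.2) * (φ q.1 - φ q.2) * cknK γ α q.1 q.2 =
      u q.1 * ((φ q.1 - φ q.2) * cknK γ α q.1 q.2) +
      (fun q : ℝ × ℝ => u q.1 * ((φ q.1 - φ q.2) * cknK γ α q.1 q.2)) q.swap := by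
    intro q
    simp only [Prod.fst_swap, Prod.snd_swap]
    rw [cknK_symm γ α q.2 q.1]; ring
  have e2 : ∫ q : ℝ × ℝ, (u q.1 - u q.2) * (φ q.1 - φ q.2) * cknK γ α q.1 q.2 =
      (∫ q : ℝ × ℝ, u q.1 * ((φ q.1 - φ q.2) * cknK γ α q.1 q.2)) +
      ∫ q : ℝ × ℝ, (fun q : ℝ × ℝ => u q.1 * ((φ q.1 - φ q.2) * cknK γ α q.1 q.2)) q.swap := by
    rw [integral_congr_ae (ae_of_all _ e)]
    exact integral_add hi hi.swap
  rw [e2, integral_swap_prod (fun q : ℝ × ℝ => u q.1 * ((φ q.1 - φ q.2) * cknK γ α q.1 q.2))]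
  ring

lemma Lop_scale (φ : ℝ → ℝ) {l : ℝ} (hl : 0 < l) (x : ℝ) :
    Lop γ α (fun x => φ (l⁻¹ * x)) (l * x) = l ^ (-(2 * γ + 2 * α)) * Lop γ α φ x := by
  unfold Lop
  have h := Measure.integral_comp_mul_left
    (fun y => (φ (l⁻¹ * (l * x)) - φ (l⁻¹ * y)) * cknK γ α (l * x) y) l
  have e : ∀ y, (φ (l⁻¹ * (l * x)) - φ (l⁻¹ * (l * y))) * cknK γ α (l * x) (l * y) =
      l ^ (-(1 + 2 * γ + 2 * α)) * ((φ x - φ y) * cknK γ α x y) := by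
    intro y
    rw [cknK_smul γ α x y hl.ne', abs_of_pos hl, inv_mul_cancel_left₀ hl.ne',
      inv_mul_cancel_left₀ hl.ne']
    ring
  simp_rw [e] at h
  rw [integral_const_mul, abs_of_pos (inv_pos.mpr hl), smul_eq_mul] at h
  have h2 : l ^ (-(2 * γ + 2 * α)) = l * l ^ (-(1 + 2 * γ + 2 * α)) := by
    nth_rewrite 2 [← Real.rpow_one l]
    rw [← Real.rpow_add hl]
    congr 1; ring
  rw [h2, mul_assoc, h, ← mul_assoc, mul_inv_cancel₀ hl.ne', one_mul]

lemma Lop_int (hγ : γ ∈ Set.Ico (1 / 3 : ℝ) (1 / 2)) (hα : α ∈ Set.Ioo (0 : ℝ) (1 / 2))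
    {φ : ℝ → ℝ} (hr : Reg φ) (hs : Supp0 φ) : Integrable (Lop γ α φ) := by
  have h := hr.int_diff hγ hα hs
  rw [Measure.volume_eq_prod] at h
  exact h.integral_prod_left

lemma weak_scale (hγ : γ ∈ Set.Ico (1 / 3 : ℝ) (1 / 2)) (hα : α ∈ Set.Ioo (0 : ℝ) (1 / 2))
    {u F : ℝ → ℝ} {L l : ℝ} (hl : 0 < l) (hu : Measurable u) (hb : ∃ K, ∀ x, |u x| ≤ K)
    (hw : IsWeakSol γ α u F (Set.Ioo (-L) L)) {φ : ℝ → ℝ} (h1 : ContDiff ℝ (⊤ : ℕ∞) φ)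
    (h2 : HasCompactSupport φ) (h3 : (0 : ℝ) ∉ tsupport φ)
    (h4 : ∀ x ∈ tsupport φ, l * |x| < L) :
    ∫ x, u (l * x) * Lop γ α φ x = ∫ x, l ^ (2 * γ + 2 * α) * (F (l * x) * φ x) := by
  let e := Homeomorph.mulLeft₀ l⁻¹ (inv_ne_zero hl.ne')
  let ψ : ℝ → ℝ := fun x => φ (l⁻¹ * x)
  have hψ : ψ = φ ∘ e := rfl
  have ht : tsupport ψ = e ⁻¹' tsupport φ := by rw [hψ]; exact tsupport_comp_eq_preimage φ e
  have hψ1 : ContDiff ℝ (⊤ : ℕ∞) ψ := h1.comp (contDiff_const.mul contDiff_id)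
  have hψ2 : HasCompactSupport ψ := h2.comp_homeomorph e
  have key := weak_dual hγ hα hu hb hw hψ1 hψ2
    (by rw [ht]; simpa [e] using h3)
    (by
      intro x hx
      rw [ht] at hx
      have := h4 _ hx
      have h5 : (e x : ℝ) = l⁻¹ * x := rfl
      rw [h5, abs_mul, abs_of_pos (inv_pos.mpr hl), mul_inv_cancel_left₀ hl.ne'] at this
      exact abs_lt.mp this)
  have hs := Measure.integral_comp_mul_left (fun x => u x * Lop γ α ψ x) l
  have hs2 := Measure.integral_comp_mul_left (fun x => F x * ψ x) l
  rw [key, ← hs2] at hs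
  have e1 : ∀ x, u (l * x) * Lop γ α φ x =
      l ^ (2 * γ + 2 * α) * (u (l * x) * Lop γ α ψ (l * x)) := by
    intro x
    rw [Lop_scale φ hl x, Real.rpow_neg hl.le]
    field_simp
  simp_rw [e1]
  rw [integral_const_mul, hs, integral_const_mul]
  congr 2
  ext x
  simp only [ψ, inv_mul_cancel_left₀ hl.ne']

/-- Averaged right hand side. -/
noncomputable def Fav (γ α ε : ℝ) (F : ℝ → ℝ) (x : ℝ) : ℝ :=
  (1 / ε) * ∫ l in (1 : ℝ)..(1 + ε), l ^ (2 * γ + 2 * α) * F (l * x)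

lemma Av_weak (hγ : γ ∈ Set.Ico (1 / 3 : ℝ) (1 / 2)) (hα : α ∈ Set.Ioo (0 : ℝ) (1 / 2))
    {u F : ℝ → ℝ} {L ε : ℝ} (hε : 0 < ε) (hu : Measurable u) (hb : ∃ K, ∀ x, |u x| ≤ K)
    (hF : Measurable F) (hFb : ∀ δ > 0, ∃ C, ∀ x, δ ≤ |x| → |F x| ≤ C)
    (hw : IsWeakSol γ α u F (Set.Ioo (-L) L)) {φ : ℝ → ℝ} (h1 : ContDiff ℝ (⊤ : ℕ∞) φ)
    (h2 : HasCompactSupport φ) (h3 : (0 : ℝ) ∉ tsupport φ)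
    (h4 : ∀ x ∈ tsupport φ, (1 + ε) * |x| < L) :
    ∫ x, φ x * Lop γ α (Av ε u) x = ∫ x, φ x * Fav γ α ε F x := by
  obtain ⟨K, hK⟩ := hb
  obtain ⟨hr, hs⟩ := smooth_reg h1 h2 h3
  have hA := Av_reg hε hu hK
  rw [← pair_left hγ hα hA hr.1 hr.2.1 hs, duality hγ hα hA hr hs,
    pair_right hγ hα hA.1 hA.2.1 hr hs]
  have hLi := Lop_int hγ hα hr hs
  have hle : (1 : ℝ) ≤ 1 + ε := by linarith
  let ν := (volume : Measure ℝ).restrict (Set.Ioc (1 : ℝ) (1 + ε))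
  have : IsFiniteMeasure ν := by
    refine ⟨?_⟩; simp [ν]
  have hnt1 : Integrable (fun q : ℝ × ℝ => u (q.2 * q.1) * Lop γ α φ q.1) (volume.prod ν) := by
    refine (hLi.comp_fst ν).bdd_mul (c := K) (f := fun q : ℝ × ℝ => u (q.2 * q.1)) ?_
      (ae_of_all _ fun q => hK _)
    have : Measurable (fun q : ℝ × ℝ => u (q.2 * q.1)) := by fun_prop
    exact this.aestronglyMeasurable
  obtain ⟨δ, hδ, S, hS⟩ := hs
  obtain ⟨C, hC⟩ := hFb δ hδ
  have hφi : Integrable φ := h1.continuous.integrable_of_hasCompactSupport h2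
  have hφm := hr.1
  have hnt2 : Integrable (fun q : ℝ × ℝ => q.2 ^ (2 * γ + 2 * α) * (F (q.2 * q.1) * φ q.1))
      (volume.prod ν) := by
    refine ((hφi.norm.comp_fst ν).const_mul ((1 + ε) ^ (2 * γ + 2 * α) * C)).mono' ?_ ?_
    · have : Measurable (fun q : ℝ × ℝ => q.2 ^ (2 * γ + 2 * α) * (F (q.2 * q.1) * φ q.1)) := by
        fun_prop
      exact this.aestronglyMeasurable
    · have hae : ∀ᵐ q : ℝ × ℝ ∂(volume.prod ν), q.2 ∈ Set.Ioc (1 : ℝ) (1 + ε) :=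
        Measure.quasiMeasurePreserving_snd.ae (ae_restrict_mem measurableSet_Ioc)
      filter_upwards [hae] with q hq
      have hq0 : 0 ≤ q.2 := by linarith [hq.1]
      by_cases hx : δ ≤ |q.1| ∧ |q.1| ≤ S
      · rw [norm_mul, norm_mul, Real.norm_eq_abs, abs_of_nonneg (Real.rpow_nonneg hq0 _), mul_assoc]
        have hc : ‖F (q.2 * q.1)‖ ≤ C := hC _ (by
          rw [abs_mul, abs_of_nonneg hq0]; nlinarith [hq.1, abs_nonneg q.1, hx.1])
        have : (0:ℝ) ≤ 2 * γ + 2 * α := by linarith [hγ.1, hα.1]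
        gcongr
        exact hq.2
      · simp [hS q.1 hx]
  have hl : ∀ l ∈ Set.Ioc (1 : ℝ) (1 + ε), ∫ x, u (l * x) * Lop γ α φ x =
      ∫ x, l ^ (2 * γ + 2 * α) * (F (l * x) * φ x) := by
    intro l hl
    refine weak_scale hγ hα (by linarith [hl.1]) hu ⟨K, hK⟩ hw h1 h2 h3 fun x hx => ?_
    refine lt_of_le_of_lt ?_ (h4 x hx)
    exact mul_le_mul_of_nonneg_right hl.2 (abs_nonneg _)
  have s1 := integral_integral_swap (f := fun x l => u (l * x) * Lop γ α φ x)
    (μ := volume) (ν := ν) hnt1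
  have s2 := integral_integral_swap (f := fun x l => l ^ (2 * γ + 2 * α) * (F (l * x) * φ x))
    (μ := volume) (ν := ν) hnt2
  have s3 : ∫ l, ∫ x, u (l * x) * Lop γ α φ x ∂volume ∂ν =
      ∫ l, ∫ x, l ^ (2 * γ + 2 * α) * (F (l * x) * φ x) ∂volume ∂ν :=
    setIntegral_congr_fun measurableSet_Ioc hl
  simp only [Av, Fav, intervalIntegral.integral_of_le hle]
  calc ∫ x, (1 / ε * ∫ l in Set.Ioc (1 : ℝ) (1 + ε), u (l * x)) * Lop γ α φ x
      = (1 / ε) * ∫ x, ∫ l, u (l * x) * Lop γ α φ x ∂ν := by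
        rw [← integral_const_mul]
        congr 1; ext x
        rw [integral_mul_const]; ring
    _ = (1 / ε) * ∫ x, ∫ l, l ^ (2 * γ + 2 * α) * (F (l * x) * φ x) ∂ν := by
        rw [s1, s3, s2]
    _ = _ := by
        rw [← integral_const_mul]
        congr 1; ext x
        simp_rw [← mul_assoc]
        rw [integral_mul_const]; ring

lemma Fav_meas {ε : ℝ} (hε : 0 < ε) {F : ℝ → ℝ} (hF : Measurable F) : Measurable (Fav γ α ε F) := by
  unfold Fav
  refine Measurable.const_mul ?_ _
  simp_rw [intervalIntegral.integral_of_le (by linarith : (1 : ℝ) ≤ 1 + ε)]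
  have : Measurable (fun q : ℝ × ℝ => q.2 ^ (2 * γ + 2 * α) * F (q.2 * q.1)) := by fun_prop
  exact (this.stronglyMeasurable.integral_prod_right
    (ν := (volume.restrict (Set.Ioc (1 : ℝ) (1 + ε))))).measurable

lemma Fav_bdd (hγ : γ ∈ Set.Ico (1 / 3 : ℝ) (1 / 2)) (hα : α ∈ Set.Ioo (0 : ℝ) (1 / 2))
    {ε : ℝ} (hε : 0 < ε) (hε1 : ε ≤ 1) {F : ℝ → ℝ} {K x : ℝ}
    (h : ∀ l ∈ Set.Icc 1 (1 + ε), |F (l * x)| ≤ K) : |Fav γ α ε F x| ≤ 4 * K := by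
  have h1 : ‖∫ l in (1 : ℝ)..(1 + ε), l ^ (2 * γ + 2 * α) * F (l * x)‖ ≤ (4 * K) * |1 + ε - 1| := by
    refine intervalIntegral.norm_integral_le_of_norm_le_const fun l hl => ?_
    rw [Set.uIoc_of_le (by linarith)] at hl
    have := h l ⟨hl.1.le, hl.2⟩
    have hl0 : 0 ≤ l := by linarith [hl.1]
    rw [norm_mul, Real.norm_eq_abs, Real.norm_eq_abs, abs_of_nonneg (Real.rpow_nonneg hl0 _)]
    refine mul_le_mul ?_ this (abs_nonneg _) (by norm_num)
    calc l ^ (2 * γ + 2 * α) ≤ l ^ (2 : ℝ) :=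
          Real.rpow_le_rpow_of_exponent_le hl.1.le (by linarith [hγ.2, hα.2])
      _ = l ^ 2 := by norm_num
      _ ≤ 4 := by nlinarith [hl.2, hl.1]
  rw [Real.norm_eq_abs, add_sub_cancel_left, abs_of_pos hε] at h1
  rw [Fav, abs_mul, abs_of_pos (by positivity : 0 < 1 / ε)]
  calc 1 / ε * |∫ l in (1 : ℝ)..(1 + ε), l ^ (2 * γ + 2 * α) * F (l * x)|
      ≤ 1 / ε * ((4 * K) * ε) := by gcongr
    _ = _ := by field_simp

lemma Av_Lop (hγ : γ ∈ Set.Ico (1 / 3 : ℝ) (1 / 2)) (hα : α ∈ Set.Ioo (0 : ℝ) (1 / 2))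
    {u F : ℝ → ℝ} {L ε : ℝ} (hε : 0 < ε) (hε1 : ε ≤ 1) (hu : Measurable u)
    (hb : ∃ K, ∀ x, |u x| ≤ K)
    (hF : Measurable F) (hFb : ∀ δ > 0, ∃ C, ∀ x, δ ≤ |x| → |F x| ≤ C)
    (hw : IsWeakSol γ α u F (Set.Ioo (-L) L)) :
    ∀ᵐ x : ℝ, (1 + ε) * |x| < L → Lop γ α (Av ε u) x = Fav γ α ε F x := by
  have hb' := hb
  obtain ⟨K, hK⟩ := hb
  have hA := Av_reg hε hu hK
  let U : Set ℝ := {x | x ≠ 0 ∧ (1 + ε) * |x| < L}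
  have hU : IsOpen U := by
    have o1 : IsOpen {x : ℝ | x ≠ 0} := isOpen_ne
    have o2 : IsOpen {x : ℝ | (1 + ε) * |x| < L} := isOpen_lt (by fun_prop) continuous_const
    exact o1.inter o2
  have hm : Measurable (fun x => Lop γ α (Av ε u) x - Fav γ α ε F x) :=
    (Lop_meas hA.1).sub (Fav_meas hε hF)
  have hbd : ∀ δ > 0, ∃ C, ∀ x, δ ≤ |x| → |Lop γ α (Av ε u) x - Fav γ α ε F x| ≤ C := by
    intro δ hδ
    obtain ⟨C1, hC1⟩ := Lop_bdd hγ hα hA hδ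
    obtain ⟨C2, hC2⟩ := hFb δ hδ
    refine ⟨C1 + 4 * C2, fun x hx => (abs_sub _ _).trans (add_le_add (hC1 x hx) ?_)⟩
    refine Fav_bdd hγ hα hε hε1 fun l hl => hC2 _ ?_
    rw [abs_mul, abs_of_nonneg (by linarith [hl.1])]
    nlinarith [hl.1, abs_nonneg x]
  have hli : LocallyIntegrableOn (fun x => Lop γ α (Av ε u) x - Fav γ α ε F x) U := by
    intro x hx
    have hx0 : 0 < |x| := abs_pos.mpr hx.1
    obtain ⟨C, hC⟩ := hbd (|x| / 2) (by positivity)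
    refine ⟨Metric.ball x (|x| / 2), mem_nhdsWithin_of_mem_nhds (Metric.ball_mem_nhds x (by positivity)), ?_⟩
    refine Measure.integrableOn_of_bounded (M := C) measure_ball_lt_top.ne hm.aestronglyMeasurable ?_
    refine (ae_restrict_iff' measurableSet_ball).mpr (ae_of_all _ fun y hy => hC y ?_)
    rw [Metric.mem_ball, Real.dist_eq] at hy
    have := abs_sub_abs_le_abs_sub x y
    rw [abs_sub_comm] at this
    linarith
  have key := hU.ae_eq_zero_of_integral_contDiff_smul_eq_zero hli ?_
  · have h0 : ∀ᵐ x : ℝ, x ≠ 0 := by simp [ae_iff]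
    filter_upwards [key, h0] with x hx hx0 hxL
    exact sub_eq_zero.mp (hx ⟨hx0, hxL⟩)
  · intro φ h1 h2 h3
    have h30 : (0 : ℝ) ∉ tsupport φ := fun h => (h3 h).1 rfl
    have hw' := Av_weak hγ hα hε hu hb' hF hFb hw h1 h2 h30 (fun x hx => (h3 hx).2)
    obtain ⟨hr, hs⟩ := smooth_reg h1 h2 h30
    have hφi : Integrable φ := h1.continuous.integrable_of_hasCompactSupport h2
    obtain ⟨δ, hδ, S, hS⟩ := hs
    have hnt : ∀ G : ℝ → ℝ, Measurable G → (∃ C, ∀ x, δ ≤ |x| → |G x| ≤ C) →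
        Integrable (fun x => φ x * G x) := by
      rintro G hG ⟨C, hC⟩
      refine (hφi.norm.const_mul C).mono' (hr.1.mul hG).aestronglyMeasurable
        (ae_of_all _ fun x => ?_)
      by_cases hx : δ ≤ |x| ∧ |x| ≤ S
      · rw [norm_mul, mul_comm]
        exact mul_le_mul_of_nonneg_right (hC x hx.1) (norm_nonneg _)
      · simp [hS x hx]
    simp only [smul_eq_mul, mul_sub]
    rw [integral_sub, hw', sub_self]
    · exact hnt _ (Lop_meas hA.1) (Lop_bdd hγ hα hA hδ)
    · refine hnt _ (Fav_meas hε hF) ?_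
      obtain ⟨C2, hC2⟩ := hFb δ hδ
      refine ⟨4 * C2, fun x hx => Fav_bdd hγ hα hε hε1 fun l hl => hC2 _ ?_⟩
      rw [abs_mul, abs_of_nonneg (by linarith [hl.1])]
      nlinarith [hl.1, abs_nonneg x]
end

lemma rpow_lip {q δ x y : ℝ} (hq : 0 < q) (hq1 : q ≤ 1) (hδ : 0 < δ) (hx : δ ≤ |x|) :
    |(|x| ^ q - |y| ^ q)| ≤ δ ^ (q - 1) * |x - y| := by
  have ha : 0 < |x| := hδ.trans_le hx
  have hb : 0 ≤ |y| := abs_nonneg y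
  have h1 : |x| ^ (q - 1) ≤ δ ^ (q - 1) := Real.rpow_le_rpow_of_nonpos hδ hx (by linarith)
  have h2 : |(|x| - |y|)| ≤ |x - y| := abs_abs_sub_abs_le _ _
  have e : |x| ^ q = |x| ^ (q - 1) * |x| := by
    rw [← Real.rpow_add_one ha.ne']; congr 1; ring
  have e2 : |y| ^ q = |x| ^ q * (|y| / |x|) ^ q := by
    rw [← Real.mul_rpow ha.le (by positivity)]; congr 1; field_simp
  have h3 : |(|x| ^ q - |y| ^ q)| ≤ |x| ^ (q - 1) * |(|x| - |y|)| := by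
    have hp : 0 ≤ |x| ^ q := by positivity
    rcases le_total |y| |x| with h | h
    · have ht : |y| / |x| ≤ (|y| / |x|) ^ q := by
        have := Real.rpow_le_rpow_of_exponent_ge' (x := |y| / |x|) (by positivity)
          (by rw [div_le_one ha]; exact h) hq.le hq1
        simpa using this
      rw [abs_of_nonneg (by linarith : 0 ≤ |x| - |y|),
        abs_of_nonneg (sub_nonneg.mpr (Real.rpow_le_rpow hb h hq.le)), e2]
      have : |x| ^ q * (|y| / |x|) = |x| ^ (q - 1) * |y| := by rw [e]; field_simp
      nlinarith [mul_le_mul_of_nonneg_left ht hp]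
    · have ht : (|y| / |x|) ^ q ≤ |y| / |x| := by
        have := Real.rpow_le_rpow_of_exponent_le (x := |y| / |x|)
          (by rw [le_div_iff₀ ha]; linarith) hq1
        simpa using this
      rw [abs_of_nonpos (by linarith : |x| - |y| ≤ 0),
        abs_of_nonpos (sub_nonpos.mpr (Real.rpow_le_rpow ha.le h hq.le)), e2]
      have : |x| ^ q * (|y| / |x|) = |x| ^ (q - 1) * |y| := by rw [e]; field_simp
      nlinarith [mul_le_mul_of_nonneg_left ht hp]
  refine h3.trans ?_
  gcongr

/-- Truncated power. -/
noncomputable def om (q x : ℝ) : ℝ := min (|x| ^ q) (max 0 (2 - |x|))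

lemma om_nonneg (q x : ℝ) : 0 ≤ om q x := le_min (by positivity) (le_max_left _ _)

lemma om_le (q x : ℝ) : om q x ≤ |x| ^ q := min_le_left _ _

lemma om_eq {q x : ℝ} (hq : 0 < q) (hx : |x| ≤ 1) : om q x = |x| ^ q := by
  refine min_eq_left ((Real.rpow_le_one (abs_nonneg _) hx hq.le).trans (le_max_of_le_right ?_))
  linarith

lemma om_zero {q x : ℝ} (hx : 2 ≤ |x|) : om q x = 0 := by
  unfold om
  rw [max_eq_left (by linarith), min_eq_right (by positivity)]

lemma om_meas (q : ℝ) : Measurable (om q) := by unfold om; fun_prop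

lemma om_le_two (q x : ℝ) : om q x ≤ 2 :=
  (min_le_right _ _).trans (max_le (by norm_num) (by linarith [abs_nonneg x]))

lemma om_reg {q : ℝ} (hq : 0 < q) (hq1 : q ≤ 1) : Reg (om q) := by
  refine Reg.of_lip (om_meas q) (K := 2) (fun x => ?_) fun δ hδ => ?_
  · rw [abs_of_nonneg (om_nonneg q x)]; exact om_le_two q x
  · refine ⟨max (δ ^ (q - 1)) 1, fun x y hx => ?_⟩
    unfold om
    refine (abs_min_sub_min_le_max _ _ _ _).trans (max_le ?_ ?_)
    · exact (rpow_lip hq hq1 hδ hx).trans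
        (mul_le_mul_of_nonneg_right (le_max_left _ _) (abs_nonneg _))
    · have h1 := abs_max_sub_max_le_max 0 (2 - |x|) 0 (2 - |y|)
      have h2 : |2 - |x| - (2 - |y|)| ≤ |x - y| := by
        rw [show 2 - |x| - (2 - |y|) = -(|x| - |y|) by ring, abs_neg]
        exact abs_abs_sub_abs_le _ _
      have h3 : |x - y| ≤ max (δ ^ (q - 1)) 1 * |x - y| :=
        le_mul_of_one_le_left (abs_nonneg _) (le_max_right _ _)
      refine h1.trans (max_le ?_ (h2.trans h3))
      simp only [sub_self, abs_zero]; positivity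

section
variable {γ α : ℝ}

lemma inv_identity {a b d : ℝ} (ha : 0 < a) (hb : 0 < b) (hd : 0 ≤ d) :
    a ^ 2 / b ^ 2 * ((a ^ (2 * γ + 2 * α - 1) - (a ^ 2 / b) ^ (2 * γ + 2 * α - 1)) *
      ((a * d / b) ^ (-(1 + 2 * γ)) * (a ^ (-α) * (a ^ 2 / b) ^ (-α)))) =
    -((a ^ (2 * γ + 2 * α - 1) - b ^ (2 * γ + 2 * α - 1)) *
      (d ^ (-(1 + 2 * γ)) * (a ^ (-α) * b ^ (-α)))) := by
  rw [Real.div_rpow (by positivity) hb.le, Real.div_rpow (by positivity) hb.le,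
    Real.div_rpow (by positivity) hb.le, Real.mul_rpow ha.le hd]
  have e1 : ∀ p : ℝ, (a ^ 2) ^ p = a ^ p * a ^ p := by
    intro p; rw [sq, Real.mul_rpow ha.le ha.le]
  rw [e1, e1]
  have A : a ^ (2 * γ + 2 * α - 1) * a ^ (-(1 + 2 * γ)) * a ^ (-α) * a ^ (-α) * a ^ 2 = 1 := by
    rw [← Real.rpow_natCast a 2, ← Real.rpow_add ha, ← Real.rpow_add ha, ← Real.rpow_add ha,
      ← Real.rpow_add ha]
    rw [show 2 * γ + 2 * α - 1 + -(1 + 2 * γ) + -α + -α + ((2 : ℕ) : ℝ) = 0 by push_cast; ring,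
      Real.rpow_zero]
  have B : b ^ (2 * γ + 2 * α - 1) * b ^ (-(1 + 2 * γ)) * b ^ (-α) * b ^ (-α) * b ^ 2 = 1 := by
    rw [← Real.rpow_natCast b 2, ← Real.rpow_add hb, ← Real.rpow_add hb, ← Real.rpow_add hb,
      ← Real.rpow_add hb]
    rw [show 2 * γ + 2 * α - 1 + -(1 + 2 * γ) + -α + -α + ((2 : ℕ) : ℝ) = 0 by push_cast; ring,
      Real.rpow_zero]
  have p1 : 0 < b ^ (2 * γ + 2 * α - 1) := by positivity
  have p2 : 0 < b ^ (-(1 + 2 * γ)) := by positivity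
  have p3 : 0 < b ^ (-α) := by positivity
  generalize a ^ (2 * γ + 2 * α - 1) = X at *
  generalize a ^ (-(1 + 2 * γ)) = Y at *
  generalize a ^ (-α) = Z at *
  generalize b ^ (2 * γ + 2 * α - 1) = X' at *
  generalize b ^ (-(1 + 2 * γ)) = Y' at *
  generalize b ^ (-α) = Z' at *
  generalize d ^ (-(1 + 2 * γ)) = D at *
  have e : a ^ 2 / b ^ 2 * ((X - X * X / X') * (Y * D / Y' * (Z * (Z * Z / Z')))) =
    (X * Y * Z * Z * a ^ 2) * ((X' - X) * D * Z) / (X' * Y' * Z' * Z' * b ^ 2) * Z' := by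
    field_simp
  rw [e, A, B]; ring

lemma pow_zero_int (x : ℝ) (hx : x ≠ 0) :
    ∫ y, (|x| ^ (2 * γ + 2 * α - 1) - |y| ^ (2 * γ + 2 * α - 1)) * cknK γ α x y = 0 := by
  set G : ℝ → ℝ := fun y =>
    (|x| ^ (2 * γ + 2 * α - 1) - |y| ^ (2 * γ + 2 * α - 1)) * cknK γ α x y with hG
  have hs : MeasurableSet ({0}ᶜ : Set ℝ) := (measurableSet_singleton 0).compl
  have hx2 : x ^ 2 ≠ 0 := pow_ne_zero 2 hx
  have him : (fun y => x ^ 2 / y) '' ({0}ᶜ : Set ℝ) = {0}ᶜ := by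
    ext z
    simp only [Set.mem_image, Set.mem_compl_iff, Set.mem_singleton_iff]
    constructor
    · rintro ⟨y, hy, rfl⟩; exact div_ne_zero hx2 hy
    · intro hz
      exact ⟨x ^ 2 / z, div_ne_zero hx2 hz, by field_simp⟩
  have hcv := integral_image_eq_integral_abs_deriv_smul (s := ({0}ᶜ : Set ℝ))
    (f := fun y => x ^ 2 / y) (f' := fun y => - (x ^ 2) / y ^ 2) hs
    (fun y hy => by
      have h1 := (hasDerivAt_inv (𝕜 := ℝ) (x := y) hy).const_mul (x ^ 2)
      have h2 : HasDerivAt (fun y => x ^ 2 / y) (- (x ^ 2) / y ^ 2) y := by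
        refine h1.congr_deriv ?_
        field_simp
      exact h2.hasDerivWithinAt)
    (fun y hy z hz hyz => by
      have hy' : y ≠ 0 := hy
      have hz' : z ≠ 0 := hz
      simp only at hyz
      rw [div_eq_div_iff hy' hz'] at hyz
      exact (mul_left_cancel₀ hx2 hyz).symm) G
  rw [him] at hcv
  have h2 : ∫ y in ({0}ᶜ : Set ℝ), |-(x ^ 2) / y ^ 2| • G (x ^ 2 / y) = ∫ y in ({0}ᶜ : Set ℝ), - G y := by
    refine setIntegral_congr_fun hs fun y hy => ?_
    have hy' : y ≠ 0 := hy
    simp only [smul_eq_mul, hG, cknK]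
    have := inv_identity (γ := γ) (α := α) (abs_pos.mpr hx) (abs_pos.mpr hy') (abs_nonneg (x - y))
    rw [← this]
    have e1 : |-(x ^ 2) / y ^ 2| = |x| ^ 2 / |y| ^ 2 := by
      rw [abs_div, abs_neg, abs_pow, abs_pow]
    have e2 : |x ^ 2 / y| = |x| ^ 2 / |y| := by rw [abs_div, abs_pow]
    have e3 : |x - x ^ 2 / y| = |x| * |x - y| / |y| := by
      rw [show x - x ^ 2 / y = x * (y - x) / y by field_simp, abs_div, abs_mul, abs_sub_comm y x]
    rw [e1, e2, e3]
  rw [h2, integral_neg] at hcv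
  have h3 : ∫ y in ({0}ᶜ : Set ℝ), G y = ∫ y, G y := by
    rw [Measure.restrict_congr_set (t := Set.univ), Measure.restrict_univ]
    rw [ae_eq_univ]; simp
  rw [h3] at hcv
  linarith

lemma D_int (hα : α ∈ Set.Ioo (0 : ℝ) (1 / 2)) (hγ : γ ∈ Set.Ico (1 / 3 : ℝ) (1 / 2))
    (hq : 0 < 2 * γ + 2 * α - 1) : ∃ C : ℝ, 0 ≤ C ∧ ∀ x, |x| < 1 / 2 →
    Integrable (fun y => (|y| ^ (2 * γ + 2 * α - 1) - om (2 * γ + 2 * α - 1) y) * cknK γ α x y) ∧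
    ∫ y, (|y| ^ (2 * γ + 2 * α - 1) - om (2 * γ + 2 * α - 1) y) * cknK γ α x y ≤ C * |x| ^ (-α) := by
  set q := 2 * γ + 2 * α - 1
  have hlarge := lint_abs_rpow_large (s := 2 - α) (by linarith [hα.2])
  have hS : MeasurableSet {x : ℝ | 1 ≤ |x|} := measurableSet_le measurable_const (by fun_prop)
  have hi : Integrable ({x : ℝ | 1 ≤ |x|}.indicator (fun x => |x| ^ (-(2 - α)))) := by
    rw [integrable_indicator_iff hS]
    have hmm : Measurable (fun x : ℝ => |x| ^ (-(2 - α))) := by fun_prop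
    refine ⟨hmm.aestronglyMeasurable, ?_⟩
    rw [hasFiniteIntegral_iff_norm]
    refine lt_of_le_of_lt (lintegral_mono fun x => ?_) hlarge.lt_top
    rw [Real.norm_eq_abs, abs_of_nonneg (by positivity)]
  refine ⟨4 * ∫ y, {x : ℝ | 1 ≤ |x|}.indicator (fun x => |x| ^ (-(2 - α))) y,
    mul_nonneg (by norm_num) (integral_nonneg fun y => Set.indicator_nonneg (fun _ _ => by positivity) _),
    fun x hx => ?_⟩
  have hb : ∀ y, (|y| ^ q - om q y) * cknK γ α x y ≤
      (4 * |x| ^ (-α)) * {x : ℝ | 1 ≤ |x|}.indicator (fun x => |x| ^ (-(2 - α))) y := by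
    intro y
    rcases le_total |y| 1 with h | h
    · rw [om_eq hq h, sub_self, zero_mul]
      exact mul_nonneg (by positivity) (Set.indicator_nonneg (fun _ _ => by positivity) _)
    · rw [Set.indicator_of_mem (by exact h)]
      have hy : 0 < |y| := by linarith
      have h1 : |y| / 2 ≤ |x - y| := by
        have := abs_sub_abs_le_abs_sub y x
        rw [abs_sub_comm] at this; linarith
      have h2 : |x - y| ^ (-(1 + 2 * γ)) ≤ 4 * |y| ^ (-(1 + 2 * γ)) := by
        calc |x - y| ^ (-(1 + 2 * γ)) ≤ (|y| / 2) ^ (-(1 + 2 * γ)) :=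
              Real.rpow_le_rpow_of_nonpos (by positivity) h1 (by linarith [hγ.1])
          _ = (2 : ℝ) ^ (1 + 2 * γ) * |y| ^ (-(1 + 2 * γ)) := by
              rw [Real.div_rpow hy.le (by norm_num), Real.rpow_neg (by norm_num : (0:ℝ) ≤ 2)]
              field_simp
          _ ≤ 4 * |y| ^ (-(1 + 2 * γ)) := by
              gcongr
              calc (2 : ℝ) ^ (1 + 2 * γ) ≤ (2 : ℝ) ^ (2 : ℝ) :=
                    Real.rpow_le_rpow_of_exponent_le (by norm_num) (by linarith [hγ.2])
                _ = 4 := by norm_num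
      have e : |y| ^ (-(2 - α)) = |y| ^ q * (|y| ^ (-(1 + 2 * γ)) * |y| ^ (-α)) := by
        rw [← Real.rpow_add hy, ← Real.rpow_add hy]; congr 1; simp only [q]; ring
      rw [e]
      unfold cknK
      have h3 : |y| ^ q - om q y ≤ |y| ^ q := by linarith [om_nonneg q y]
      calc (|y| ^ q - om q y) * (|x - y| ^ (-(1 + 2 * γ)) * (|x| ^ (-α) * |y| ^ (-α)))
          ≤ |y| ^ q * (4 * |y| ^ (-(1 + 2 * γ)) * (|x| ^ (-α) * |y| ^ (-α))) := by gcongr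
        _ = _ := by ring
  have hK := cknK_meas_right γ α x
  have hom := om_meas q
  have hnt : Integrable (fun y => (|y| ^ q - om q y) * cknK γ α x y) := by
    refine (hi.const_mul (4 * |x| ^ (-α))).mono' ?_ (ae_of_all _ fun y => ?_)
    · have : Measurable (fun y => (|y| ^ q - om q y) * cknK γ α x y) := by fun_prop
      exact this.aestronglyMeasurable
    · rw [Real.norm_eq_abs, abs_of_nonneg]
      · exact hb y
      · exact mul_nonneg (by linarith [om_le q y]) (cknK_nonneg _ _ _ _)
  refine ⟨hnt, ?_⟩
  calc _ ≤ ∫ y, (4 * |x| ^ (-α)) * {x : ℝ | 1 ≤ |x|}.indicator (fun x => |x| ^ (-(2 - α))) y :=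
        integral_mono hnt (hi.const_mul _) hb
    _ = _ := by rw [integral_const_mul]; ring

lemma pow_int (hα : α ∈ Set.Ioo (0 : ℝ) (1 / 2)) (hγ : γ ∈ Set.Ico (1 / 3 : ℝ) (1 / 2))
    (hq : 0 < 2 * γ + 2 * α - 1) {x : ℝ} (hx0 : x ≠ 0) (hx : |x| < 1 / 2) :
    Integrable (fun y => (|x| ^ (2 * γ + 2 * α - 1) - |y| ^ (2 * γ + 2 * α - 1)) * cknK γ α x y) := by
  obtain ⟨C, hC, h⟩ := D_int hα hγ hq
  have h1 := (om_reg hq (by linarith [hα.2, hγ.2])).integrable_y hγ hα hx0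
  refine (h1.sub (h x hx).1).congr (ae_of_all _ fun y => ?_)
  simp only [Pi.sub_apply]
  rw [om_eq hq (x := x) (by linarith)]; ring

lemma Lop_om_near (hα : α ∈ Set.Ioo (0 : ℝ) (1 / 2)) (hγ : γ ∈ Set.Ico (1 / 3 : ℝ) (1 / 2))
    (hq : 0 < 2 * γ + 2 * α - 1) : ∃ C : ℝ, 0 ≤ C ∧ ∀ x, x ≠ 0 → |x| < 1 / 2 →
    |Lop γ α (om (2 * γ + 2 * α - 1)) x| ≤ C * |x| ^ (-α) := by
  obtain ⟨C, hC, h⟩ := D_int hα hγ hq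
  refine ⟨C, hC, fun x hx0 hx => ?_⟩
  have e : Lop γ α (om (2 * γ + 2 * α - 1)) x =
      ∫ y, (|y| ^ (2 * γ + 2 * α - 1) - om (2 * γ + 2 * α - 1) y) * cknK γ α x y := by
    rw [← sub_zero (∫ y, (|y| ^ (2 * γ + 2 * α - 1) - om (2 * γ + 2 * α - 1) y) * cknK γ α x y)]
    have hz := pow_zero_int (γ := γ) (α := α) x hx0
    rw [sub_zero, ← add_zero (∫ y, _), ← hz, ← integral_add (h x hx).1 (pow_int hα hγ hq hx0 hx), Lop]
    congr 1; ext y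
    rw [om_eq hq (x := x) (by linarith)]; ring
  rw [e, abs_of_nonneg]
  · exact (h x hx).2
  · exact integral_nonneg fun y => mul_nonneg (by linarith [om_le (2 * γ + 2 * α - 1) y])
      (cknK_nonneg _ _ _ _)
end

lemma Reg.mul {f g : ℝ → ℝ} (hf : Reg f) (hg : Reg g) : Reg (fun x => f x * g x) := by
  obtain ⟨mf, ⟨Kf, kf⟩, lf⟩ := hf
  obtain ⟨mg, ⟨Kg, kg⟩, lg⟩ := hg
  have kf0 : 0 ≤ Kf := (abs_nonneg _).trans (kf 0)
  have kg0 : 0 ≤ Kg := (abs_nonneg _).trans (kg 0)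
  refine ⟨mf.mul mg, ⟨Kf * Kg, fun x => ?_⟩, fun δ hδ => ?_⟩
  · rw [abs_mul]; exact mul_le_mul (kf x) (kg x) (abs_nonneg _) kf0
  · obtain ⟨M1, h1, l1⟩ := lf δ hδ
    obtain ⟨M2, h2, l2⟩ := lg δ hδ
    refine ⟨M1 * Kg + Kf * M2, by positivity, fun x y hx => ?_⟩
    have a1 := l1 x y hx
    have a2 := l2 x y hx
    have hm : 0 ≤ min 1 |x - y| := by positivity
    rw [show f x * g x - f y * g y = (f x - f y) * g x + f y * (g x - g y) by ring]
    refine (abs_add_le _ _).trans ?_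
    rw [abs_mul, abs_mul]
    have b1 := mul_le_mul a1 (kg x) (abs_nonneg _) (by positivity)
    have b2 := mul_le_mul (kf y) a2 (abs_nonneg _) kf0
    calc _ ≤ _ := add_le_add b1 b2
      _ = _ := by ring

lemma Reg.sub {f g : ℝ → ℝ} (hf : Reg f) (hg : Reg g) : Reg (fun x => f x - g x) := by
  obtain ⟨mf, ⟨Kf, kf⟩, lf⟩ := hf
  obtain ⟨mg, ⟨Kg, kg⟩, lg⟩ := hg
  refine ⟨mf.sub mg, ⟨Kf + Kg, fun x => (abs_sub _ _).trans (add_le_add (kf x) (kg x))⟩, fun δ hδ => ?_⟩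
  obtain ⟨M1, h1, l1⟩ := lf δ hδ
  obtain ⟨M2, h2, l2⟩ := lg δ hδ
  refine ⟨M1 + M2, by positivity, fun x y hx => ?_⟩
  rw [show f x - g x - (f y - g y) = (f x - f y) - (g x - g y) by ring, add_mul]
  exact (abs_sub _ _).trans (add_le_add (l1 x y hx) (l2 x y hx))

lemma Reg.const (c : ℝ) : Reg (fun _ => c) :=
  Reg.of_lip measurable_const (K := |c|) (fun _ => le_rfl) fun _ _ => ⟨0, fun x y _ => by simp⟩

lemma Reg.lip {f : ℝ → ℝ} {K Λ : ℝ} (h0 : ∀ x, |f x| ≤ K) (hL : ∀ x y, |f x - f y| ≤ Λ * |x - y|) :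
    Reg f := by
  refine Reg.of_lip (K := K) ?_ h0 fun _ _ => ⟨Λ, fun x y _ => hL x y⟩
  have : LipschitzWith (Real.toNNReal Λ) f := by
    refine LipschitzWith.of_dist_le_mul fun x y => ?_
    rw [Real.dist_eq, Real.dist_eq]
    exact (hL x y).trans (mul_le_mul_of_nonneg_right (Real.le_coe_toNNReal Λ) (abs_nonneg _))
  exact this.continuous.measurable

lemma Reg.scale {f : ℝ → ℝ} (hf : Reg f) {l : ℝ} (hl : 0 < l) : Reg (fun x => f (l * x)) := by
  obtain ⟨mf, ⟨Kf, kf⟩, lf⟩ := hf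
  refine Reg.of_lip (by fun_prop) (K := Kf) (fun x => kf _) fun δ hδ => ?_
  obtain ⟨M, hM, h⟩ := lf (l * δ) (by positivity)
  refine ⟨M * l, fun x y hx => (h (l * x) (l * y) ?_).trans ?_⟩
  · rw [abs_mul, abs_of_pos hl]; gcongr
  · rw [← mul_sub, abs_mul, abs_of_pos hl, mul_assoc]
    gcongr
    exact min_le_right _ _

lemma Reg.min {f g : ℝ → ℝ} (hf : Reg f) (hg : Reg g) : Reg (fun x => Min.min (f x) (g x)) := by
  obtain ⟨mf, ⟨Kf, kf⟩, lf⟩ := hf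
  obtain ⟨mg, ⟨Kg, kg⟩, lg⟩ := hg
  refine ⟨mf.min mg, ⟨max Kf Kg, fun x => ?_⟩, fun δ hδ => ?_⟩
  · rcases min_choice (f x) (g x) with h | h <;> simp only [h]
    · exact (kf x).trans (le_max_left _ _)
    · exact (kg x).trans (le_max_right _ _)
  · obtain ⟨M1, h1, l1⟩ := lf δ hδ
    obtain ⟨M2, h2, l2⟩ := lg δ hδ
    refine ⟨max M1 M2, by positivity, fun x y hx => ?_⟩
    have hm : 0 ≤ Min.min 1 |x - y| := by positivity
    refine (abs_min_sub_min_le_max _ _ _ _).trans (max_le ?_ ?_)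
    · exact (l1 x y hx).trans (mul_le_mul_of_nonneg_right (le_max_left _ _) hm)
    · exact (l2 x y hx).trans (mul_le_mul_of_nonneg_right (le_max_right _ _) hm)

lemma measurableSet_le_abs (S : ℝ) : MeasurableSet {x : ℝ | |x| ≤ S} :=
  measurableSet_le (by fun_prop) measurable_const
lemma measurableSet_ge_abs (S : ℝ) : MeasurableSet {x : ℝ | S ≤ |x|} :=
  measurableSet_le measurable_const (by fun_prop)

lemma meas_abs_rpow (s : ℝ) : Measurable (fun x : ℝ => |x| ^ s) := by fun_prop

lemma int_small {s : ℝ} (hs : s < 1) (S : ℝ) :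
    Integrable ({x : ℝ | |x| ≤ S}.indicator (fun x => |x| ^ (-s))) := by
  rw [integrable_indicator_iff (measurableSet_le_abs S)]
  have e : {x : ℝ | |x| ≤ S} = Set.Icc (-S) S := by ext x; simp [abs_le]
  rw [e]; exact integrableOn_abs_rpow hs S

lemma int_large {s : ℝ} (hs : 1 < s) :
    Integrable ({x : ℝ | 1 ≤ |x|}.indicator (fun x => |x| ^ (-s))) := by
  rw [integrable_indicator_iff (measurableSet_ge_abs 1)]
  refine ⟨(meas_abs_rpow _).aestronglyMeasurable, ?_⟩
  rw [hasFiniteIntegral_iff_norm]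
  refine lt_of_le_of_lt (lintegral_mono fun x => ?_) (lint_abs_rpow_large hs).lt_top
  rw [Real.norm_eq_abs, abs_of_nonneg (by positivity)]

lemma rpow_half_le {γ a b : ℝ} (hγ : γ ∈ Set.Ico (1 / 3 : ℝ) (1 / 2)) (ha : 0 < a) (h : a / 2 ≤ b) :
    b ^ (-(1 + 2 * γ)) ≤ 4 * a ^ (-(1 + 2 * γ)) := by
  calc b ^ (-(1 + 2 * γ)) ≤ (a / 2) ^ (-(1 + 2 * γ)) :=
        Real.rpow_le_rpow_of_nonpos (by positivity) h (by linarith [hγ.1])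
    _ = (2 : ℝ) ^ (1 + 2 * γ) * a ^ (-(1 + 2 * γ)) := by
        rw [Real.div_rpow ha.le (by norm_num), Real.rpow_neg (by norm_num : (0:ℝ) ≤ 2)]
        field_simp
    _ ≤ 4 * a ^ (-(1 + 2 * γ)) := by
        gcongr
        calc (2 : ℝ) ^ (1 + 2 * γ) ≤ (2 : ℝ) ^ (2 : ℝ) :=
              Real.rpow_le_rpow_of_exponent_le (by norm_num) (by linarith [hγ.2])
          _ = 4 := by norm_num

section
variable {γ α : ℝ}

lemma Lop_om_int (hγ : γ ∈ Set.Ico (1 / 3 : ℝ) (1 / 2)) (hα : α ∈ Set.Ioo (0 : ℝ) (1 / 2))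
    (hq : 0 < 2 * γ + 2 * α - 1) : Integrable (Lop γ α (om (2 * γ + 2 * α - 1))) := by
  set q := 2 * γ + 2 * α - 1 with hqdef
  have hR : Reg (om q) := om_reg hq (by linarith [hα.2, hγ.2])
  obtain ⟨Cn, hCn, hn⟩ := Lop_om_near hα hγ hq
  obtain ⟨Cm, hm⟩ := Lop_bdd hγ hα hR (δ := 1 / 2) (by norm_num)
  have hCm : 0 ≤ Cm := (abs_nonneg _).trans (hm 1 (by norm_num))
  have i0 := int_small (s := α) (by linarith [hα.2]) 2
  set c0 := ∫ y, {x : ℝ | |x| ≤ 2}.indicator (fun x => |x| ^ (-α)) y with hc0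
  have hc0' : 0 ≤ c0 := integral_nonneg fun y => Set.indicator_nonneg (fun _ _ => by positivity) _
  have i1 := int_small (s := 0) (by norm_num) 4
  have i2 := int_large (s := 1 + 2 * γ) (by linarith [hγ.1])
  have hx0 : ∀ᵐ x : ℝ, x ≠ 0 := by simp [ae_iff]
  refine (((i0.const_mul Cn).add (i1.const_mul Cm)).add (i2.const_mul (8 * c0))).mono'
    (Lop_meas hR.1).aestronglyMeasurable ?_
  filter_upwards [hx0] with x hx0
  simp only [Pi.add_apply]
  have n0 : 0 ≤ Cn * {x : ℝ | |x| ≤ 2}.indicator (fun x => |x| ^ (-α)) x :=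
    mul_nonneg hCn (Set.indicator_nonneg (fun _ _ => by positivity) _)
  have n1 : 0 ≤ Cm * {x : ℝ | |x| ≤ 4}.indicator (fun x => |x| ^ (-(0:ℝ))) x :=
    mul_nonneg hCm (Set.indicator_nonneg (fun _ _ => by positivity) _)
  have n2 : 0 ≤ 8 * c0 * {x : ℝ | 1 ≤ |x|}.indicator (fun x => |x| ^ (-(1 + 2 * γ))) x :=
    mul_nonneg (by positivity) (Set.indicator_nonneg (fun _ _ => by positivity) _)
  rw [Real.norm_eq_abs]
  rcases lt_or_ge |x| (1 / 2) with h | h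
  · have := hn x hx0 h
    rw [Set.indicator_of_mem (s := {x : ℝ | |x| ≤ 2}) (show |x| ≤ 2 by linarith)] at *
    linarith
  rcases le_or_gt |x| 4 with h4 | h4
  · have := hm x h
    rw [Set.indicator_of_mem (s := {x : ℝ | |x| ≤ 4}) (show |x| ≤ 4 from h4), neg_zero, Real.rpow_zero] at *
    linarith
  · rw [Set.indicator_of_mem (s := {x : ℝ | 1 ≤ |x|}) (show 1 ≤ |x| by linarith)] at *
    have hb : |Lop γ α (om q) x| ≤ 8 * c0 * |x| ^ (-(1 + 2 * γ)) := by
      unfold Lop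
      have e : 8 * c0 * |x| ^ (-(1 + 2 * γ)) = ∫ y, (8 * |x| ^ (-(1 + 2 * γ))) *
          {x : ℝ | |x| ≤ 2}.indicator (fun x => |x| ^ (-α)) y := by
        rw [integral_const_mul, ← hc0]; ring
      rw [e]
      rw [← Real.norm_eq_abs]
      refine norm_integral_le_of_norm_le (i0.const_mul _) (ae_of_all _ fun y => ?_)
      rw [om_zero (by linarith : 2 ≤ |x|), norm_mul, zero_sub, norm_neg, Real.norm_eq_abs,
        Real.norm_eq_abs, abs_of_nonneg (om_nonneg q y), abs_of_nonneg (cknK_nonneg _ _ _ _)]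
      rcases le_or_gt |y| 2 with hy | hy
      · rw [Set.indicator_of_mem (by exact hy)]
        unfold cknK
        have h1 := rpow_half_le hγ (a := |x|) (b := |x - y|) (by linarith) (by
          have := abs_sub_abs_le_abs_sub x y
          linarith)
        have h2 : |x| ^ (-α) ≤ 1 :=
          Real.rpow_le_one_of_one_le_of_nonpos (by linarith) (by linarith [hα.1])
        calc om q y * (|x - y| ^ (-(1 + 2 * γ)) * (|x| ^ (-α) * |y| ^ (-α)))
            ≤ 2 * (4 * |x| ^ (-(1 + 2 * γ)) * (1 * |y| ^ (-α))) := by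
              gcongr
              exact om_le_two q y
          _ = _ := by ring
      · rw [om_zero hy.le, zero_mul]
        exact mul_nonneg (by positivity) (Set.indicator_nonneg (fun _ _ => by positivity) _)
    linarith

/-- Rescaled truncated power. -/
noncomputable def omR (q R x : ℝ) : ℝ := R ^ q * om q (R⁻¹ * x)

lemma omR_reg {q R : ℝ} (hq : 0 < q) (hq1 : q ≤ 1) (hR : 0 < R) : Reg (omR q R) :=
  (Reg.const (R ^ q)).mul ((om_reg hq hq1).scale (inv_pos.mpr hR))

lemma omR_nonneg {q R : ℝ} (hR : 0 < R) (x : ℝ) : 0 ≤ omR q R x :=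
  mul_nonneg (by positivity) (om_nonneg _ _)

lemma omR_eq {q R x : ℝ} (hq : 0 < q) (hR : 0 < R) (hx : |x| ≤ R) : omR q R x = |x| ^ q := by
  unfold omR
  have h : |R⁻¹ * x| = |x| / R := by rw [abs_mul, abs_of_pos (inv_pos.mpr hR)]; field_simp
  rw [om_eq hq (by rw [h, div_le_one hR]; exact hx), h, ← Real.mul_rpow hR.le (by positivity)]
  congr 1; field_simp

lemma omR_zero {q R x : ℝ} (hR : 0 < R) (hx : 2 * R ≤ |x|) : omR q R x = 0 := by
  unfold omR
  have h : |R⁻¹ * x| = |x| / R := by rw [abs_mul, abs_of_pos (inv_pos.mpr hR)]; field_simp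
  rw [om_zero (by rw [h, le_div_iff₀ hR]; exact hx), mul_zero]

lemma omR_le {q R : ℝ} (hR : 0 < R) (x : ℝ) : omR q R x ≤ |x| ^ q := by
  unfold omR
  have h : |R⁻¹ * x| = |x| / R := by rw [abs_mul, abs_of_pos (inv_pos.mpr hR)]; field_simp
  calc R ^ q * om q (R⁻¹ * x) ≤ R ^ q * |R⁻¹ * x| ^ q :=
        mul_le_mul_of_nonneg_left (om_le _ _) (by positivity)
    _ = _ := by
      rw [h, ← Real.mul_rpow hR.le (by positivity)]
      congr 1; field_simp

lemma omR_le_two {q R : ℝ} (hR : 0 < R) (x : ℝ) : omR q R x ≤ 2 * R ^ q := by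
  unfold omR
  rw [mul_comm]
  exact mul_le_mul_of_nonneg_right (om_le_two _ _) (by positivity)

lemma omR_le_om {q R : ℝ} (hq : 0 < q) (hR : 0 < R) (hR1 : R ≤ 1) (x : ℝ) : omR q R x ≤ om q x := by
  refine le_min (omR_le hR x) ?_
  unfold omR
  have h : |R⁻¹ * x| = |x| / R := by rw [abs_mul, abs_of_pos (inv_pos.mpr hR)]; field_simp
  have h1 : om q (R⁻¹ * x) ≤ max 0 (2 - |x| / R) := by
    rw [← h]; exact min_le_right _ _
  have h2 : |x| ≤ |x| / R := by
    rw [le_div_iff₀ hR]; exact mul_le_of_le_one_right (abs_nonneg _) hR1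
  have h3 : max 0 (2 - |x| / R) ≤ max 0 (2 - |x|) := max_le_max le_rfl (by linarith)
  calc R ^ q * om q (R⁻¹ * x) ≤ 1 * om q (R⁻¹ * x) :=
        mul_le_mul_of_nonneg_right (Real.rpow_le_one hR.le hR1 hq.le) (om_nonneg _ _)
    _ ≤ _ := by rw [one_mul]; exact h1.trans h3

lemma Lop_const_mul (c : ℝ) (h : ℝ → ℝ) (x : ℝ) :
    Lop γ α (fun x => c * h x) x = c * Lop γ α h x := by
  unfold Lop
  rw [← integral_const_mul]; congr 1; ext y; ring

lemma Lop_omR {R : ℝ} (hR : 0 < R) (x : ℝ) :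
    Lop γ α (omR (2 * γ + 2 * α - 1) R) (R * x) = R⁻¹ * Lop γ α (om (2 * γ + 2 * α - 1)) x := by
  have e : omR (2 * γ + 2 * α - 1) R =
      fun x => R ^ (2 * γ + 2 * α - 1) * (fun x => om (2 * γ + 2 * α - 1) (R⁻¹ * x)) x := rfl
  rw [e, Lop_const_mul, Lop_scale _ hR, ← mul_assoc, ← Real.rpow_add hR]
  rw [show 2 * γ + 2 * α - 1 + -(2 * γ + 2 * α) = -1 by ring, Real.rpow_neg_one]

lemma Lop_omR_int (hγ : γ ∈ Set.Ico (1 / 3 : ℝ) (1 / 2)) (hα : α ∈ Set.Ioo (0 : ℝ) (1 / 2))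
    (hq : 0 < 2 * γ + 2 * α - 1) {R : ℝ} (hR : 0 < R) :
    Integrable (Lop γ α (omR (2 * γ + 2 * α - 1) R)) := by
  have h := Lop_om_int hγ hα hq
  rw [← integrable_comp_mul_left_iff _ hR.ne']
  simp_rw [Lop_omR hR]
  exact h.const_mul _

/-- rescaling of integrals against `Lop omR` -/
lemma int_Lop_omR {R : ℝ} (hR : 0 < R) (w : ℝ → ℝ) :
    ∫ x, w x * |Lop γ α (omR (2 * γ + 2 * α - 1) R) x| =
      ∫ x, w (R * x) * |Lop γ α (om (2 * γ + 2 * α - 1)) x| := by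
  have h := Measure.integral_comp_mul_left
    (fun x => w x * |Lop γ α (omR (2 * γ + 2 * α - 1) R) x|) R
  simp_rw [Lop_omR hR, abs_mul, abs_of_pos (inv_pos.mpr hR)] at h
  rw [smul_eq_mul] at h
  have h2 : R⁻¹ * ∫ x, w (R * x) * |Lop γ α (om (2 * γ + 2 * α - 1)) x| =
      R⁻¹ * ∫ x, w x * |Lop γ α (omR (2 * γ + 2 * α - 1) R) x| := by
    rw [← h, ← integral_const_mul]
    congr 1; ext x; ring
  exact (mul_left_cancel₀ (inv_ne_zero hR.ne') h2).symm
end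

/-- A convenient form of Fatou's lemma. -/
lemma fatou_h {Ω : Type*} [MeasurableSpace Ω] {μ : Measure Ω} {f : ℕ → Ω → ℝ≥0∞} {g : Ω → ℝ≥0∞}
    (hf : ∀ n, Measurable (f n)) {Cn : ℕ → ℝ≥0∞} {C : ℝ≥0∞}
    (hg : ∀ᵐ x ∂μ, g x ≤ Filter.liminf (fun n => f n x) Filter.atTop)
    (hC : ∀ n, ∫⁻ x, f n x ∂μ ≤ Cn n) (hlim : Filter.Tendsto Cn Filter.atTop (nhds C)) :
    ∫⁻ x, g x ∂μ ≤ C := by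
  calc ∫⁻ x, g x ∂μ ≤ ∫⁻ x, Filter.liminf (fun n => f n x) Filter.atTop ∂μ := lintegral_mono_ae hg
    _ ≤ Filter.liminf (fun n => ∫⁻ x, f n x ∂μ) Filter.atTop := lintegral_liminf_le hf
    _ ≤ Filter.liminf Cn Filter.atTop := Filter.liminf_le_liminf (Filter.Eventually.of_forall hC)
    _ = C := hlim.liminf_eq

lemma le_liminf_of_ev {f : ℕ → ℝ≥0∞} {a : ℝ≥0∞} (h : ∀ᶠ n in Filter.atTop, a ≤ f n) :
    a ≤ Filter.liminf f Filter.atTop := by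
  exact Filter.le_liminf_of_le (by isBoundedDefault) h

section
variable {γ α : ℝ}

lemma Supp0.mul_right {ζ : ℝ → ℝ} (hs : Supp0 ζ) (h : ℝ → ℝ) : Supp0 (fun x => ζ x * h x) := by
  obtain ⟨δ, hδ, S, hS⟩ := hs
  exact ⟨δ, hδ, S, fun x hx => by simp [hS x hx]⟩

lemma energy_id (hγ : γ ∈ Set.Ico (1 / 3 : ℝ) (1 / 2)) (hα : α ∈ Set.Ioo (0 : ℝ) (1 / 2))
    {h ζ : ℝ → ℝ} (hh : Reg h) (hζ : Reg ζ) (hs : Supp0 ζ) :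
    Integrable (fun p : ℝ × ℝ => ζ p.1 * ((h p.1 - h p.2) ^ 2 * cknK γ α p.1 p.2)) ∧
    ∫ p : ℝ × ℝ, ζ p.1 * ((h p.1 - h p.2) ^ 2 * cknK γ α p.1 p.2) =
      2 * (∫ x, ζ x * h x * Lop γ α h x) - ∫ x, h x * h x * Lop γ α ζ x := by
  have hφ := hζ.mul hh
  have hφs := hs.mul_right h
  have hw := hh.mul hh
  have i1 := hh.int_mul hγ hα hφ.1 hφ.2.1 hφs
  have i2 := hw.int_mul hγ hα hζ.1 hζ.2.1 hs
  have e : ∀ p : ℝ × ℝ, ζ p.1 * ((h p.1 - h p.2) ^ 2 * cknK γ α p.1 p.2) =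
      2 * (ζ p.1 * h p.1 * ((h p.1 - h p.2) * cknK γ α p.1 p.2)) -
      ζ p.1 * ((h p.1 * h p.1 - h p.2 * h p.2) * cknK γ α p.1 p.2) := by
    intro p; ring
  refine ⟨((i1.const_mul 2).sub i2).congr (ae_of_all _ fun p => (e p).symm), ?_⟩
  rw [← pair_left hγ hα hh hφ.1 hφ.2.1 hφs, ← pair_right hγ hα hw.1 hw.2.1 hζ hs,
    ← duality hγ hα hw hζ hs, integral_congr_ae (ae_of_all _ e), integral_sub (i1.const_mul 2) i2,
    integral_const_mul]

lemma Lop_sub (hγ : γ ∈ Set.Ico (1 / 3 : ℝ) (1 / 2)) (hα : α ∈ Set.Ioo (0 : ℝ) (1 / 2))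
    {f g : ℝ → ℝ} (hf : Reg f) (hg : Reg g) {x : ℝ} (hx : x ≠ 0) :
    Lop γ α (fun x => f x - g x) x = Lop γ α f x - Lop γ α g x := by
  unfold Lop
  rw [← integral_sub (hf.integrable_y hγ hα hx) (hg.integrable_y hγ hα hx)]
  congr 1; ext y; ring

lemma ae_ne_zero : ∀ᵐ x : ℝ, x ≠ 0 := by simp [ae_iff]

lemma step1_bound (hγ : γ ∈ Set.Ico (1 / 3 : ℝ) (1 / 2)) (hα : α ∈ Set.Ioo (0 : ℝ) (1 / 2))
    (hq : 0 < 2 * γ + 2 * α - 1) {h : ℝ → ℝ} (hh : Reg h) {G θ : ℝ} (hθ : θ < 1)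
    (hG : ∀ᵐ x : ℝ, |x| < 2 → |Lop γ α h x| ≤ G * |x| ^ (-θ)) :
    ∃ C : ℝ, ∀ R : ℝ, 0 < R → R ≤ 1 / 2 →
      ∫⁻ p : ℝ × ℝ, ENNReal.ofReal ((om (2 * γ + 2 * α - 1) p.1 - omR (2 * γ + 2 * α - 1) R p.1) *
        ((h p.1 - h p.2) ^ 2 * cknK γ α p.1 p.2)) ≤ ENNReal.ofReal C := by
  set q := 2 * γ + 2 * α - 1 with hqdef
  have hq1 : q ≤ 1 := by linarith [hα.2, hγ.2]
  obtain ⟨K, hK⟩ := hh.2.1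
  have hK0 : 0 ≤ K := (abs_nonneg _).trans (hK 0)
  have i0 := int_small hθ 2
  have iω := (Lop_om_int hγ hα hq).norm
  refine ⟨2 * (∫ x, 2 * K * |G| * {x : ℝ | |x| ≤ 2}.indicator (fun x => |x| ^ (-θ)) x) +
    K ^ 2 * (2 * ∫ x, ‖Lop γ α (om q) x‖), fun R hR hR1 => ?_⟩
  have r1 := om_reg hq hq1
  have r2 := omR_reg hq hq1 hR
  have hζ := r1.sub r2
  have hζ0 : ∀ x, 0 ≤ om q x - omR q R x := fun x =>
    sub_nonneg.mpr (omR_le_om hq hR (by linarith) x)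
  have hζ2 : ∀ x, 2 ≤ |x| → om q x - omR q R x = 0 := fun x hx => by
    rw [om_zero hx, omR_zero hR (by linarith), sub_zero]
  have hs : Supp0 (fun x => om q x - omR q R x) := by
    refine ⟨R, hR, 2, fun x hx => ?_⟩
    rw [not_and_or, not_le, not_le] at hx
    rcases hx with hx | hx
    · show om q x - omR q R x = 0
      rw [om_eq hq (by linarith), omR_eq hq hR hx.le, sub_self]
    · exact hζ2 x hx.le
  obtain ⟨hi, he⟩ := energy_id hγ hα hh hζ hs
  rw [← ofReal_integral_eq_lintegral_ofReal hi (ae_of_all _ fun p =>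
    mul_nonneg (hζ0 _) (mul_nonneg (sq_nonneg _) (cknK_nonneg _ _ _ _))), he]
  refine ENNReal.ofReal_le_ofReal ?_
  have b1 : |∫ x, (om q x - omR q R x) * h x * Lop γ α h x| ≤
      ∫ x, 2 * K * |G| * {x : ℝ | |x| ≤ 2}.indicator (fun x => |x| ^ (-θ)) x := by
    rw [← Real.norm_eq_abs]
    refine norm_integral_le_of_norm_le (i0.const_mul _) ?_
    filter_upwards [hG] with x hx
    rcases lt_or_ge |x| 2 with h2 | h2
    · rw [Set.indicator_of_mem (by exact h2.le), norm_mul, norm_mul]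
      have a1 : ‖om q x - omR q R x‖ ≤ 2 := by
        rw [Real.norm_eq_abs, abs_of_nonneg (hζ0 x)]
        linarith [om_le_two q x, omR_nonneg (q := q) hR x]
      have a2 : ‖h x‖ ≤ K := hK x
      have a3 : ‖Lop γ α h x‖ ≤ |G| * |x| ^ (-θ) :=
        (hx h2).trans (mul_le_mul_of_nonneg_right (le_abs_self G) (by positivity))
      calc _ ≤ 2 * K * (|G| * |x| ^ (-θ)) := by gcongr
        _ = _ := by ring
    · rw [hζ2 x h2]
      simp only [zero_mul, norm_zero]
      exact mul_nonneg (by positivity) (Set.indicator_nonneg (fun _ _ => by positivity) _)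
  have b2 : |∫ x, h x * h x * Lop γ α (fun x => om q x - omR q R x) x| ≤
      K ^ 2 * (2 * ∫ x, ‖Lop γ α (om q) x‖) := by
    have e1 := int_Lop_omR (γ := γ) (α := α) hR (fun _ => 1)
    simp only [one_mul] at e1
    have iR := (Lop_omR_int hγ hα hq hR).norm
    have e2 : K ^ 2 * (2 * ∫ x, ‖Lop γ α (om q) x‖) =
        ∫ x, K ^ 2 * (‖Lop γ α (om q) x‖ + ‖Lop γ α (omR q R) x‖) := by
      rw [integral_const_mul, integral_add iω iR]
      simp only [Real.norm_eq_abs]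
      rw [e1]; ring
    rw [e2, ← Real.norm_eq_abs]
    refine norm_integral_le_of_norm_le ((iω.add iR).const_mul _) ?_
    filter_upwards [ae_ne_zero] with x hx
    rw [Lop_sub hγ hα r1 r2 hx, norm_mul, norm_mul]
    have a2 : ‖h x‖ ≤ K := hK x
    have := norm_sub_le (Lop γ α (om q) x) (Lop γ α (omR q R) x)
    calc _ ≤ K * K * (‖Lop γ α (om q) x‖ + ‖Lop γ α (omR q R) x‖) := by gcongr
      _ = _ := by ring
  have := (abs_le.mp b2).1
  have := (abs_le.mp b1).2
  linarith

lemma step1 (hγ : γ ∈ Set.Ico (1 / 3 : ℝ) (1 / 2)) (hα : α ∈ Set.Ioo (0 : ℝ) (1 / 2))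
    (hq : 0 < 2 * γ + 2 * α - 1) {h : ℝ → ℝ} (hh : Reg h) {G θ : ℝ} (hθ : θ < 1)
    (hG : ∀ᵐ x : ℝ, |x| < 2 → |Lop γ α h x| ≤ G * |x| ^ (-θ)) :
    ∫⁻ p : ℝ × ℝ, {p : ℝ × ℝ | |p.1| < 1}.indicator (fun p => ENNReal.ofReal
      (|p.1| ^ (2 * γ + 2 * α - 1) * ((h p.1 - h p.2) ^ 2 * cknK γ α p.1 p.2))) p ≠ ⊤ := by
  obtain ⟨C, hC⟩ := step1_bound hγ hα hq hh hθ hG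
  set q := 2 * γ + 2 * α - 1 with hqdef
  refine ne_top_of_le_ne_top (b := ENNReal.ofReal C) ENNReal.ofReal_ne_top ?_
  have hK := cknK_meas γ α
  have hom := om_meas q
  have hmh := hh.1
  have hlim : Filter.Tendsto (fun n : ℕ => 2 * (1 / ((n : ℝ) + 2))) Filter.atTop (nhds 0) := by
    have h1 := (tendsto_one_div_add_atTop_nhds_zero_nat (𝕜 := ℝ)).comp (Filter.tendsto_add_atTop_nat 1)
    have h2 := h1.const_mul 2
    rw [mul_zero] at h2
    refine h2.congr fun n => ?_
    simp only [Function.comp]; push_cast; ring_nf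
  refine fatou_h (f := fun n p => ENNReal.ofReal ((om q p.1 - omR q (1 / ((n : ℝ) + 2)) p.1) *
        ((h p.1 - h p.2) ^ 2 * cknK γ α p.1 p.2))) (Cn := fun _ => ENNReal.ofReal C) ?_ ?_ ?_
        tendsto_const_nhds
  · intro n
    unfold omR
    fun_prop
  · refine ae_of_all _ fun p => ?_
    by_cases hp : |p.1| < 1
    · rw [Set.indicator_of_mem (by exact hp)]
      refine le_liminf_of_ev ?_
      by_cases h0 : p.1 = 0
      · refine Filter.Eventually.of_forall fun n => ?_
        rw [h0, abs_zero, Real.zero_rpow hq.ne', zero_mul]; simp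
      have hpos : 0 < |p.1| := abs_pos.mpr h0
      filter_upwards [hlim.eventually (gt_mem_nhds hpos)] with n hn
      rw [omR_zero (by positivity) hn.le, om_eq hq hp.le, sub_zero]
    · rw [Set.indicator_of_notMem (by exact hp)]; exact bot_le
  · intro n
    refine hC _ (by positivity) ?_
    rw [div_le_div_iff₀ (by positivity) (by norm_num)]
    have : (0:ℝ) ≤ n := by positivity
    linarith

lemma lint_scale {f : ℝ × ℝ → ℝ≥0∞} (hf : Measurable f) {R : ℝ} (hR : 0 < R) :
    ∫⁻ p, f (R • p) = ENNReal.ofReal (R ^ 2)⁻¹ * ∫⁻ p, f p := by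
  have h := Measure.map_addHaar_smul (volume : Measure (ℝ × ℝ)) hR.ne'
  have h2 : ∫⁻ p, f (R • p) = ∫⁻ p, f p ∂(Measure.map (R • ·) (volume : Measure (ℝ × ℝ))) := by
    rw [lintegral_map hf (by fun_prop)]
  rw [h2, h, lintegral_smul_measure]
  simp [abs_of_pos hR]

lemma exists_c (hγ : γ ∈ Set.Ico (1 / 3 : ℝ) (1 / 2)) (hα : α ∈ Set.Ioo (0 : ℝ) (1 / 2))
    (hq : 0 < 2 * γ + 2 * α - 1) {h : ℝ → ℝ} (hh : Reg h) {G θ : ℝ} (hθ : θ < 1)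
    (hG : ∀ᵐ x : ℝ, |x| < 2 → |Lop γ α h x| ≤ G * |x| ^ (-θ)) :
    ∃ c : ℝ, ∃ R : ℕ → ℝ, (∀ n, 0 < R n) ∧ Filter.Tendsto R Filter.atTop (nhds 0) ∧
      ∀ᵐ x : ℝ, Filter.Tendsto (fun n => h (R n * x)) Filter.atTop (nhds c) := by
  have hJ := step1 hγ hα hq hh hθ hG
  set q := 2 * γ + 2 * α - 1 with hqdef
  have hKm := cknK_meas γ α
  have hmh := hh.1
  set E : ℝ × ℝ → ℝ≥0∞ := fun p => ENNReal.ofReal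
    (|p.1| ^ q * ((h p.1 - h p.2) ^ 2 * cknK γ α p.1 p.2)) with hE
  have hEm : Measurable E := by fun_prop
  have hSm : ∀ r : ℝ, MeasurableSet {p : ℝ × ℝ | |p.1| < r} := fun r =>
    measurableSet_lt (by fun_prop) measurable_const
  have h0ae : ∀ᵐ p : ℝ × ℝ, p.1 ≠ 0 := Measure.quasiMeasurePreserving_fst.ae ae_ne_zero
  have hlim : Filter.Tendsto (fun n : ℕ => 1 / ((n : ℝ) + 1)) Filter.atTop (nhds 0) :=
    tendsto_one_div_add_atTop_nhds_zero_nat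
  have t0 : Filter.Tendsto (fun n : ℕ => ∫⁻ p, {p : ℝ × ℝ | |p.1| < 1 / ((n : ℝ) + 1)}.indicator E p)
      Filter.atTop (nhds 0) := by
    have := tendsto_lintegral_of_dominated_convergence
      (F := fun n : ℕ => {p : ℝ × ℝ | |p.1| < 1 / ((n : ℝ) + 1)}.indicator E) (f := fun _ => 0)
      (μ := (volume : Measure (ℝ × ℝ)))
      ({p : ℝ × ℝ | |p.1| < 1}.indicator E) (fun n => hEm.indicator (hSm _)) ?_ hJ ?_
    · simpa using this
    · intro n
      refine ae_of_all _ fun p => Set.indicator_le_indicator_of_subset ?_ (fun _ => bot_le) p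
      intro p hp
      have hp' : |p.1| < 1 / ((n : ℝ) + 1) := hp
      have : 1 / ((n : ℝ) + 1) ≤ 1 := by
        rw [div_le_one (by positivity)]; linarith [(by positivity : (0:ℝ) ≤ n)]
      exact lt_of_lt_of_le hp' this
    · filter_upwards [h0ae] with p hp
      refine tendsto_const_nhds.congr' ?_
      filter_upwards [hlim.eventually (gt_mem_nhds (abs_pos.mpr hp))] with n hn
      rw [Set.indicator_of_notMem]
      simp only [Set.mem_ofPred_eq, not_lt]; exact hn.le
  have hch : ∀ k : ℕ, ∃ n : ℕ, k ≤ n ∧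
      ∫⁻ p, {p : ℝ × ℝ | |p.1| < 1 / ((n : ℝ) + 1)}.indicator E p ≤ (2 : ℝ≥0∞)⁻¹ ^ k := by
    intro k
    have hpos : (0 : ℝ≥0∞) < (2 : ℝ≥0∞)⁻¹ ^ k := by
      refine ENNReal.pow_pos (by simp) k
    have h1 := t0.eventually (gt_mem_nhds hpos)
    obtain ⟨n, hn, hk⟩ := (h1.and (Filter.eventually_ge_atTop k)).exists
    exact ⟨n, hk, hn.le⟩
  choose N hN1 hN2 using hch
  set R : ℕ → ℝ := fun k => 1 / ((N k : ℝ) + 1) with hR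
  have hRpos : ∀ k, 0 < R k := fun k => by simp only [hR]; positivity
  have hRlim : Filter.Tendsto R Filter.atTop (nhds 0) :=
    hlim.comp (Filter.tendsto_atTop_mono hN1 Filter.tendsto_id)
  -- rescaled
  let ER : ℕ → ℝ × ℝ → ℝ≥0∞ := fun k => {p : ℝ × ℝ | |p.1| < 1}.indicator (fun p => ENNReal.ofReal
    (|p.1| ^ q * ((h (R k * p.1) - h (R k * p.2)) ^ 2 * cknK γ α p.1 p.2)))
  have hERm : ∀ k, Measurable (ER k) := fun k => Measurable.indicator (by fun_prop) (hSm 1)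
  have hERi : ∀ k, ∫⁻ p, ER k p ≤ (2 : ℝ≥0∞)⁻¹ ^ k := by
    intro k
    refine le_trans ?_ (hN2 k)
    have hs := lint_scale (f := {p : ℝ × ℝ | |p.1| < R k}.indicator E) (hEm.indicator (hSm _)) (hRpos k)
    have e : ∀ p : ℝ × ℝ, {p : ℝ × ℝ | |p.1| < R k}.indicator E (R k • p) =
        ENNReal.ofReal (R k ^ 2)⁻¹ * ER k p := by
      intro p
      have hiff : (R k • p ∈ {p : ℝ × ℝ | |p.1| < R k}) ↔ p ∈ {p : ℝ × ℝ | |p.1| < 1} := by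
        simp only [Set.mem_ofPred_eq, Prod.smul_fst, smul_eq_mul, abs_mul, abs_of_pos (hRpos k)]
        constructor
        · intro h'; exact lt_of_mul_lt_mul_left (by linarith) (hRpos k).le
        · intro h'; nlinarith [hRpos k]
      by_cases hp : p ∈ {p : ℝ × ℝ | |p.1| < 1}
      · rw [Set.indicator_of_mem (hiff.mpr hp)]
        simp only [ER]
        rw [Set.indicator_of_mem hp, ← ENNReal.ofReal_mul (by positivity)]
        simp only [hE, Prod.smul_fst, Prod.smul_snd, smul_eq_mul]
        rw [cknK_smul γ α p.1 p.2 (hRpos k).ne', abs_mul, abs_of_pos (hRpos k),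
          Real.mul_rpow (hRpos k).le (abs_nonneg _)]
        have e2 : (R k ^ 2)⁻¹ = R k ^ q * R k ^ (-(1 + 2 * γ + 2 * α)) := by
          rw [← Real.rpow_add (hRpos k), ← Real.rpow_natCast, ← Real.rpow_neg (hRpos k).le]
          congr 1; simp only [hqdef]; push_cast; ring
        rw [e2]; congr 1; ring
      · rw [Set.indicator_of_notMem (fun h' => hp (hiff.mp h'))]
        simp only [ER]
        rw [Set.indicator_of_notMem hp, mul_zero]
    simp_rw [e] at hs
    rw [lintegral_const_mul _ (hERm k)] at hs
    have hne : ENNReal.ofReal (R k ^ 2)⁻¹ ≠ 0 := by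
      have := hRpos k
      simp only [ne_eq, ENNReal.ofReal_eq_zero, not_le]; positivity
    exact le_of_eq ((ENNReal.mul_right_inj hne ENNReal.ofReal_ne_top).mp hs)
  have hsum : ∫⁻ p, ∑' k, ER k p ≠ ⊤ := by
    rw [lintegral_tsum fun k => (hERm k).aemeasurable]
    refine ne_top_of_le_ne_top ?_ (ENNReal.tsum_le_tsum hERi)
    rw [ENNReal.tsum_geometric, ENNReal.one_sub_inv_two, inv_inv]; simp
  have hae : ∀ᵐ p : ℝ × ℝ, Filter.Tendsto (fun k => ER k p) Filter.atTop (nhds 0) := by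
    filter_upwards [ae_lt_top' (AEMeasurable.ennreal_tsum fun k => (hERm k).aemeasurable) hsum] with p hp
    exact ENNReal.tendsto_atTop_zero_of_tsum_ne_top hp.ne
  have hae2 := Measure.ae_ae_of_ae_prod (μ := (volume : Measure ℝ)) (ν := (volume : Measure ℝ)) hae
  have hex : ∃ x0 : ℝ, x0 ≠ 0 ∧ |x0| < 1 ∧ ∀ᵐ y : ℝ, Filter.Tendsto (fun k => ER k (x0, y)) Filter.atTop (nhds 0) := by
    have hpos : volume (Set.Ioo (-1 : ℝ) 1) ≠ 0 := by simp
    have hne : (ae (volume.restrict (Set.Ioo (-1 : ℝ) 1))).NeBot := by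
      rw [ae_neBot]; simpa [Measure.restrict_eq_zero] using hpos
    have := ((ae_restrict_of_ae (s := Set.Ioo (-1 : ℝ) 1) hae2).and
      ((ae_restrict_of_ae (s := Set.Ioo (-1 : ℝ) 1) ae_ne_zero).and
      (ae_restrict_mem (μ := volume) (measurableSet_Ioo (a := (-1 : ℝ)) (b := 1))))).exists
    obtain ⟨x0, h1, h2, h3⟩ := this
    exact ⟨x0, h2, abs_lt.mpr h3, h1⟩
  obtain ⟨x0, hx0, hx1, hy⟩ := hex
  obtain ⟨K, hK⟩ := hh.2.1
  obtain ⟨c, _, φ, hφ, hc⟩ := (isCompact_Icc (a := -K) (b := K)).tendsto_subseq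
    (x := fun k => h (R k * x0)) (fun k => abs_le.mp (hK _))
  refine ⟨c, R ∘ φ, fun n => hRpos _, hRlim.comp hφ.tendsto_atTop, ?_⟩
  have hyx : ∀ᵐ y : ℝ, y ≠ x0 := by simp [ae_iff]
  filter_upwards [hy, ae_ne_zero, hyx] with y hy hy0 hyx
  have hw : 0 < |x0| ^ q * cknK γ α x0 y := by
    unfold cknK
    have a1 : 0 < |x0| := abs_pos.mpr hx0
    have a2 : 0 < |y| := abs_pos.mpr hy0
    have a3 : 0 < |x0 - y| := abs_pos.mpr (sub_ne_zero.mpr (Ne.symm hyx))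
    positivity
  have hER : ∀ k, ER k (x0, y) = ENNReal.ofReal
      ((|x0| ^ q * cknK γ α x0 y) * (h (R k * x0) - h (R k * y)) ^ 2) := by
    intro k
    simp only [ER]
    rw [Set.indicator_of_mem (by exact hx1)]
    congr 1; ring
  simp_rw [hER] at hy
  have t1 := (ENNReal.tendsto_toReal ENNReal.zero_ne_top).comp hy
  simp only [Function.comp_def, ENNReal.toReal_zero] at t1
  have t2 : Filter.Tendsto (fun k => (h (R k * x0) - h (R k * y)) ^ 2) Filter.atTop (nhds 0) := by
    have := t1.const_mul (|x0| ^ q * cknK γ α x0 y)⁻¹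
    rw [mul_zero] at this
    refine this.congr fun k => ?_
    rw [ENNReal.toReal_ofReal (mul_nonneg hw.le (sq_nonneg _)), inv_mul_cancel_left₀ hw.ne']
  have t3 : Filter.Tendsto (fun k => h (R k * x0) - h (R k * y)) Filter.atTop (nhds 0) := by
    have := t2.sqrt
    simp only [Real.sqrt_sq_eq_abs, Real.sqrt_zero] at this
    exact (tendsto_zero_iff_abs_tendsto_zero _).mpr this
  have t4 := hc.sub (t3.comp hφ.tendsto_atTop)
  rw [sub_zero] at t4
  refine t4.congr fun k => ?_
  simp [Function.comp]
end

noncomputable def vw (s x : ℝ) : ℝ := {x : ℝ | |x| ≤ 1}.indicator (fun x => |x| ^ (-s)) x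

noncomputable def Ei (x₀ x : ℝ) : ℝ := {x : ℝ | |x - x₀| ≤ 5 / 2}.indicator (fun _ => (1 : ℝ)) x

noncomputable def ww (z : ℝ) : ℝ := {x : ℝ | |x| ≤ 1}.indicator (fun x => |x| ^ (-(0 : ℝ))) z +
  {x : ℝ | 1 ≤ |x|}.indicator (fun x => |x| ^ (-(5 / 3 : ℝ))) z

lemma vw_nonneg (s x : ℝ) : 0 ≤ vw s x := Set.indicator_nonneg (fun x _ => by positivity) x

lemma vw_int {s : ℝ} (hs : s < 1) : Integrable (vw s) := int_small hs 1

lemma ww_int : Integrable ww := (int_small (by norm_num) 1).add (int_large (by norm_num))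

lemma ww_nonneg (z : ℝ) : 0 ≤ ww z :=
  add_nonneg (Set.indicator_nonneg (fun x _ => by positivity) z)
    (Set.indicator_nonneg (fun x _ => by positivity) z)

lemma vw_meas (s : ℝ) : Measurable (vw s) := (meas_abs_rpow _).indicator (measurableSet_le_abs 1)

lemma ww_meas : Measurable ww :=
  ((meas_abs_rpow _).indicator (measurableSet_le_abs 1)).add
    ((meas_abs_rpow _).indicator (measurableSet_ge_abs 1))

lemma abs_rpow_le_vw {s s₀ : ℝ} (h0 : 0 ≤ s) (h1 : s ≤ s₀) (x : ℝ) : |x| ^ (-s) ≤ 1 + vw s₀ x := by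
  rcases le_or_gt |x| 1 with h | h
  · rcases eq_or_ne x 0 with rfl | hx
    · rcases eq_or_lt_of_le h0 with rfl | h2
      · simpa using vw_nonneg s₀ 0
      · rw [abs_zero, Real.zero_rpow (by linarith)]
        linarith [vw_nonneg s₀ 0]
    · have : |x| ^ (-s) ≤ |x| ^ (-s₀) :=
        Real.rpow_le_rpow_of_exponent_ge (abs_pos.mpr hx) h (by linarith)
      unfold vw
      rw [Set.indicator_of_mem (by exact h)]
      linarith
  · have := Real.rpow_le_one_of_one_le_of_nonpos h.le (by linarith : -s ≤ 0)
    linarith [vw_nonneg s₀ x]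

lemma Ei_nonneg (x₀ x : ℝ) : 0 ≤ Ei x₀ x := Set.indicator_nonneg (fun x _ => zero_le_one) x

lemma Ei_le_one (x₀ x : ℝ) : Ei x₀ x ≤ 1 := by
  unfold Ei Set.indicator; split_ifs <;> norm_num

lemma measurableSet_E (x₀ : ℝ) : MeasurableSet {x : ℝ | |x - x₀| ≤ 5 / 2} :=
  measurableSet_le (by fun_prop) measurable_const

lemma Ei_meas (x₀ : ℝ) : Measurable (Ei x₀) := measurable_const.indicator (measurableSet_E x₀)

lemma Ei_one {x₀ x : ℝ} (h : |x - x₀| ≤ 5 / 2) : Ei x₀ x = 1 := Set.indicator_of_mem (by exact h) _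

lemma E_eq (x₀ : ℝ) : {x : ℝ | |x - x₀| ≤ 5 / 2} = Set.Icc (x₀ - 5 / 2) (x₀ + 5 / 2) := by
  ext x
  simp only [Set.mem_ofPred_eq, Set.mem_Icc, abs_le]
  constructor <;> rintro ⟨h1, h2⟩ <;> constructor <;> linarith

lemma Ei_int (x₀ : ℝ) : Integrable (Ei x₀) := by
  have : Integrable (Ei x₀) ↔ IntegrableOn (fun _ => (1 : ℝ)) {x : ℝ | |x - x₀| ≤ 5 / 2} :=
    integrable_indicator_iff (measurableSet_E x₀)
  rw [this, E_eq]
  simp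

lemma Ei_integral (x₀ : ℝ) : ∫ x, Ei x₀ x = 5 := by
  have : ∫ x, Ei x₀ x = ∫ x in {x : ℝ | |x - x₀| ≤ 5 / 2}, (1 : ℝ) :=
    integral_indicator (measurableSet_E x₀)
  rw [this, E_eq]
  simp

lemma Ei_pow {s s₀ : ℝ} (h0 : 0 ≤ s) (h1 : s ≤ s₀) (hs : s₀ < 1) (x₀ : ℝ) :
    Integrable (fun x => Ei x₀ x * |x| ^ (-s)) ∧
    ∫ x, Ei x₀ x * |x| ^ (-s) ≤ 5 + ∫ x, vw s₀ x := by
  have hb : ∀ x, Ei x₀ x * |x| ^ (-s) ≤ Ei x₀ x + vw s₀ x := fun x => by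
    nlinarith [abs_rpow_le_vw h0 h1 x, Ei_nonneg x₀ x, Ei_le_one x₀ x, vw_nonneg s₀ x]
  have hd := (Ei_int x₀).add (vw_int hs)
  have hm : Measurable (fun x => Ei x₀ x * |x| ^ (-s)) := (Ei_meas x₀).mul (meas_abs_rpow _)
  have hi : Integrable (fun x => Ei x₀ x * |x| ^ (-s)) := by
    refine hd.mono' hm.aestronglyMeasurable (ae_of_all _ fun x => ?_)
    rw [Real.norm_eq_abs, abs_of_nonneg (mul_nonneg (Ei_nonneg _ _) (by positivity))]
    exact hb x
  refine ⟨hi, (integral_mono hi hd hb).trans_eq ?_⟩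
  show ∫ x, (Ei x₀ x + vw s₀ x) = _
  rw [integral_add (Ei_int x₀) (vw_int hs), Ei_integral]

lemma min_ker_le {γ : ℝ} (hγ : γ ∈ Set.Ico (1 / 3 : ℝ) (1 / 2)) (z : ℝ) :
    min 1 (z ^ 2) * |z| ^ (-(1 + 2 * γ)) ≤ ww z := by
  unfold ww
  rcases le_or_gt |z| 1 with h | h
  · rw [Set.indicator_of_mem (by exact h)]
    have h2 : 0 ≤ {x : ℝ | 1 ≤ |x|}.indicator (fun x => |x| ^ (-(5 / 3 : ℝ))) z :=
      Set.indicator_nonneg (fun x _ => by positivity) z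
    have h3 : min 1 (z ^ 2) * |z| ^ (-(1 + 2 * γ)) ≤ 1 := by
      rcases eq_or_ne z 0 with rfl | hz
      · simp
      · have hp := abs_pos.mpr hz
        calc min 1 (z ^ 2) * |z| ^ (-(1 + 2 * γ)) ≤ |z| ^ (2 : ℝ) * |z| ^ (-(1 + 2 * γ)) := by
              gcongr
              rw [Real.rpow_two, sq_abs]; exact min_le_right _ _
          _ = |z| ^ (1 - 2 * γ) := by rw [← Real.rpow_add hp]; congr 1; ring
          _ ≤ 1 := Real.rpow_le_one hp.le h (by linarith [hγ.2])
    rw [neg_zero, Real.rpow_zero]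
    linarith
  · rw [Set.indicator_of_notMem (by simpa using h), Set.indicator_of_mem (by exact h.le), zero_add]
    calc min 1 (z ^ 2) * |z| ^ (-(1 + 2 * γ)) ≤ 1 * |z| ^ (-(1 + 2 * γ)) := by
          gcongr; exact min_le_left _ _
      _ ≤ |z| ^ (-(5 / 3 : ℝ)) := by
          rw [one_mul]
          exact Real.rpow_le_rpow_of_exponent_le h.le (by linarith [hγ.1])

lemma ww_le_two (z : ℝ) : ww z ≤ 2 := by
  unfold ww
  have h1 : {x : ℝ | |x| ≤ 1}.indicator (fun x => |x| ^ (-(0 : ℝ))) z ≤ 1 := by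
    unfold Set.indicator; split_ifs <;> simp
  have h2 : {x : ℝ | 1 ≤ |x|}.indicator (fun x => |x| ^ (-(5 / 3 : ℝ))) z ≤ 1 := by
    unfold Set.indicator; split_ifs with h
    · exact Real.rpow_le_one_of_one_le_of_nonpos h (by norm_num)
    · norm_num
  exact (add_le_add h1 h2).trans (by norm_num)

/-- The basic nonnegative majorant. -/
noncomputable def Wd (γ α x₀ : ℝ) (p : ℝ × ℝ) : ℝ :=
  Ei x₀ p.1 * (min 1 ((p.1 - p.2) ^ 2) * cknK γ α p.1 p.2)

lemma Wd_nonneg (γ α x₀ : ℝ) (p : ℝ × ℝ) : 0 ≤ Wd γ α x₀ p :=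
  mul_nonneg (Ei_nonneg _ _) (mul_nonneg (le_min zero_le_one (sq_nonneg _)) (cknK_nonneg _ _ _ _))

lemma lemU : ∃ A : ℝ, 0 ≤ A ∧ ∀ γ α x₀ : ℝ, γ ∈ Set.Ico (1 / 3 : ℝ) (1 / 2) →
    α ∈ Set.Ioo (0 : ℝ) (1 / 2) → Integrable (Wd γ α x₀) ∧ ∫ p, Wd γ α x₀ p ≤ A := by
  have hv := vw_int (s := 1 / 2) (by norm_num)
  set cv := ∫ x, vw (1 / 2) x with hcv
  set cw := ∫ x, ww x with hcw
  have cv0 : 0 ≤ cv := integral_nonneg (vw_nonneg _)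
  have cw0 : 0 ≤ cw := integral_nonneg ww_nonneg
  refine ⟨(5 + cv) * (cw + 2 * cv), by positivity, fun γ α x₀ hγ hα => ?_⟩
  have hK := cknK_meas γ α
  have hE := Ei_meas x₀
  have hm : Measurable (Wd γ α x₀) := by unfold Wd; fun_prop
  obtain ⟨hp, hpb⟩ := Ei_pow (s := α) (s₀ := 1 / 2) hα.1.le hα.2.le (by norm_num) x₀
  have key : ∫⁻ p, ENNReal.ofReal (Wd γ α x₀ p) ≤ ENNReal.ofReal ((5 + cv) * (cw + 2 * cv)) := by
    rw [Measure.volume_eq_prod, lintegral_prod _ (by fun_prop)]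
    have hw := ww_meas
    have hvm := vw_meas (1 / 2)
    calc ∫⁻ x, ∫⁻ y, ENNReal.ofReal (Wd γ α x₀ (x, y))
        ≤ ∫⁻ x, ∫⁻ y, ENNReal.ofReal (Ei x₀ x * |x| ^ (-α)) *
          (ENNReal.ofReal (ww (x - y)) + ENNReal.ofReal (2 * vw (1 / 2) y)) := by
          refine lintegral_mono fun x => lintegral_mono fun y => ?_
          have h2 := vw_nonneg (1 / 2) y
          rw [← ENNReal.ofReal_add (ww_nonneg _) (by positivity),
            ← ENNReal.ofReal_mul (mul_nonneg (Ei_nonneg _ _) (by positivity))]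
          refine ENNReal.ofReal_le_ofReal ?_
          have h1 := min_ker_le hγ (x - y)
          have h3 := abs_rpow_le_vw hα.1.le hα.2.le y
          have h4 : min 1 ((x - y) ^ 2) * |x - y| ^ (-(1 + 2 * γ)) * |y| ^ (-α) ≤
              ww (x - y) + 2 * vw (1 / 2) y := by
            calc _ ≤ ww (x - y) * (1 + vw (1 / 2) y) := by
                  refine mul_le_mul h1 h3 (by positivity) (ww_nonneg _)
              _ ≤ _ := by nlinarith [ww_le_two (x - y), ww_nonneg (x - y)]
          have h5 : 0 ≤ Ei x₀ x * |x| ^ (-α) := mul_nonneg (Ei_nonneg _ _) (by positivity)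
          calc Wd γ α x₀ (x, y) = Ei x₀ x * |x| ^ (-α) *
                (min 1 ((x - y) ^ 2) * |x - y| ^ (-(1 + 2 * γ)) * |y| ^ (-α)) := by
                unfold Wd cknK; ring
            _ ≤ _ := mul_le_mul_of_nonneg_left h4 h5
      _ = ∫⁻ x, ENNReal.ofReal (Ei x₀ x * |x| ^ (-α)) * ENNReal.ofReal (cw + 2 * cv) := by
          refine lintegral_congr fun x => ?_
          rw [lintegral_const_mul _ (by fun_prop), lintegral_add_left (by fun_prop),
            lintegral_sub_left_eq_self (fun z => ENNReal.ofReal (ww z)) x,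
            ← ofReal_integral_eq_lintegral_ofReal ww_int (ae_of_all _ ww_nonneg),
            ← ofReal_integral_eq_lintegral_ofReal (hv.const_mul 2)
              (ae_of_all _ fun y => mul_nonneg zero_le_two (vw_nonneg _ _)), integral_const_mul,
            ← ENNReal.ofReal_add cw0 (by positivity)]
      _ = ENNReal.ofReal (∫ x, Ei x₀ x * |x| ^ (-α)) * ENNReal.ofReal (cw + 2 * cv) := by
          rw [lintegral_mul_const _ (by fun_prop), ofReal_integral_eq_lintegral_ofReal hp
            (ae_of_all _ fun x => mul_nonneg (Ei_nonneg _ _) (by positivity))]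
      _ ≤ _ := by
          rw [← ENNReal.ofReal_mul (integral_nonneg fun x => mul_nonneg (Ei_nonneg _ _) (by positivity))]
          exact ENNReal.ofReal_le_ofReal (mul_le_mul_of_nonneg_right hpb (by positivity))
  have hi : Integrable (Wd γ α x₀) := by
    refine ⟨hm.aestronglyMeasurable, ?_⟩
    rw [hasFiniteIntegral_iff_ofReal (ae_of_all _ (Wd_nonneg γ α x₀))]
    exact key.trans_lt ENNReal.ofReal_lt_top
  refine ⟨hi, ?_⟩
  rw [← ofReal_integral_eq_lintegral_ofReal hi (ae_of_all _ (Wd_nonneg γ α x₀))] at key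
  exact (ENNReal.ofReal_le_ofReal_iff (by positivity)).mp key

section
variable {γ α : ℝ}

lemma int_mul_bdd {φ w : ℝ → ℝ}
    (hi : Integrable (fun q : ℝ × ℝ => (φ q.1 - φ q.2) * cknK γ α q.1 q.2))
    (hw : Measurable w) {m : ℝ} (hm : ∀ x, |w x| ≤ m) :
    Integrable (fun q : ℝ × ℝ => w q.1 * ((φ q.1 - φ q.2) * cknK γ α q.1 q.2)) :=
  hi.bdd_mul (c := m) (f := fun q : ℝ × ℝ => w q.1)
    (hw.comp measurable_fst).aestronglyMeasurable (ae_of_all _ fun q => hm _)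

lemma int_Lop_of {φ : ℝ → ℝ}
    (hi : Integrable (fun q : ℝ × ℝ => (φ q.1 - φ q.2) * cknK γ α q.1 q.2)) :
    Integrable (Lop γ α φ) := by
  rw [Measure.volume_eq_prod] at hi
  exact hi.integral_prod_left

lemma half_id {φ w : ℝ → ℝ}
    (hi : Integrable (fun q : ℝ × ℝ => (φ q.1 - φ q.2) * cknK γ α q.1 q.2))
    (hw : Measurable w) {m : ℝ} (hm : ∀ x, |w x| ≤ m) :
    Integrable (fun q : ℝ × ℝ => (w q.1 - w q.2) * (φ q.1 - φ q.2) * cknK γ α q.1 q.2) ∧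
    2 * ∫ x, w x * Lop γ α φ x =
      ∫ q : ℝ × ℝ, (w q.1 - w q.2) * (φ q.1 - φ q.2) * cknK γ α q.1 q.2 := by
  have h1 := int_mul_bdd hi hw hm
  have h2 := h1.swap
  have e : ∀ q : ℝ × ℝ, (w q.1 - w q.2) * (φ q.1 - φ q.2) * cknK γ α q.1 q.2 =
      w q.1 * ((φ q.1 - φ q.2) * cknK γ α q.1 q.2) +
      ((fun q : ℝ × ℝ => w q.1 * ((φ q.1 - φ q.2) * cknK γ α q.1 q.2)) ∘ Prod.swap) q := by
    intro q
    simp only [Function.comp, Prod.fst_swap, Prod.snd_swap]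
    rw [cknK_symm γ α q.2 q.1]; ring
  have h3 : ∫ q : ℝ × ℝ, w q.1 * ((φ q.1 - φ q.2) * cknK γ α q.1 q.2) = ∫ x, w x * Lop γ α φ x := by
    rw [Measure.volume_eq_prod] at h1 ⊢
    rw [integral_prod _ h1]
    simp only [Lop, integral_const_mul]
  refine ⟨(h1.add h2).congr (ae_of_all _ fun q => (e q).symm), ?_⟩
  rw [integral_congr_ae (ae_of_all _ e), integral_add h1 h2]
  have h4 := integral_swap_prod (fun q : ℝ × ℝ => w q.1 * ((φ q.1 - φ q.2) * cknK γ α q.1 q.2))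
  simp only [Function.comp_def]
  rw [h4, h3]; ring

lemma absorb (hγ : γ ∈ Set.Ico (1 / 3 : ℝ) (1 / 2)) (hα : α ∈ Set.Ioo (0 : ℝ) (1 / 2))
    {k ζ φ P : ℝ → ℝ} {D : ℝ × ℝ → ℝ} (hk : Reg k) (hζ : Reg ζ) (hs : Supp0 ζ)
    (hφ : Integrable (fun q : ℝ × ℝ => (φ q.1 - φ q.2) * cknK γ α q.1 q.2))
    (hP : Integrable P) (hPL : ∀ᵐ x, Lop γ α φ x - P x ≤ Lop γ α ζ x)
    (hD : Integrable D)
    (hpt : ∀ p : ℝ × ℝ, |φ p.1 - φ p.2| * |k p.1 * k p.1 - k p.2 * k p.2| * cknK γ α p.1 p.2 ≤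
      1 / 2 * ((ζ p.1 + ζ p.2) * ((k p.1 - k p.2) ^ 2 * cknK γ α p.1 p.2)) + D p) :
    Integrable (fun p : ℝ × ℝ => ζ p.1 * ((k p.1 - k p.2) ^ 2 * cknK γ α p.1 p.2)) ∧
    ∫ p : ℝ × ℝ, ζ p.1 * ((k p.1 - k p.2) ^ 2 * cknK γ α p.1 p.2) ≤
      4 * (∫ x, ζ x * k x * Lop γ α k x) + (∫ p, D p) + 2 * ∫ x, k x * k x * P x := by
  obtain ⟨hi, he⟩ := energy_id hγ hα hk hζ hs
  refine ⟨hi, ?_⟩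
  set Q := ∫ p : ℝ × ℝ, ζ p.1 * ((k p.1 - k p.2) ^ 2 * cknK γ α p.1 p.2) with hQ
  have hkk := hk.mul hk
  obtain ⟨m, hm⟩ := hkk.2.1
  obtain ⟨i1, e1⟩ := half_id hφ hkk.1 hm
  have hi2 := hi.swap
  have hsw := integral_swap_prod (fun p : ℝ × ℝ => ζ p.1 * ((k p.1 - k p.2) ^ 2 * cknK γ α p.1 p.2))
  have b1 : -(2 * ∫ x, k x * k x * Lop γ α φ x) ≤ Q + ∫ p, D p := by
    rw [e1, ← integral_neg]
    calc _ ≤ ∫ p : ℝ × ℝ, (1 / 2 * (ζ p.1 * ((k p.1 - k p.2) ^ 2 * cknK γ α p.1 p.2) +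
          ((fun p : ℝ × ℝ => ζ p.1 * ((k p.1 - k p.2) ^ 2 * cknK γ α p.1 p.2)) ∘ Prod.swap) p) + D p) := by
          refine integral_mono i1.neg (((hi.add hi2).const_mul (1 / 2)).add hD) fun p => ?_
          have h1 := hpt p
          simp only [Pi.neg_apply, Function.comp, Prod.fst_swap, Prod.snd_swap]
          rw [cknK_symm γ α p.2 p.1]
          have h2 : -((k p.1 * k p.1 - k p.2 * k p.2) * (φ p.1 - φ p.2) * cknK γ α p.1 p.2) ≤
              |φ p.1 - φ p.2| * |k p.1 * k p.1 - k p.2 * k p.2| * cknK γ α p.1 p.2 := by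
            rw [← neg_mul, ← abs_mul]
            refine mul_le_mul_of_nonneg_right ?_ (cknK_nonneg _ _ _ _)
            rw [mul_comm (φ p.1 - φ p.2)]
            exact neg_le_abs _
          refine h2.trans (h1.trans (le_of_eq ?_))
          ring
      _ = Q + ∫ p, D p := by
          have hh := integral_add ((hi.add hi2).const_mul (1 / 2)) hD
          have hh2 := integral_add hi hi2
          simp only [Pi.add_apply] at hh hh2
          refine hh.trans ?_
          rw [integral_const_mul]
          have hh3 := hh2.trans (congrArg (fun t => Q + t) hsw)
          refine (congrArg (fun t => 1 / 2 * t + ∫ p, D p) hh3).trans ?_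
          simp only [← hQ]
          ring
  have b2 : -(∫ x, k x * k x * Lop γ α ζ x) ≤ -(∫ x, k x * k x * Lop γ α φ x) + ∫ x, k x * k x * P x := by
    have j0 : ∀ {f : ℝ → ℝ}, Integrable f → Integrable (fun x => k x * k x * f x) := fun hf =>
      hf.bdd_mul (c := m) hkk.1.aestronglyMeasurable (ae_of_all _ hm)
    have j1 := j0 (int_Lop_of hφ)
    have j2 := j0 hP
    have j3 := j0 (Lop_int hγ hα hζ hs)
    have := integral_mono_ae (j1.sub j2) j3 (by
      filter_upwards [hPL] with x hx
      simp only [Pi.sub_apply]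
      nlinarith [mul_self_nonneg (k x)])
    simp only [Pi.sub_apply] at this
    rw [integral_sub j1 j2] at this
    linarith
  linarith

lemma int_s (hγ : γ ∈ Set.Ico (1 / 3 : ℝ) (1 / 2)) (hα : α ∈ Set.Ioo (0 : ℝ) (1 / 2))
    {φ : ℝ → ℝ} {x₀ : ℝ} (hx₀ : |x₀| < 9 / 4) (hr : Reg φ) (h01 : ∀ x, 0 ≤ φ x ∧ φ x ≤ 1)
    (hc : ∀ x, |x| < 1 / 8 → φ x = 1) (h0 : ∀ x, 5 / 2 < |x - x₀| → φ x = 0) :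
    Integrable (fun q : ℝ × ℝ => (φ q.1 - φ q.2) * cknK γ α q.1 q.2) := by
  obtain ⟨A, -, hA⟩ := lemU
  have iW := (hA γ α x₀ hγ hα).1
  let χ : ℝ → ℝ := ({x : ℝ | 1 / 16 ≤ |x| ∧ |x| ≤ 5}).indicator (fun _ => 1)
  have hχm : Measurable χ := measurable_const.indicator (measurableSet_ann _ _)
  have hχb : ∀ x, |χ x| ≤ 1 := by
    intro x; simp only [χ, Set.indicator]; split_ifs <;> simp
  have hχs : Supp0 χ := ⟨1 / 16, by norm_num, 5, fun x hx => Set.indicator_of_notMem (by exact hx) _⟩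
  have h1 := hr.int_mul hγ hα hχm ⟨1, hχb⟩ hχs
  have hK := cknK_meas γ α
  have hφm := hr.1
  have hm : Measurable (fun q : ℝ × ℝ => (φ q.1 - φ q.2) * cknK γ α q.1 q.2) := by fun_prop
  have hd := ((h1.norm.add h1.norm.swap).add ((iW.add iW.swap).const_mul 256))
  refine hd.mono' hm.aestronglyMeasurable (ae_of_all _ fun p => ?_)
  obtain ⟨x, y⟩ := p
  simp only [Pi.add_apply, Function.comp, Prod.swap, Real.norm_eq_abs]
  have hKn := cknK_nonneg γ α x y
  have w1 := Wd_nonneg γ α x₀ (x, y)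
  have w2 := Wd_nonneg γ α x₀ (y, x)
  have n1 := abs_nonneg (χ x * ((φ x - φ y) * cknK γ α x y))
  have n2 := abs_nonneg (χ y * ((φ y - φ x) * cknK γ α y x))
  by_cases cx : 1 / 16 ≤ |x| ∧ |x| ≤ 5
  · have : χ x = 1 := Set.indicator_of_mem (by exact cx) _
    rw [this, one_mul]
    linarith
  by_cases cy : 1 / 16 ≤ |y| ∧ |y| ≤ 5
  · have : χ y = 1 := Set.indicator_of_mem (by exact cy) _
    rw [this, one_mul, cknK_symm γ α y x, abs_mul (φ y - φ x), abs_sub_comm (φ y), ← abs_mul]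
    linarith
  rw [not_and_or, not_le, not_le] at cx cy
  have big : ∀ z, 5 < |z| → φ z = 0 := fun z hz => h0 z (by
    have := abs_sub_abs_le_abs_sub z x₀
    linarith)
  have small : ∀ z, |z| < 1 / 16 → φ z = 1 := fun z hz => hc z (by linarith)
  have mix : ∀ a b : ℝ, |a| < 1 / 16 → 5 < |b| → 1 * cknK γ α a b ≤ 256 * Wd γ α x₀ (a, b) := by
    intro a b ha hb
    unfold Wd
    have e1 : Ei x₀ a = 1 := Ei_one (by
      have := abs_sub a x₀
      linarith)
    have e2 : min 1 ((a - b) ^ 2) = 1 := by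
      refine min_eq_left ?_
      have := abs_sub_abs_le_abs_sub b a
      rw [← sq_abs, abs_sub_comm]
      nlinarith
    simp only [e1, e2]
    linarith [cknK_nonneg γ α a b]
  refine le_trans ?_ (show 256 * (Wd γ α x₀ (x, y) + Wd γ α x₀ (y, x)) ≤ _ by linarith)
  rcases cx with cx | cx <;> rcases cy with cy | cy
  · rw [small x cx, small y cy, sub_self, zero_mul, abs_zero]; linarith
  · rw [small x cx, big y cy, sub_zero]
    have := mix x y cx cy
    rw [abs_of_nonneg (by linarith)]
    linarith
  · rw [big x cx, small y cy, zero_sub, neg_mul, abs_neg]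
    have := mix y x cy cx
    rw [cknK_symm γ α y x] at this
    rw [abs_of_nonneg (by linarith)]
    linarith
  · rw [big x cx, big y cy, sub_self, zero_mul, abs_zero]; linarith
end

noncomputable def eta (b x₀ x : ℝ) : ℝ := max 0 (min 1 (8 * (b - |x - x₀|)))

lemma eta_nonneg (b x₀ x : ℝ) : 0 ≤ eta b x₀ x := le_max_left _ _
lemma eta_le_one (b x₀ x : ℝ) : eta b x₀ x ≤ 1 := max_le zero_le_one (min_le_left _ _)
lemma eta_one {b x₀ x : ℝ} (h : |x - x₀| ≤ b - 1 / 8) : eta b x₀ x = 1 := by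
  unfold eta; rw [min_eq_left (by linarith), max_eq_right zero_le_one]
lemma eta_zero {b x₀ x : ℝ} (h : b ≤ |x - x₀|) : eta b x₀ x = 0 := by
  unfold eta; exact max_eq_left ((min_le_right _ _).trans (by linarith))

lemma clamp_lip (a b : ℝ) : |max 0 (min 1 a) - max 0 (min 1 b)| ≤ |a - b| := by
  have h1 := abs_max_sub_max_le_max 0 (min 1 a) 0 (min 1 b)
  have h2 := abs_min_sub_min_le_max 1 a 1 b
  simp only [sub_self, abs_zero] at h1 h2
  refine h1.trans (max_le (abs_nonneg _) (h2.trans (max_le (abs_nonneg _) le_rfl)))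

lemma eta_lip (b x₀ x y : ℝ) : |eta b x₀ x - eta b x₀ y| ≤ 8 * |x - y| := by
  refine (clamp_lip _ _).trans ?_
  rw [← mul_sub, abs_mul, abs_of_pos (by norm_num : (0:ℝ) < 8)]
  refine mul_le_mul_of_nonneg_left ?_ (by norm_num)
  rw [show b - |x - x₀| - (b - |y - x₀|) = |y - x₀| - |x - x₀| by ring]
  refine (abs_abs_sub_abs_le _ _).trans (le_of_eq ?_)
  rw [abs_sub_comm]; congr 1; ring

lemma eta_reg (b x₀ : ℝ) : Reg (eta b x₀) :=
  Reg.lip (K := 1) (fun x => by rw [abs_of_nonneg (eta_nonneg _ _ _)]; exact eta_le_one _ _ _)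
    (eta_lip b x₀)

/-- pointwise bound of squared increments by the majorant -/
lemma sq_le_Wd {γ α x₀ L : ℝ} {f : ℝ → ℝ} (hL : 1 ≤ L) (h01 : ∀ x, 0 ≤ f x ∧ f x ≤ 1)
    (hl : ∀ x y, |f x - f y| ≤ L * |x - y|) {c : ℝ} (h0 : ∀ x, 5 / 2 < |x - x₀| → f x = c) (x y : ℝ) :
    (f x - f y) ^ 2 * cknK γ α x y ≤ L ^ 2 * (Wd γ α x₀ (x, y) + Wd γ α x₀ (y, x)) := by
  have hK := cknK_nonneg γ α x y
  have w1 := Wd_nonneg γ α x₀ (x, y)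
  have w2 := Wd_nonneg γ α x₀ (y, x)
  have hL2 : 1 ≤ L ^ 2 := one_le_pow₀ hL
  have hm : (f x - f y) ^ 2 ≤ L ^ 2 * min 1 ((x - y) ^ 2) := by
    rcases min_choice 1 ((x - y) ^ 2) with h | h <;> rw [h]
    · have : |f x - f y| ≤ 1 := by
        rw [abs_le]; constructor <;> linarith [(h01 x).1, (h01 x).2, (h01 y).1, (h01 y).2]
      rw [← sq_abs]
      nlinarith [abs_nonneg (f x - f y)]
    · rw [← sq_abs, ← sq_abs (x - y), ← mul_pow]
      exact pow_le_pow_left₀ (abs_nonneg _) (hl x y) 2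
  have hmK := mul_le_mul_of_nonneg_right hm hK
  by_cases hx : |x - x₀| ≤ 5 / 2
  · have : Wd γ α x₀ (x, y) = min 1 ((x - y) ^ 2) * cknK γ α x y := by
      unfold Wd; rw [Ei_one hx, one_mul]
    rw [mul_add, this]
    nlinarith
  by_cases hy : |y - x₀| ≤ 5 / 2
  · have : Wd γ α x₀ (y, x) = min 1 ((x - y) ^ 2) * cknK γ α x y := by
      unfold Wd; rw [Ei_one hy, one_mul, cknK_symm γ α y x]
      simp only []
      rw [show (y - x) ^ 2 = (x - y) ^ 2 by ring]
    rw [mul_add, this]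
    nlinarith
  · rw [h0 x (not_le.mp hx), h0 y (not_le.mp hy), sub_self]
    simp only [ne_eq, OfNat.ofNat_ne_zero, not_false_eq_true, zero_pow, zero_mul]
    positivity

lemma sq_int {γ α x₀ L A : ℝ} {f : ℝ → ℝ} (hf : Measurable f) (hL : 1 ≤ L)
    (h01 : ∀ x, 0 ≤ f x ∧ f x ≤ 1)
    (hl : ∀ x y, |f x - f y| ≤ L * |x - y|) {c : ℝ} (h0 : ∀ x, 5 / 2 < |x - x₀| → f x = c)
    (hA : Integrable (Wd γ α x₀) ∧ ∫ p, Wd γ α x₀ p ≤ A) :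
    Integrable (fun p : ℝ × ℝ => (f p.1 - f p.2) ^ 2 * cknK γ α p.1 p.2) ∧
    ∫ p : ℝ × ℝ, (f p.1 - f p.2) ^ 2 * cknK γ α p.1 p.2 ≤ L ^ 2 * (2 * A) := by
  have hK := cknK_meas γ α
  have hm : Measurable (fun p : ℝ × ℝ => (f p.1 - f p.2) ^ 2 * cknK γ α p.1 p.2) := by fun_prop
  have hd := (hA.1.add hA.1.swap).const_mul (L ^ 2)
  have hb : ∀ p : ℝ × ℝ, (f p.1 - f p.2) ^ 2 * cknK γ α p.1 p.2 ≤
    L ^ 2 * ((Wd γ α x₀ + Wd γ α x₀ ∘ Prod.swap) p) := fun p => sq_le_Wd hL h01 hl h0 p.1 p.2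
  have hi : Integrable (fun p : ℝ × ℝ => (f p.1 - f p.2) ^ 2 * cknK γ α p.1 p.2) := by
    refine hd.mono' hm.aestronglyMeasurable (ae_of_all _ fun p => ?_)
    rw [Real.norm_eq_abs, abs_of_nonneg (mul_nonneg (sq_nonneg _) (cknK_nonneg _ _ _ _))]
    exact hb p
  refine ⟨hi, (integral_mono hi hd hb).trans ?_⟩
  rw [integral_const_mul]
  refine mul_le_mul_of_nonneg_left ?_ (sq_nonneg _)
  have e := integral_add hA.1 hA.1.swap
  have e2 := integral_swap_prod (Wd γ α x₀)
  calc _ = _ := e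
    _ = (∫ p, Wd γ α x₀ p) + ∫ p, Wd γ α x₀ p := congrArg (fun t => (∫ p, Wd γ α x₀ p) + t) e2
    _ ≤ _ := by linarith [hA.2]

/-- the constant for the weights -/
noncomputable def cV (s₀ : ℝ) : ℝ := 5 + ∫ x, vw s₀ x

lemma cV_nonneg (s₀ : ℝ) : 0 ≤ cV s₀ := add_nonneg (by norm_num) (integral_nonneg (vw_nonneg _))

section
variable {γ α : ℝ}

lemma Lop_term {θ θ₀ x₀ m N T : ℝ} (hα : α ∈ Set.Ioo (0 : ℝ) (1 / 2)) (hθ : θ ∈ Set.Icc 0 θ₀)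
    (hθ₀ : θ₀ < 1) {k ζ : ℝ → ℝ} (hN : 0 ≤ N) (hT : 0 ≤ T) (hm : ∀ x, |k x| ≤ m)
    (hζ0 : ∀ x, 0 ≤ ζ x) (hζ : ∀ x, ζ x ≤ Ei x₀ x)
    (hb : ∀ᵐ x : ℝ, |x - x₀| ≤ 5 / 2 → |Lop γ α k x| ≤ N * |x| ^ (-θ) + T * |x| ^ (-α)) :
    ∫ x, ζ x * k x * Lop γ α k x ≤ m * (N * cV θ₀ + T * cV (1 / 2)) := by
  have hm0 : 0 ≤ m := (abs_nonneg _).trans (hm 0)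
  obtain ⟨i1, b1⟩ := Ei_pow (s := θ) hθ.1 hθ.2 hθ₀ x₀
  obtain ⟨i2, b2⟩ := Ei_pow (s := α) (s₀ := 1 / 2) hα.1.le hα.2.le (by norm_num) x₀
  have hd := ((i1.const_mul N).add (i2.const_mul T)).const_mul m
  have h := norm_integral_le_of_norm_le (f := fun x => ζ x * k x * Lop γ α k x) hd (by
    filter_upwards [hb] with x hx
    simp only [Pi.add_apply, norm_mul, Real.norm_eq_abs]
    rw [abs_of_nonneg (hζ0 x)]
    by_cases hE : |x - x₀| ≤ 5 / 2
    · have h1 := hζ x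
      rw [Ei_one hE] at h1 ⊢
      have h2 := hx hE
      calc ζ x * |k x| * |Lop γ α k x| ≤ 1 * m * (N * |x| ^ (-θ) + T * |x| ^ (-α)) := by
            gcongr
            exact hm x
        _ = _ := by ring
    · have h1 := hζ x
      have : Ei x₀ x = 0 := Set.indicator_of_notMem (by exact hE) _
      rw [this] at h1 ⊢
      rw [le_antisymm h1 (hζ0 x)]; simp)
  refine (le_abs_self _).trans (h.trans ?_)
  simp only [Pi.add_apply]
  rw [integral_const_mul, integral_add (i1.const_mul N) (i2.const_mul T), integral_const_mul,
    integral_const_mul]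
  unfold cV
  gcongr

lemma sq_pt {m a b : ℝ} (t t' : ℝ) (ha : |a| ≤ m) (hb : |b| ≤ m) :
    |t * t - t' * t'| * |a * a - b * b| ≤
      1 / 2 * ((t * t + t' * t') * (a - b) ^ 2) + 4 * m ^ 2 * (t - t') ^ 2 := by
  have e1 : |t * t - t' * t'| * |a * a - b * b| =
      |((t + t') * (a - b)) * ((t - t') * (a + b))| := by
    rw [← abs_mul]; congr 1; ring
  rw [e1]
  have h2 : (a + b) ^ 2 ≤ 4 * m ^ 2 := by
    have := abs_add_le (a) (b)
    have h3 : |a + b| ≤ 2 * m := by linarith [ha, hb]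
    calc (a + b) ^ 2 = |a + b| ^ 2 := (sq_abs _).symm
      _ ≤ (2 * m) ^ 2 := pow_le_pow_left₀ (abs_nonneg _) h3 2
      _ = _ := by ring
  have h4 : |((t + t') * (a - b)) * ((t - t') * (a + b))| ≤
      1 / 4 * ((t + t') * (a - b)) ^ 2 + ((t - t') * (a + b)) ^ 2 := by
    rw [abs_le]
    constructor <;>
    nlinarith [sq_nonneg (1 / 2 * ((t + t') * (a - b)) + ((t - t') * (a + b))),
      sq_nonneg (1 / 2 * ((t + t') * (a - b)) - ((t - t') * (a + b)))]
  have h5 : (t + t') ^ 2 ≤ 2 * (t * t + t' * t') := by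
    nlinarith [sq_nonneg (t - t')]
  have h6 := mul_le_mul_of_nonneg_right h5 (sq_nonneg (a - b))
  have h7 := mul_le_mul_of_nonneg_right h2 (sq_nonneg (t - t'))
  nlinarith

lemma caseI {θ θ₀ x₀ m N T B : ℝ} (hγ : γ ∈ Set.Ico (1 / 3 : ℝ) (1 / 2))
    (hα : α ∈ Set.Ioo (0 : ℝ) (1 / 2)) (hθ : θ ∈ Set.Icc 0 θ₀)
    (hθ₀ : θ₀ < 1) {k τ : ℝ → ℝ} (hN : 0 ≤ N) (hT : 0 ≤ T) (hk : Reg k) (hm : ∀ x, |k x| ≤ m)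
    (hτ : Reg τ) (hs : Supp0 τ) (hτ0 : ∀ x, 0 ≤ τ x) (hτE : ∀ x, τ x ≤ Ei x₀ x)
    (hb : ∀ᵐ x : ℝ, |x - x₀| ≤ 5 / 2 → |Lop γ α k x| ≤ N * |x| ^ (-θ) + T * |x| ^ (-α))
    (hD : Integrable (fun p : ℝ × ℝ => (τ p.1 - τ p.2) ^ 2 * cknK γ α p.1 p.2))
    (hDB : ∫ p : ℝ × ℝ, (τ p.1 - τ p.2) ^ 2 * cknK γ α p.1 p.2 ≤ B) :
    ∫⁻ p : ℝ × ℝ, ENNReal.ofReal (τ p.1 * τ p.1 * ((k p.1 - k p.2) ^ 2 * cknK γ α p.1 p.2)) ≤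
      ENNReal.ofReal (4 * (m * (N * cV θ₀ + T * cV (1 / 2))) + 4 * m ^ 2 * B) := by
  have hζ := hτ.mul hτ
  have hζs := hs.mul_right τ
  have hm0 : 0 ≤ m := (abs_nonneg _).trans (hm 0)
  obtain ⟨hi, he⟩ := absorb hγ hα (φ := fun x => τ x * τ x) (P := fun _ => 0) hk hζ hζs (hζ.int_diff hγ hα hζs)
    (integrable_zero _ _ _) (ae_of_all _ fun x => by simp) (hD.const_mul (4 * m ^ 2)) (by
      rintro ⟨x, y⟩
      have hK := cknK_nonneg γ α x y
      have h1 := sq_pt (τ x) (τ y) (hm x) (hm y)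
      have h2 := mul_le_mul_of_nonneg_right h1 hK
      refine h2.trans (le_of_eq ?_)
      simp only []
      ring)
  rw [← ofReal_integral_eq_lintegral_ofReal hi (ae_of_all _ fun p =>
    mul_nonneg (mul_self_nonneg _) (mul_nonneg (sq_nonneg _) (cknK_nonneg _ _ _ _)))]
  refine ENNReal.ofReal_le_ofReal (he.trans ?_)
  have h1 := Lop_term (ζ := fun x => τ x * τ x) hα hθ hθ₀ hN hT hm (fun x => mul_self_nonneg _)
    (fun x => (mul_le_of_le_one_left (hτ0 x) ((hτE x).trans (Ei_le_one _ _))).trans (hτE x)) hb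
  rw [integral_const_mul]
  have h2 := mul_le_mul_of_nonneg_left hDB (by positivity : 0 ≤ 4 * m ^ 2)
  simp only [mul_zero, integral_zero] at h1 ⊢
  linarith
end

noncomputable def bi (x₀ x : ℝ) : ℝ := {x : ℝ | |x - x₀| < 2}.indicator (fun _ => (1 : ℝ)) x

lemma bi_meas (x₀ : ℝ) : Measurable (bi x₀) :=
  measurable_const.indicator (measurableSet_lt (by fun_prop) measurable_const)

lemma bi_nonneg (x₀ x : ℝ) : 0 ≤ bi x₀ x := Set.indicator_nonneg (fun _ _ => zero_le_one) x

lemma bi_cases (x₀ x : ℝ) : (bi x₀ x = 0) ∨ (bi x₀ x = 1 ∧ |x - x₀| < 2) := by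
  by_cases h : |x - x₀| < 2
  · exact Or.inr ⟨Set.indicator_of_mem (by exact h) _, h⟩
  · exact Or.inl (Set.indicator_of_notMem (by exact h) _)

noncomputable def psi (r x : ℝ) : ℝ := max 0 (min 1 (r⁻¹ * |x| - 1))

lemma psi_nonneg (r x : ℝ) : 0 ≤ psi r x := le_max_left _ _
lemma psi_le_one (r x : ℝ) : psi r x ≤ 1 := max_le zero_le_one (min_le_left _ _)
lemma psi_zero {r x : ℝ} (hr : 0 < r) (h : |x| ≤ r) : psi r x = 0 := by
  unfold psi
  have : r⁻¹ * |x| ≤ 1 := by rw [inv_mul_le_iff₀ hr]; linarith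
  exact max_eq_left ((min_le_right _ _).trans (by linarith))
lemma psi_one {r x : ℝ} (hr : 0 < r) (h : 2 * r ≤ |x|) : psi r x = 1 := by
  unfold psi
  have : 2 ≤ r⁻¹ * |x| := by rw [le_inv_mul_iff₀ hr]; linarith
  rw [min_eq_left (by linarith), max_eq_right zero_le_one]
lemma psi_lip {r : ℝ} (hr : 0 < r) (x y : ℝ) : |psi r x - psi r y| ≤ r⁻¹ * |x - y| := by
  refine (clamp_lip _ _).trans ?_
  rw [show r⁻¹ * |x| - 1 - (r⁻¹ * |y| - 1) = r⁻¹ * (|x| - |y|) by ring, abs_mul,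
    abs_of_pos (inv_pos.mpr hr)]
  exact mul_le_mul_of_nonneg_left (abs_abs_sub_abs_le _ _) (by positivity)
lemma psi_reg {r : ℝ} (hr : 0 < r) : Reg (psi r) :=
  Reg.lip (K := 1) (fun x => by rw [abs_of_nonneg (psi_nonneg _ _)]; exact psi_le_one _ _)
    (psi_lip hr)
lemma psi_scale {r : ℝ} (hr : 0 < r) (x : ℝ) : psi r (r * x) = psi 1 x := by
  unfold psi
  rw [abs_mul, abs_of_pos hr, inv_mul_cancel_left₀ hr.ne', inv_one, one_mul]

lemma ae_fst_ne : ∀ᵐ p : ℝ × ℝ, p.1 ≠ 0 := by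
  rw [Measure.volume_eq_prod]
  exact Measure.quasiMeasurePreserving_fst.ae ae_ne_zero

section
variable {γ α : ℝ}

lemma psi_energy (hγ : γ ∈ Set.Ico (1 / 3 : ℝ) (1 / 2)) (hα : α ∈ Set.Ioo (0 : ℝ) (1 / 2))
    (hq : 2 * γ + 2 * α - 1 ≤ 0) {A : ℝ} (hA0 : 0 ≤ A)
    (hA : Integrable (Wd γ α 0) ∧ ∫ p, Wd γ α 0 p ≤ A)
    {r : ℝ} (hr : 0 < r) (hr1 : r ≤ 1) :
    Integrable (fun p : ℝ × ℝ => (psi r p.1 - psi r p.2) ^ 2 * cknK γ α p.1 p.2) ∧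
    ∫ p : ℝ × ℝ, (psi r p.1 - psi r p.2) ^ 2 * cknK γ α p.1 p.2 ≤ 2 * A := by
  have hn : ∀ r, ∀ p : ℝ × ℝ, 0 ≤ (psi r p.1 - psi r p.2) ^ 2 * cknK γ α p.1 p.2 := fun r p =>
    mul_nonneg (sq_nonneg _) (cknK_nonneg _ _ _ _)
  have h1 := sq_int (f := psi 1) (x₀ := 0) (L := 1) (c := 1) (psi_reg one_pos).1 le_rfl
    (fun x => ⟨psi_nonneg _ _, psi_le_one _ _⟩)
    (fun x y => by simpa using psi_lip one_pos x y)
    (fun x hx => psi_one one_pos (by rw [sub_zero] at hx; linarith)) hA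
  have hK := cknK_meas γ α
  have hp := (psi_reg hr).1
  have hm : Measurable (fun p : ℝ × ℝ => (psi r p.1 - psi r p.2) ^ 2 * cknK γ α p.1 p.2) := by fun_prop
  have hs := lint_scale hm.ennreal_ofReal hr
  have e : ∀ p : ℝ × ℝ, ENNReal.ofReal ((psi r (r • p).1 - psi r (r • p).2) ^ 2 *
      cknK γ α (r • p).1 (r • p).2) = ENNReal.ofReal (r ^ (-(1 + 2 * γ + 2 * α))) *
      ENNReal.ofReal ((psi 1 p.1 - psi 1 p.2) ^ 2 * cknK γ α p.1 p.2) := by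
    intro p
    simp only [Prod.smul_fst, Prod.smul_snd, smul_eq_mul]
    rw [psi_scale hr, psi_scale hr, cknK_smul _ _ _ _ hr.ne', abs_of_pos hr,
      ← ENNReal.ofReal_mul (by positivity)]
    congr 1; ring
  simp_rw [e] at hs
  have hp1 := (psi_reg one_pos).1
  rw [lintegral_const_mul _ (by fun_prop)] at hs
  have key : ∫⁻ p : ℝ × ℝ, ENNReal.ofReal ((psi r p.1 - psi r p.2) ^ 2 * cknK γ α p.1 p.2) ≤
      ENNReal.ofReal (2 * A) := by
    have h2 : ∫⁻ p : ℝ × ℝ, ENNReal.ofReal ((psi r p.1 - psi r p.2) ^ 2 * cknK γ α p.1 p.2) =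
        ENNReal.ofReal (r ^ 2) * (ENNReal.ofReal (r ^ 2)⁻¹ *
        ∫⁻ p : ℝ × ℝ, ENNReal.ofReal ((psi r p.1 - psi r p.2) ^ 2 * cknK γ α p.1 p.2)) := by
      rw [← mul_assoc, ← ENNReal.ofReal_mul (by positivity), mul_inv_cancel₀ (by positivity),
        ENNReal.ofReal_one, one_mul]
    rw [h2, ← hs, ← mul_assoc, ← ENNReal.ofReal_mul (by positivity),
      ← ofReal_integral_eq_lintegral_ofReal h1.1 (ae_of_all _ (hn 1)),
      ← ENNReal.ofReal_mul (by positivity)]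
    refine ENNReal.ofReal_le_ofReal ?_
    have h3 : r ^ 2 * r ^ (-(1 + 2 * γ + 2 * α)) ≤ 1 := by
      rw [← Real.rpow_two, ← Real.rpow_add hr]
      exact Real.rpow_le_one hr.le hr1 (by linarith)
    have h4 := h1.2
    rw [one_pow, one_mul] at h4
    calc _ ≤ 1 * (2 * A) := mul_le_mul h3 h4 (integral_nonneg (hn 1)) zero_le_one
      _ = _ := one_mul _
  have hi : Integrable (fun p : ℝ × ℝ => (psi r p.1 - psi r p.2) ^ 2 * cknK γ α p.1 p.2) := by
    refine ⟨hm.aestronglyMeasurable, ?_⟩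
    rw [hasFiniteIntegral_iff_ofReal (ae_of_all _ (hn r))]
    exact key.trans_lt ENNReal.ofReal_lt_top
  refine ⟨hi, ?_⟩
  rw [← ofReal_integral_eq_lintegral_ofReal hi (ae_of_all _ (hn r))] at key
  exact (ENNReal.ofReal_le_ofReal_iff (by positivity)).mp key

lemma eta_le_Ei {b x₀ : ℝ} (hb : b ≤ 5 / 2) (x : ℝ) : eta b x₀ x ≤ Ei x₀ x := by
  by_cases h : |x - x₀| ≤ 5 / 2
  · rw [Ei_one h]; exact eta_le_one _ _ _
  · rw [eta_zero (by linarith)]; exact Ei_nonneg _ _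

lemma eta_energy {A b x₀ : ℝ} (hb : b ≤ 5 / 2)
    (hA : Integrable (Wd γ α x₀) ∧ ∫ p, Wd γ α x₀ p ≤ A) :
    Integrable (fun p : ℝ × ℝ => (eta b x₀ p.1 - eta b x₀ p.2) ^ 2 * cknK γ α p.1 p.2) ∧
    ∫ p : ℝ × ℝ, (eta b x₀ p.1 - eta b x₀ p.2) ^ 2 * cknK γ α p.1 p.2 ≤ 8 ^ 2 * (2 * A) :=
  sq_int (c := 0) (eta_reg _ _).1 (by norm_num) (fun x => ⟨eta_nonneg _ _ _, eta_le_one _ _ _⟩)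
    (eta_lip b x₀) (fun x hx => eta_zero (by linarith)) hA

lemma core_far {θ θ₀ x₀ m N T A : ℝ} (hγ : γ ∈ Set.Ico (1 / 3 : ℝ) (1 / 2))
    (hα : α ∈ Set.Ioo (0 : ℝ) (1 / 2)) (hθ : θ ∈ Set.Icc 0 θ₀)
    (hθ₀ : θ₀ < 1) {k : ℝ → ℝ} (hN : 0 ≤ N) (hT : 0 ≤ T) (hk : Reg k) (hm : ∀ x, |k x| ≤ m)
    (hb : ∀ᵐ x : ℝ, |x - x₀| ≤ 5 / 2 → |Lop γ α k x| ≤ N * |x| ^ (-θ) + T * |x| ^ (-α))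
    (hA : Integrable (Wd γ α x₀) ∧ ∫ p, Wd γ α x₀ p ≤ A) (hx : 9 / 4 ≤ |x₀|) :
    ∫⁻ p : ℝ × ℝ, ENNReal.ofReal (bi x₀ p.1 * ((k p.1 - k p.2) ^ 2 * cknK γ α p.1 p.2)) ≤
      ENNReal.ofReal (4 * (m * (N * cV θ₀ + T * cV (1 / 2))) + 4 * m ^ 2 * (8 ^ 2 * (2 * A))) := by
  have hs : Supp0 (eta (17 / 8) x₀) := by
    refine ⟨1 / 8, by norm_num, |x₀| + 3, fun x hx' => eta_zero ?_⟩
    rw [not_and_or, not_le, not_le] at hx'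
    rcases hx' with h | h
    · have := abs_sub_abs_le_abs_sub x₀ x
      rw [abs_sub_comm]; linarith
    · have := abs_sub_abs_le_abs_sub x x₀
      linarith
  obtain ⟨e1, e2⟩ := eta_energy (b := 17 / 8) (by norm_num) hA
  refine le_trans (lintegral_mono fun p => ENNReal.ofReal_le_ofReal ?_)
    (caseI hγ hα hθ hθ₀ hN hT hk hm (eta_reg (17 / 8) x₀) hs (eta_nonneg _ _)
      (eta_le_Ei (by norm_num)) hb e1 e2)
  have hn := mul_nonneg (sq_nonneg (k p.1 - k p.2)) (cknK_nonneg γ α p.1 p.2)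
  refine mul_le_mul_of_nonneg_right ?_ hn
  rcases bi_cases x₀ p.1 with h | ⟨h, h2⟩
  · rw [h]; exact mul_self_nonneg _
  · rw [h, eta_one (by linarith), mul_one]

lemma core_neg {θ θ₀ x₀ m N T A : ℝ} (hγ : γ ∈ Set.Ico (1 / 3 : ℝ) (1 / 2))
    (hα : α ∈ Set.Ioo (0 : ℝ) (1 / 2)) (hθ : θ ∈ Set.Icc 0 θ₀)
    (hθ₀ : θ₀ < 1) {k : ℝ → ℝ} (hN : 0 ≤ N) (hT : 0 ≤ T) (hk : Reg k) (hm : ∀ x, |k x| ≤ m)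
    (hb : ∀ᵐ x : ℝ, |x - x₀| ≤ 5 / 2 → |Lop γ α k x| ≤ N * |x| ^ (-θ) + T * |x| ^ (-α))
    (hA0 : 0 ≤ A) (hA : Integrable (Wd γ α x₀) ∧ ∫ p, Wd γ α x₀ p ≤ A)
    (hA' : Integrable (Wd γ α 0) ∧ ∫ p, Wd γ α 0 p ≤ A) (hq : 2 * γ + 2 * α - 1 ≤ 0) :
    ∫⁻ p : ℝ × ℝ, ENNReal.ofReal (bi x₀ p.1 * ((k p.1 - k p.2) ^ 2 * cknK γ α p.1 p.2)) ≤
      ENNReal.ofReal (4 * (m * (N * cV θ₀ + T * cV (1 / 2))) + 4 * m ^ 2 * (260 * A)) := by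
  have hK := cknK_meas γ α
  have hkm := hk.1
  let τ : ℕ → ℝ → ℝ := fun n x => eta (5 / 2) x₀ x * psi (1 / ((n : ℝ) + 1)) x
  have hr : ∀ n : ℕ, 0 < 1 / ((n : ℝ) + 1) := fun n => Nat.one_div_pos_of_nat
  have hr1 : ∀ n : ℕ, 1 / ((n : ℝ) + 1) ≤ 1 := fun n => by
    rw [div_le_one (by positivity)]; linarith [(Nat.cast_nonneg n : (0 : ℝ) ≤ n)]
  have hτ : ∀ n, Reg (τ n) := fun n => (eta_reg _ _).mul (psi_reg (hr n))
  have hτm : ∀ n, Measurable (τ n) := fun n => (hτ n).1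
  refine fatou_h (f := fun n (p : ℝ × ℝ) => ENNReal.ofReal (τ n p.1 * τ n p.1 *
    ((k p.1 - k p.2) ^ 2 * cknK γ α p.1 p.2))) (Cn := fun _ => ENNReal.ofReal
      (4 * (m * (N * cV θ₀ + T * cV (1 / 2))) + 4 * m ^ 2 * (260 * A))) (fun n => ?_) ?_ (fun n => ?_)
    tendsto_const_nhds
  · have := hτm n
    fun_prop
  · filter_upwards [ae_fst_ne] with p hp
    refine le_liminf_of_ev ?_
    have h1 : ∀ᶠ n : ℕ in Filter.atTop, 1 / ((n : ℝ) + 1) < |p.1| / 2 :=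
      tendsto_one_div_add_atTop_nhds_zero_nat.eventually_lt_const (by positivity)
    filter_upwards [h1] with n hn
    refine ENNReal.ofReal_le_ofReal ?_
    have hnn := mul_nonneg (sq_nonneg (k p.1 - k p.2)) (cknK_nonneg γ α p.1 p.2)
    refine mul_le_mul_of_nonneg_right ?_ hnn
    rcases bi_cases x₀ p.1 with h | ⟨h, h2⟩
    · rw [h]; exact mul_self_nonneg _
    · have : τ n p.1 = 1 := by
        show eta (5 / 2) x₀ p.1 * psi (1 / ((n : ℝ) + 1)) p.1 = 1
        rw [eta_one (by linarith), psi_one (hr n) (by linarith), mul_one]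
      rw [h, this, mul_one]
  · have hs : Supp0 (τ n) := by
      refine ⟨1 / ((n : ℝ) + 1), hr n, |x₀| + 3, fun x hx' => ?_⟩
      show eta (5 / 2) x₀ x * psi (1 / ((n : ℝ) + 1)) x = 0
      rw [not_and_or, not_le, not_le] at hx'
      rcases hx' with h | h
      · rw [psi_zero (hr n) h.le, mul_zero]
      · have := abs_sub_abs_le_abs_sub x x₀
        rw [eta_zero (by linarith), zero_mul]
    obtain ⟨e1, e2⟩ := eta_energy (b := 5 / 2) le_rfl hA
    obtain ⟨e3, e4⟩ := psi_energy hγ hα hq hA0 hA' (hr n) (hr1 n)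
    have hpt : ∀ p : ℝ × ℝ, (τ n p.1 - τ n p.2) ^ 2 * cknK γ α p.1 p.2 ≤
        2 * ((eta (5 / 2) x₀ p.1 - eta (5 / 2) x₀ p.2) ^ 2 * cknK γ α p.1 p.2) +
        2 * ((psi (1 / ((n : ℝ) + 1)) p.1 - psi (1 / ((n : ℝ) + 1)) p.2) ^ 2 * cknK γ α p.1 p.2) := by
      intro p
      have hKn := cknK_nonneg γ α p.1 p.2
      simp only [τ]
      have a1 := eta_nonneg (5 / 2) x₀ p.1
      have a2 := eta_le_one (5 / 2) x₀ p.1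
      have a3 := psi_nonneg (1 / ((n : ℝ) + 1)) p.2
      have a4 := psi_le_one (1 / ((n : ℝ) + 1)) p.2
      generalize eta (5 / 2) x₀ p.1 = a at *
      generalize eta (5 / 2) x₀ p.2 = b at *
      generalize psi (1 / ((n : ℝ) + 1)) p.1 = c at *
      generalize psi (1 / ((n : ℝ) + 1)) p.2 = d at *
      have h1 : (a * c - b * d) ^ 2 ≤ 2 * (a - b) ^ 2 + 2 * (c - d) ^ 2 := by
        have e : a * c - b * d = a * (c - d) + (a - b) * d := by ring
        have h2 : (a * (c - d)) ^ 2 ≤ (c - d) ^ 2 := by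
          rw [mul_pow]
          exact mul_le_of_le_one_left (sq_nonneg _) (pow_le_one₀ a1 a2)
        have h3 : ((a - b) * d) ^ 2 ≤ (a - b) ^ 2 := by
          rw [mul_pow]
          exact mul_le_of_le_one_right (sq_nonneg _) (pow_le_one₀ a3 a4)
        rw [e]
        nlinarith [sq_nonneg (a * (c - d) - (a - b) * d)]
      have h2 := mul_le_mul_of_nonneg_right h1 hKn
      linarith
    have hd := (e1.const_mul 2).add (e3.const_mul 2)
    have hmeas : Measurable (fun p : ℝ × ℝ => (τ n p.1 - τ n p.2) ^ 2 * cknK γ α p.1 p.2) := by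
      have := hτm n
      fun_prop
    have hD : Integrable (fun p : ℝ × ℝ => (τ n p.1 - τ n p.2) ^ 2 * cknK γ α p.1 p.2) := by
      refine hd.mono' hmeas.aestronglyMeasurable (ae_of_all _ fun p => ?_)
      rw [Real.norm_eq_abs, abs_of_nonneg (mul_nonneg (sq_nonneg _) (cknK_nonneg _ _ _ _))]
      exact hpt p
    refine caseI hγ hα hθ hθ₀ hN hT hk hm (hτ n) hs
      (fun x => mul_nonneg (eta_nonneg _ _ _) (psi_nonneg _ _))
      (fun x => (mul_le_of_le_one_right (eta_nonneg _ _ _) (psi_le_one _ _)).trans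
        (eta_le_Ei le_rfl x)) hb hD ?_
    have h1 := integral_mono hD hd hpt
    simp only [Pi.add_apply] at h1
    rw [integral_add (e1.const_mul 2) (e3.const_mul 2), integral_const_mul, integral_const_mul] at h1
    linarith
end

/-- truncated power -/
noncomputable def Psi (q r x : ℝ) : ℝ := min 1 ((r ^ q)⁻¹ * |x| ^ q)

lemma Psi_nonneg {q r : ℝ} (hr : 0 < r) (x : ℝ) : 0 ≤ Psi q r x :=
  le_min zero_le_one (by positivity)

lemma Psi_le_one (q r x : ℝ) : Psi q r x ≤ 1 := min_le_left _ _

lemma Psi_one {q r x : ℝ} (hq : 0 < q) (hr : 0 < r) (hx : r ≤ |x|) : Psi q r x = 1 := by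
  refine min_eq_left ?_
  rw [le_inv_mul_iff₀ (by positivity), mul_one]
  exact Real.rpow_le_rpow hr.le hx hq.le

lemma Psi_eq {q r x : ℝ} (hq : 0 < q) (hr : 0 < r) (hx : |x| ≤ r) :
    Psi q r x = (r ^ q)⁻¹ * |x| ^ q := by
  refine min_eq_right ?_
  rw [inv_mul_le_iff₀ (by positivity), mul_one]
  exact Real.rpow_le_rpow (abs_nonneg _) hx hq.le

lemma Psi_reg {q r : ℝ} (hq : 0 < q) (hq1 : q ≤ 1) (hr : 0 < r) : Reg (Psi q r) := by
  refine Reg.of_lip (K := 1) ?_ (fun x => ?_) (fun δ hδ => ⟨(r ^ q)⁻¹ * δ ^ (q - 1), fun x y hx => ?_⟩)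
  · unfold Psi; fun_prop
  · rw [abs_of_nonneg (Psi_nonneg hr x)]; exact Psi_le_one _ _ _
  · have h := abs_min_sub_min_le_max 1 ((r ^ q)⁻¹ * |x| ^ q) 1 ((r ^ q)⁻¹ * |y| ^ q)
    refine h.trans (max_le ?_ ?_)
    · rw [sub_self, abs_zero]; positivity
    · rw [← mul_sub, abs_mul, abs_of_pos (by positivity : 0 < (r ^ q)⁻¹), mul_assoc]
      exact mul_le_mul_of_nonneg_left (rpow_lip hq hq1 hδ hx) (by positivity)

section
variable {γ α : ℝ}

lemma Lop_Psi (hγ : γ ∈ Set.Ico (1 / 3 : ℝ) (1 / 2)) (hα : α ∈ Set.Ioo (0 : ℝ) (1 / 2))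
    (hq : 0 < 2 * γ + 2 * α - 1) {r x : ℝ} (hr : 0 < r) (hr1 : r ≤ 1 / 16) (hx : x ≠ 0) :
    0 ≤ Lop γ α (Psi (2 * γ + 2 * α - 1) r) x := by
  set q := 2 * γ + 2 * α - 1 with hqdef
  have hq1 : q ≤ 1 := by linarith [hα.2, hγ.2]
  unfold Lop
  by_cases h : r ≤ |x|
  · refine integral_nonneg fun y => mul_nonneg ?_ (cknK_nonneg _ _ _ _)
    rw [Psi_one hq hr h]
    linarith [Psi_le_one q r y]
  · have h' : |x| < r := not_le.mp h
    have i1 := (pow_int hα hγ hq hx (by linarith)).const_mul (r ^ q)⁻¹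
    have i2 := (Psi_reg hq hq1 hr).integrable_y hγ hα hx
    have e : ∫ y, (r ^ q)⁻¹ * ((|x| ^ q - |y| ^ q) * cknK γ α x y) = 0 := by
      rw [integral_const_mul, pow_zero_int x hx, mul_zero]
    rw [← e]
    refine integral_mono i1 i2 fun y => ?_
    simp only []
    rw [← mul_assoc]
    refine mul_le_mul_of_nonneg_right ?_ (cknK_nonneg _ _ _ _)
    rw [Psi_eq hq hr h'.le, mul_sub]
    have : Psi q r y ≤ (r ^ q)⁻¹ * |y| ^ q := min_le_right _ _
    linarith

lemma Lop_const (c x : ℝ) : Lop γ α (fun _ => c) x = 0 := by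
  unfold Lop; simp

lemma pos_pt {x₀ m r : ℝ} (hx : |x₀| < 9 / 4) (hr1 : r ≤ 1 / 16) {k ζ : ℝ → ℝ}
    (hm : ∀ x, |k x| ≤ m) (hζ0 : ∀ x, 0 ≤ ζ x)
    (hζ : ∀ x, r ≤ |x| → ζ x = eta (5 / 2) x₀ x * eta (5 / 2) x₀ x) (p : ℝ × ℝ) :
    |eta (5 / 2) x₀ p.1 * eta (5 / 2) x₀ p.1 - eta (5 / 2) x₀ p.2 * eta (5 / 2) x₀ p.2| *
      |k p.1 * k p.1 - k p.2 * k p.2| * cknK γ α p.1 p.2 ≤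
      1 / 2 * ((ζ p.1 + ζ p.2) * ((k p.1 - k p.2) ^ 2 * cknK γ α p.1 p.2)) +
      256 * m ^ 2 * (Wd γ α x₀ p + Wd γ α x₀ p.swap) := by
  obtain ⟨x, y⟩ := p
  simp only [Prod.swap_prod_mk]
  have hm0 : 0 ≤ m := (abs_nonneg _).trans (hm 0)
  have h1 : ∀ z, |z| < 1 / 8 → |z - x₀| ≤ 5 / 2 - 1 / 8 := fun z hz => by
    have := abs_sub z x₀; linarith
  have hK := cknK_nonneg γ α x y
  have n1 : 0 ≤ 1 / 2 * ((ζ x + ζ y) * ((k x - k y) ^ 2 * cknK γ α x y)) := by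
    have := hζ0 x; have := hζ0 y; positivity
  have w1 := Wd_nonneg γ α x₀ (x, y)
  have w2 := Wd_nonneg γ α x₀ (y, x)
  have key : ∀ x y : ℝ, |x| < 1 / 16 →
      |eta (5 / 2) x₀ x * eta (5 / 2) x₀ x - eta (5 / 2) x₀ y * eta (5 / 2) x₀ y| *
      |k x * k x - k y * k y| * cknK γ α x y ≤ 256 * m ^ 2 * Wd γ α x₀ (x, y) := by
    intro x y hx'
    have hK := cknK_nonneg γ α x y
    have w1 := Wd_nonneg γ α x₀ (x, y)
    by_cases hy : |y| < 1 / 8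
    · rw [eta_one (h1 x (by linarith)), eta_one (h1 y hy)]
      simp only [sub_self, abs_zero, zero_mul]
      positivity
    · have hd : 1 / 16 ≤ |x - y| := by
        have := abs_sub_abs_le_abs_sub y x
        rw [abs_sub_comm]; linarith [not_lt.mp hy]
      have hd2 : 1 / 256 ≤ min 1 ((x - y) ^ 2) := by
        refine le_min (by norm_num) ?_
        rw [← sq_abs]; nlinarith
      have hE : Ei x₀ x = 1 := Ei_one (by linarith [h1 x (by linarith)])
      have e0 : ∀ z, 0 ≤ eta (5 / 2) x₀ z * eta (5 / 2) x₀ z := fun z => mul_self_nonneg _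
      have e1 : ∀ z, eta (5 / 2) x₀ z * eta (5 / 2) x₀ z ≤ 1 := fun z => by
        have a := eta_nonneg (5 / 2) x₀ z
        have b := eta_le_one (5 / 2) x₀ z
        nlinarith
      have k0 : ∀ z, k z * k z ≤ m ^ 2 := fun z => by
        have := hm z
        rw [← abs_mul_abs_self, sq]; exact mul_self_le_mul_self (abs_nonneg _) this
      have a1 : |eta (5 / 2) x₀ x * eta (5 / 2) x₀ x - eta (5 / 2) x₀ y * eta (5 / 2) x₀ y| ≤ 1 := by
        rw [abs_le]; constructor <;> linarith [e0 x, e0 y, e1 x, e1 y]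
      have a2 : |k x * k x - k y * k y| ≤ m ^ 2 := by
        rw [abs_le]; constructor <;>
          linarith [k0 x, k0 y, mul_self_nonneg (k x), mul_self_nonneg (k y)]
      have a3 : 1 / 256 * cknK γ α x y ≤ Wd γ α x₀ (x, y) := by
        unfold Wd; rw [hE, one_mul]
        exact mul_le_mul_of_nonneg_right hd2 hK
      calc _ ≤ 1 * m ^ 2 * cknK γ α x y := by gcongr
        _ = 256 * m ^ 2 * (1 / 256 * cknK γ α x y) := by ring
        _ ≤ _ := by gcongr
  by_cases hx1 : |x| < 1 / 16
  · refine (key x y hx1).trans ?_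
    have : 0 ≤ 256 * m ^ 2 * Wd γ α x₀ (y, x) := by positivity
    linarith
  by_cases hy1 : |y| < 1 / 16
  · have := key y x hy1
    rw [abs_sub_comm, abs_sub_comm (k y * k y), cknK_symm] at this
    refine this.trans ?_
    have : 0 ≤ 256 * m ^ 2 * Wd γ α x₀ (x, y) := by positivity
    linarith
  have s1 := mul_le_mul_of_nonneg_right (sq_pt (eta (5 / 2) x₀ x) (eta (5 / 2) x₀ y) (hm x) (hm y)) hK
  have s2 := sq_le_Wd (γ := γ) (α := α) (x₀ := x₀) (f := eta (5 / 2) x₀) (L := 8) (c := 0) (by norm_num)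
    (fun x => ⟨eta_nonneg _ _ _, eta_le_one _ _ _⟩) (eta_lip _ x₀)
    (fun x hx => eta_zero (by linarith)) x y
  rw [hζ x (by linarith [not_lt.mp hx1]), hζ y (by linarith [not_lt.mp hy1])]
  have s3 := mul_le_mul_of_nonneg_left s2 (by positivity : 0 ≤ 4 * m ^ 2)
  nlinarith

lemma pos_step {θ θ₀ x₀ m N T A : ℝ} (hγ : γ ∈ Set.Ico (1 / 3 : ℝ) (1 / 2))
    (hα : α ∈ Set.Ioo (0 : ℝ) (1 / 2)) (hθ : θ ∈ Set.Icc 0 θ₀)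
    (hθ₀ : θ₀ < 1) {k : ℝ → ℝ} (hN : 0 ≤ N) (hT : 0 ≤ T) (hk : Reg k) (hm : ∀ x, |k x| ≤ m)
    (hb : ∀ᵐ x : ℝ, |x - x₀| ≤ 5 / 2 → |Lop γ α k x| ≤ N * |x| ^ (-θ) + T * |x| ^ (-α))
    (hA : Integrable (Wd γ α x₀) ∧ ∫ p, Wd γ α x₀ p ≤ A)
    (hq : 0 < 2 * γ + 2 * α - 1) (hx : |x₀| < 9 / 4) {r R : ℝ} (hr : 0 < r) (hr1 : r ≤ 1 / 16)
    (hR : 0 < R) (hRr : 2 * R ≤ r) :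
    ∫⁻ p : ℝ × ℝ, ENNReal.ofReal ({x : ℝ | r ≤ |x|}.indicator (bi x₀) p.1 *
        ((k p.1 - k p.2) ^ 2 * cknK γ α p.1 p.2)) ≤
      ENNReal.ofReal (4 * (m * (N * cV θ₀ + T * cV (1 / 2))) + 256 * m ^ 2 * (2 * A) +
        2 * ((r ^ (2 * γ + 2 * α - 1))⁻¹ *
          ∫ x, k (R * x) * k (R * x) * |Lop γ α (om (2 * γ + 2 * α - 1)) x|)) := by
  set q := 2 * γ + 2 * α - 1 with hqdef
  have hq1 : q ≤ 1 := by linarith [hα.2, hγ.2]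
  have hcr : 0 < (r ^ q)⁻¹ := by positivity
  let s : ℝ → ℝ := fun x => eta (5 / 2) x₀ x * eta (5 / 2) x₀ x
  let ζ : ℝ → ℝ := fun x => s x - ((1 - Psi q r x) - - ((r ^ q)⁻¹ * omR q R x))
  have hsr : Reg s := (eta_reg _ _).mul (eta_reg _ _)
  have hor : Reg (fun x => (r ^ q)⁻¹ * omR q R x) := (Reg.const _).mul (omR_reg hq hq1 hR)
  have hor' : Reg (fun x => - ((r ^ q)⁻¹ * omR q R x)) := by
    have := (Reg.const 0).sub hor
    simpa using this
  have hΨ := Psi_reg hq hq1 hr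
  have hζr : Reg ζ := hsr.sub (((Reg.const 1).sub hΨ).sub hor')
  have h1 : ∀ z, |z| < 1 / 8 → |z - x₀| ≤ 5 / 2 - 1 / 8 := fun z hz => by
    have := abs_sub z x₀; linarith
  have hs1 : ∀ z, |z| < 1 / 8 → s z = 1 := fun z hz => by
    simp only [s]; rw [eta_one (h1 z hz), one_mul]
  have hs01 : ∀ z, 0 ≤ s z ∧ s z ≤ 1 := fun z => by
    have a := eta_nonneg (5 / 2) x₀ z
    have b := eta_le_one (5 / 2) x₀ z
    exact ⟨mul_self_nonneg _, by simp only [s]; nlinarith⟩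
  have hζs : ∀ x, r ≤ |x| → ζ x = s x := fun x hx => by
    simp only [ζ]; rw [Psi_one hq hr hx, omR_zero hR (by linarith)]; ring
  have hζp : ∀ x, |x| < r → ζ x = (r ^ q)⁻¹ * (|x| ^ q - omR q R x) := fun x hx => by
    simp only [ζ]; rw [hs1 x (by linarith), Psi_eq hq hr hx.le]; ring
  have hζ0 : ∀ x, 0 ≤ ζ x := fun x => by
    by_cases h : r ≤ |x|
    · rw [hζs x h]; exact (hs01 x).1
    · rw [hζp x (not_le.mp h)]
      exact mul_nonneg hcr.le (by linarith [omR_le (q := q) hR x])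
  have hζE : ∀ x, ζ x ≤ Ei x₀ x := fun x => by
    by_cases h : r ≤ |x|
    · rw [hζs x h]
      have := eta_le_Ei (x₀ := x₀) (le_refl (5 / 2)) x
      have b := eta_le_one (5 / 2) x₀ x
      have a := eta_nonneg (5 / 2) x₀ x
      simp only [s]; nlinarith
    · have h' := not_le.mp h
      rw [Ei_one (by linarith [h1 x (by linarith)])]
      simp only [ζ]
      have := (hs01 x).2
      have := Psi_le_one q r x
      have := mul_nonneg hcr.le (omR_nonneg (q := q) hR x)
      linarith
  have hsupp : Supp0 ζ := by
    refine ⟨R, hR, 5, fun x hx' => ?_⟩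
    rw [not_and_or, not_le, not_le] at hx'
    rcases hx' with h | h
    · rw [hζp x (by linarith), omR_eq hq hR h.le, sub_self, mul_zero]
    · rw [hζs x (by linarith)]
      have : 5 / 2 ≤ |x - x₀| := by
        have := abs_sub_abs_le_abs_sub x x₀; linarith
      simp only [s]; rw [eta_zero this, zero_mul]
  have hP : Integrable (fun x => (r ^ q)⁻¹ * |Lop γ α (omR q R) x|) :=
    (Lop_omR_int hγ hα hq hR).abs.const_mul _
  have hD := (hA.1.add hA.1.swap).const_mul (256 * m ^ 2)
  obtain ⟨hi, he⟩ := absorb hγ hα (φ := s) hk hζr hsupp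
    (int_s hγ hα hx hsr hs01 hs1 (fun x hx => by simp only [s]; rw [eta_zero hx.le, zero_mul]))
    hP (by
      filter_upwards [ae_ne_zero] with x hx0
      have e1 := Lop_sub hγ hα hsr (((Reg.const 1).sub hΨ).sub hor') hx0
      have e2 := Lop_sub hγ hα ((Reg.const 1).sub hΨ) hor' hx0
      have e3 := Lop_sub hγ hα (Reg.const 1) hΨ hx0
      have e4 : Lop γ α (fun x => - ((r ^ q)⁻¹ * omR q R x)) x = - ((r ^ q)⁻¹ * Lop γ α (omR q R) x) := by
        have := Lop_const_mul (γ := γ) (α := α) (-(r ^ q)⁻¹) (omR q R) x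
        simpa only [neg_mul] using this
      rw [Lop_const] at e3
      rw [e3, e4] at e2
      rw [e2] at e1
      have e5 : Lop γ α ζ x = _ := e1
      rw [e5]
      have p1 := Lop_Psi hγ hα hq hr hr1 hx0
      have p2 := mul_le_mul_of_nonneg_left (le_abs_self (Lop γ α (omR q R) x)) hcr.le
      linarith) hD (pos_pt hx hr1 hm hζ0 hζs)
  have hn : ∀ p : ℝ × ℝ, 0 ≤ (k p.1 - k p.2) ^ 2 * cknK γ α p.1 p.2 := fun p =>
    mul_nonneg (sq_nonneg _) (cknK_nonneg _ _ _ _)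
  have hle : ∫⁻ p : ℝ × ℝ, ENNReal.ofReal ({x : ℝ | r ≤ |x|}.indicator (bi x₀) p.1 *
        ((k p.1 - k p.2) ^ 2 * cknK γ α p.1 p.2)) ≤
      ∫⁻ p : ℝ × ℝ, ENNReal.ofReal (ζ p.1 * ((k p.1 - k p.2) ^ 2 * cknK γ α p.1 p.2)) := by
    refine lintegral_mono fun p => ENNReal.ofReal_le_ofReal (mul_le_mul_of_nonneg_right ?_ (hn p))
    by_cases h : r ≤ |p.1|
    · rw [Set.indicator_of_mem (by exact h), hζs _ h]
      rcases bi_cases x₀ p.1 with h | ⟨h, h2⟩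
      · rw [h]; exact (hs01 _).1
      · rw [h]; simp only [s]; rw [eta_one (by linarith), one_mul]
    · rw [Set.indicator_of_notMem (by exact h)]; exact hζ0 _
  refine hle.trans ?_
  rw [← ofReal_integral_eq_lintegral_ofReal hi (ae_of_all _ fun p => mul_nonneg (hζ0 _) (hn p))]
  refine ENNReal.ofReal_le_ofReal (he.trans ?_)
  have t1 := Lop_term (ζ := ζ) hα hθ hθ₀ hN hT hm hζ0 hζE hb
  have t2 : ∫ p, (256 * m ^ 2) * ((Wd γ α x₀ + Wd γ α x₀ ∘ Prod.swap) p) ≤ 256 * m ^ 2 * (2 * A) := by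
    rw [integral_const_mul]
    refine mul_le_mul_of_nonneg_left ?_ (by positivity)
    have e := integral_add hA.1 hA.1.swap
    have e2 := integral_swap_prod (Wd γ α x₀)
    calc _ = _ := e
      _ = (∫ p, Wd γ α x₀ p) + ∫ p, Wd γ α x₀ p := congrArg (fun t => (∫ p, Wd γ α x₀ p) + t) e2
      _ ≤ _ := by linarith [hA.2]
  have t3 : ∫ x, k x * k x * ((r ^ q)⁻¹ * |Lop γ α (omR q R) x|) =
      (r ^ q)⁻¹ * ∫ x, k (R * x) * k (R * x) * |Lop γ α (om q) x| := by
    rw [← int_Lop_omR hR (fun x => k x * k x), ← integral_const_mul]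
    congr 1; ext x; ring
  rw [t3]
  linarith

lemma core_pos {θ θ₀ x₀ m N T A c : ℝ} (hγ : γ ∈ Set.Ico (1 / 3 : ℝ) (1 / 2))
    (hα : α ∈ Set.Ioo (0 : ℝ) (1 / 2)) (hθ : θ ∈ Set.Icc 0 θ₀)
    (hθ₀ : θ₀ < 1) {g : ℝ → ℝ} (hN : 0 ≤ N) (hT : 0 ≤ T) (hk : Reg g) (hm : ∀ x, |g x| ≤ m)
    (hb : ∀ᵐ x : ℝ, |x - x₀| ≤ 5 / 2 → |Lop γ α g x| ≤ N * |x| ^ (-θ) + T * |x| ^ (-α))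
    (hA : Integrable (Wd γ α x₀) ∧ ∫ p, Wd γ α x₀ p ≤ A)
    (hq : 0 < 2 * γ + 2 * α - 1) (hx : |x₀| < 9 / 4) {R : ℕ → ℝ} (hR : ∀ n, 0 < R n)
    (hR0 : Filter.Tendsto R Filter.atTop (nhds 0))
    (hc : ∀ᵐ x : ℝ, Filter.Tendsto (fun n => g (R n * x)) Filter.atTop (nhds c)) :
    ∫⁻ p : ℝ × ℝ, ENNReal.ofReal (bi x₀ p.1 * ((g p.1 - g p.2) ^ 2 * cknK γ α p.1 p.2)) ≤
      ENNReal.ofReal (4 * (2 * m * (N * cV θ₀ + T * cV (1 / 2))) + 256 * (2 * m) ^ 2 * (2 * A)) := by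
  have hcm : |c| ≤ m := by
    obtain ⟨x, hx⟩ := hc.exists
    exact le_of_tendsto hx.abs (Filter.Eventually.of_forall fun n => hm _)
  have hm0 : 0 ≤ m := (abs_nonneg _).trans hcm
  let k : ℝ → ℝ := fun x => g x - c
  have hkr : Reg k := hk.sub (Reg.const c)
  have hkm : ∀ x, |k x| ≤ 2 * m := fun x => by
    have := abs_sub (g x) c
    simp only [k]; linarith [hm x]
  have hkL : Lop γ α k = Lop γ α g := by
    ext x; unfold Lop; congr 1; ext y; simp only [k]; ring
  have hkb : ∀ᵐ x : ℝ, |x - x₀| ≤ 5 / 2 → |Lop γ α k x| ≤ N * |x| ^ (-θ) + T * |x| ^ (-α) := by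
    rw [hkL]; exact hb
  have hkm' := hkr.1
  have hLi := (Lop_om_int hγ hα hq).abs
  have hlim : Filter.Tendsto (fun n => ∫ x, k (R n * x) * k (R n * x) *
      |Lop γ α (om (2 * γ + 2 * α - 1)) x|) Filter.atTop (nhds (∫ x : ℝ, (0 : ℝ))) := by
    refine tendsto_integral_of_dominated_convergence
      (fun x => (2 * m) ^ 2 * |Lop γ α (om (2 * γ + 2 * α - 1)) x|) (fun n => ?_) (hLi.const_mul _)
      (fun n => ae_of_all _ fun x => ?_) ?_
    · have : Measurable (fun x => k (R n * x) * k (R n * x)) := by fun_prop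
      exact this.aestronglyMeasurable.mul hLi.aestronglyMeasurable
    · rw [norm_mul, norm_mul, Real.norm_eq_abs, Real.norm_eq_abs, abs_abs, sq]
      gcongr <;> exact hkm _
    · filter_upwards [hc] with x hx
      have h1 : Filter.Tendsto (fun n => k (R n * x)) Filter.atTop (nhds 0) := by
        have := hx.sub_const c
        rwa [sub_self] at this
      have := (h1.mul h1).mul_const |Lop γ α (om (2 * γ + 2 * α - 1)) x|
      simpa using this
  rw [integral_zero] at hlim
  have hstep : ∀ r, 0 < r → r ≤ 1 / 16 →
      ∫⁻ p : ℝ × ℝ, ENNReal.ofReal ({x : ℝ | r ≤ |x|}.indicator (bi x₀) p.1 *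
        ((k p.1 - k p.2) ^ 2 * cknK γ α p.1 p.2)) ≤
      ENNReal.ofReal (4 * (2 * m * (N * cV θ₀ + T * cV (1 / 2))) + 256 * (2 * m) ^ 2 * (2 * A)) := by
    intro r hr hr1
    have h2 := ((hlim.const_mul (r ^ (2 * γ + 2 * α - 1))⁻¹).const_mul 2).const_add
      (4 * (2 * m * (N * cV θ₀ + T * cV (1 / 2))) + 256 * (2 * m) ^ 2 * (2 * A))
    rw [mul_zero, mul_zero, add_zero] at h2
    refine ge_of_tendsto (ENNReal.tendsto_ofReal h2) ?_
    have h3 : ∀ᶠ n in Filter.atTop, R n < r / 2 := hR0.eventually_lt_const (by positivity)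
    filter_upwards [h3] with n hn
    exact pos_step hγ hα hθ hθ₀ hN hT hkr hkm hkb hA hq hx hr hr1 (hR n) (by linarith)
  have hK := cknK_meas γ α
  have hgm := hk.1
  have hr : ∀ n : ℕ, 0 < 1 / ((n : ℝ) + 16) := fun n => by positivity
  have hr0 : Filter.Tendsto (fun n : ℕ => 1 / ((n : ℝ) + 16)) Filter.atTop (nhds 0) := by
    have : Filter.Tendsto (fun n : ℕ => (n : ℝ) + 16) Filter.atTop Filter.atTop :=
      tendsto_natCast_atTop_atTop.atTop_add tendsto_const_nhds
    simp only [one_div]; exact this.inv_tendsto_atTop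
  refine fatou_h (f := fun (n : ℕ) (p : ℝ × ℝ) => ENNReal.ofReal
      ({x : ℝ | 1 / ((n : ℝ) + 16) ≤ |x|}.indicator (bi x₀) p.1 *
        ((k p.1 - k p.2) ^ 2 * cknK γ α p.1 p.2))) (fun n => ?_) ?_
      (fun n => hstep _ (hr n) ?_) tendsto_const_nhds
  · have hi : Measurable ({x : ℝ | 1 / ((n : ℝ) + 16) ≤ |x|}.indicator (bi x₀)) :=
      (bi_meas x₀).indicator (measurableSet_le measurable_const (by fun_prop))
    refine Measurable.ennreal_ofReal ?_
    exact (hi.comp measurable_fst).mul (by fun_prop)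
  · filter_upwards [ae_fst_ne] with p hp
    refine le_liminf_of_ev ?_
    filter_upwards [hr0.eventually_lt_const (abs_pos.mpr hp)] with n hn
    rw [Set.indicator_of_mem (by exact hn.le)]
    refine le_of_eq ?_
    simp only [k]; congr 3; ring
  · exact one_div_le_one_div_of_le (by norm_num) (by have : (0 : ℝ) ≤ n := n.cast_nonneg; linarith)
end

/-- the tail weight -/
noncomputable def tw (γ α x₀ y : ℝ) : ℝ :=
  {y : ℝ | 11 / 4 ≤ |y - x₀|}.indicator (fun y => |y - x₀| ^ (-(1 + 2 * γ)) * |y| ^ (-α)) y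

noncomputable def cT : ℝ := (∫ z, ww z) + 2 * ∫ y, vw (1 / 2) y

lemma cT_nonneg : 0 ≤ cT :=
  add_nonneg (integral_nonneg ww_nonneg) (mul_nonneg (by norm_num) (integral_nonneg (vw_nonneg _)))

section
variable {γ α : ℝ}

lemma tw_nonneg (γ α x₀ y : ℝ) : 0 ≤ tw γ α x₀ y :=
  Set.indicator_nonneg (fun x _ => by positivity) y

lemma tw_meas (γ α x₀ : ℝ) : Measurable (tw γ α x₀) :=
  Measurable.indicator (by fun_prop) (measurableSet_le measurable_const (by fun_prop))

lemma tw_int (hγ : γ ∈ Set.Ico (1 / 3 : ℝ) (1 / 2)) (hα : α ∈ Set.Ioo (0 : ℝ) (1 / 2)) (x₀ : ℝ) :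
    Integrable (tw γ α x₀) ∧ ∫ y, tw γ α x₀ y ≤ cT := by
  have hb : ∀ y, tw γ α x₀ y ≤ ww (y - x₀) + 2 * vw (1 / 2) y := by
    intro y
    have w0 := ww_nonneg (y - x₀)
    have v0 := vw_nonneg (1 / 2) y
    unfold tw
    by_cases h : 11 / 4 ≤ |y - x₀|
    · rw [Set.indicator_of_mem (by exact h)]
      have h1 := min_ker_le hγ (y - x₀)
      have h2 : min 1 ((y - x₀) ^ 2) = 1 := min_eq_left (by rw [← sq_abs]; nlinarith)
      rw [h2, one_mul] at h1
      have h3 := abs_rpow_le_vw hα.1.le hα.2.le y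
      have h4 := ww_le_two (y - x₀)
      calc _ ≤ ww (y - x₀) * (1 + vw (1 / 2) y) := by gcongr
        _ ≤ _ := by nlinarith
    · rw [Set.indicator_of_notMem (by exact h)]; positivity
  have i1 : Integrable (fun y => ww (y - x₀)) := ww_int.comp_sub_right x₀
  have i2 : Integrable (fun y => 2 * vw (1 / 2) y) := (vw_int (by norm_num)).const_mul 2
  have hi : Integrable (tw γ α x₀) := by
    refine (i1.add i2).mono' (tw_meas γ α x₀).aestronglyMeasurable (ae_of_all _ fun y => ?_)
    rw [Real.norm_eq_abs, abs_of_nonneg (tw_nonneg _ _ _ _)]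
    exact hb y
  refine ⟨hi, (integral_mono hi (i1.add i2) hb).trans (le_of_eq ?_)⟩
  have hh := integral_add i1 i2
  simp only [Pi.add_apply] at hh ⊢
  rw [hh, integral_const_mul, integral_sub_right_eq_self (fun y => ww y)]
  rfl

lemma tw_mul_int (hγ : γ ∈ Set.Ico (1 / 3 : ℝ) (1 / 2)) (hα : α ∈ Set.Ioo (0 : ℝ) (1 / 2)) (x₀ : ℝ)
    {h : ℝ → ℝ} (hm : Measurable h) {K : ℝ} (hK : ∀ x, |h x| ≤ K) :
    Integrable (fun y => tw γ α x₀ y * |h y|) := by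
  have := (tw_int hγ hα x₀).1.bdd_mul (c := K) (f := fun y => |h y|) (by fun_prop)
    (ae_of_all _ fun y => by rw [Real.norm_eq_abs, abs_abs]; exact hK y)
  simpa only [mul_comm] using this

lemma cut_Lop (hγ : γ ∈ Set.Ico (1 / 3 : ℝ) (1 / 2)) (hα : α ∈ Set.Ioo (0 : ℝ) (1 / 2)) {x₀ x : ℝ}
    {h : ℝ → ℝ} (hh : Reg h) (hx0 : x ≠ 0) (hx : |x - x₀| ≤ 5 / 2) :
    |Lop γ α (fun x => h x * eta (23 / 8) x₀ x) x| ≤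
      |Lop γ α h x| + (121 * ∫ y, tw γ α x₀ y * |h y|) * |x| ^ (-α) := by
  have hg : Reg (fun x => h x * eta (23 / 8) x₀ x) := hh.mul (eta_reg _ _)
  have e := Lop_sub hγ hα hh hg hx0
  obtain ⟨hm, ⟨K, hK⟩, -⟩ := hh
  have hi := (tw_mul_int hγ hα x₀ hm hK).const_mul (121 * |x| ^ (-α))
  have hb : |Lop γ α (fun x => h x - h x * eta (23 / 8) x₀ x) x| ≤
      (121 * ∫ y, tw γ α x₀ y * |h y|) * |x| ^ (-α) := by
    have h1 := norm_integral_le_of_norm_le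
      (f := fun y => ((h x - h x * eta (23 / 8) x₀ x) - (h y - h y * eta (23 / 8) x₀ y)) *
        cknK γ α x y) hi (ae_of_all _ fun y => by
      have hK0 := cknK_nonneg γ α x y
      rw [eta_one (by linarith : |x - x₀| ≤ 23 / 8 - 1 / 8), mul_one, sub_self, zero_sub, norm_mul,
        norm_neg, Real.norm_eq_abs, Real.norm_eq_abs, abs_of_nonneg hK0]
      by_cases hy : 11 / 4 ≤ |y - x₀|
      · have ht : tw γ α x₀ y = |y - x₀| ^ (-(1 + 2 * γ)) * |y| ^ (-α) :=
          Set.indicator_of_mem (by exact hy) _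
        have hd : |y - x₀| / 11 ≤ |x - y| := by
          have := abs_sub_abs_le_abs_sub (y - x₀) (x - x₀)
          rw [show y - x₀ - (x - x₀) = y - x by ring, abs_sub_comm y x] at this
          linarith
        have hp : |x - y| ^ (-(1 + 2 * γ)) ≤ 121 * |y - x₀| ^ (-(1 + 2 * γ)) := by
          calc |x - y| ^ (-(1 + 2 * γ)) ≤ (|y - x₀| / 11) ^ (-(1 + 2 * γ)) :=
                Real.rpow_le_rpow_of_nonpos (by linarith) hd (by linarith [hγ.1])
            _ = 11 ^ (1 + 2 * γ) * |y - x₀| ^ (-(1 + 2 * γ)) := by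
                rw [Real.div_rpow (abs_nonneg _) (by norm_num), Real.rpow_neg (by norm_num : (0:ℝ) ≤ 11)]
                field_simp
            _ ≤ 121 * |y - x₀| ^ (-(1 + 2 * γ)) := by
                refine mul_le_mul_of_nonneg_right ?_ (by positivity)
                calc (11 : ℝ) ^ (1 + 2 * γ) ≤ 11 ^ (2 : ℝ) :=
                      Real.rpow_le_rpow_of_exponent_le (by norm_num) (by linarith [hγ.2])
                  _ = 121 := by norm_num
        have hh1 : |h y - h y * eta (23 / 8) x₀ y| ≤ |h y| := by
          rw [← mul_one_sub, abs_mul]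
          refine mul_le_of_le_one_right (abs_nonneg _) ?_
          rw [abs_le]; constructor <;> linarith [eta_nonneg (23 / 8) x₀ y, eta_le_one (23 / 8) x₀ y]
        rw [ht]
        unfold cknK
        calc _ ≤ |h y| * ((121 * |y - x₀| ^ (-(1 + 2 * γ))) * (|x| ^ (-α) * |y| ^ (-α))) := by gcongr
          _ = _ := by ring
      · rw [eta_one (by linarith [not_le.mp hy] : |y - x₀| ≤ 23 / 8 - 1 / 8), mul_one, sub_self,
          abs_zero, zero_mul]
        have := tw_nonneg γ α x₀ y
        positivity)
    rw [integral_const_mul, Real.norm_eq_abs] at h1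
    refine h1.trans (le_of_eq (by ring))
  rw [e] at hb
  have := abs_sub_abs_le_abs_sub (Lop γ α (fun x => h x * eta (23 / 8) x₀ x) x) (Lop γ α h x)
  rw [abs_sub_comm] at this
  linarith

/-- the energy estimate for regularized functions -/
lemma core_all {θ₀ : ℝ} (hθ₀ : θ₀ < 1) : ∃ C : ℝ, 0 ≤ C ∧ ∀ (γ α θ x₀ m N G : ℝ) (h : ℝ → ℝ),
    γ ∈ Set.Ico (1 / 3 : ℝ) (1 / 2) → α ∈ Set.Ioo (0 : ℝ) (1 / 2) → θ ∈ Set.Icc 0 θ₀ →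
    0 ≤ m → 0 ≤ N → Reg h → (∀ x, |x - x₀| ≤ 23 / 8 → |h x| ≤ m) →
    (∀ᵐ x : ℝ, |x - x₀| ≤ 5 / 2 → |Lop γ α h x| ≤ N * |x| ^ (-θ)) →
    (∀ᵐ x : ℝ, |x| < 2 → |Lop γ α h x| ≤ G * |x| ^ (-θ)) →
    ∫⁻ p : ℝ × ℝ, ENNReal.ofReal (bi x₀ p.1 * (bi x₀ p.2 * ((h p.1 - h p.2) ^ 2 *
      cknK γ α p.1 p.2))) ≤
      ENNReal.ofReal (C * (m * (m + N + ∫ y, tw γ α x₀ y * |h y|))) := by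
  obtain ⟨A, hA0, hA⟩ := lemU
  have cv1 := cV_nonneg θ₀
  have cv2 := cV_nonneg (1 / 2)
  refine ⟨8 * cV θ₀ + 968 * cV (1 / 2) + 2048 * A, by positivity, ?_⟩
  intro γ α θ x₀ m N G h hγ hα hθ hm hN hh hhm hL hG
  set T := ∫ y, tw γ α x₀ y * |h y| with hTdef
  have hT : 0 ≤ T := integral_nonneg fun y => mul_nonneg (tw_nonneg _ _ _ _) (abs_nonneg _)
  let g : ℝ → ℝ := fun x => h x * eta (23 / 8) x₀ x
  have hg : Reg g := hh.mul (eta_reg _ _)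
  have hgm : ∀ x, |g x| ≤ m := fun x => by
    simp only [g]
    by_cases hx : |x - x₀| ≤ 23 / 8
    · rw [abs_mul, abs_of_nonneg (eta_nonneg _ _ _)]
      exact (mul_le_of_le_one_right (abs_nonneg _) (eta_le_one _ _ _)).trans (hhm x hx)
    · rw [eta_zero (not_le.mp hx).le, mul_zero, abs_zero]; exact hm
  have hgh : ∀ x, |x - x₀| ≤ 11 / 4 → g x = h x := fun x hx => by
    simp only [g]; rw [eta_one (by linarith), mul_one]
  have hb : ∀ᵐ x : ℝ, |x - x₀| ≤ 5 / 2 →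
      |Lop γ α g x| ≤ N * |x| ^ (-θ) + (121 * T) * |x| ^ (-α) := by
    filter_upwards [hL, ae_ne_zero] with x hx hx0 hx1
    exact (cut_Lop hγ hα hh hx0 hx1).trans (by linarith [hx hx1])
  have hT' : 0 ≤ 121 * T := by positivity
  have hle : ∫⁻ p : ℝ × ℝ, ENNReal.ofReal (bi x₀ p.1 * (bi x₀ p.2 * ((h p.1 - h p.2) ^ 2 *
      cknK γ α p.1 p.2))) ≤
      ∫⁻ p : ℝ × ℝ, ENNReal.ofReal (bi x₀ p.1 * ((g p.1 - g p.2) ^ 2 * cknK γ α p.1 p.2)) := by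
    refine lintegral_mono fun p => ENNReal.ofReal_le_ofReal ?_
    have hn := mul_nonneg (sq_nonneg (g p.1 - g p.2)) (cknK_nonneg γ α p.1 p.2)
    rcases bi_cases x₀ p.1 with h1 | ⟨h1, h1'⟩
    · rw [h1]; simp
    rcases bi_cases x₀ p.2 with h2 | ⟨h2, h2'⟩
    · rw [h1, h2]; simp only [zero_mul, mul_zero, one_mul]; exact hn
    · rw [h1, h2, hgh p.1 (by linarith), hgh p.2 (by linarith), one_mul]
  refine hle.trans ?_
  have fin : ∀ B, B ≤ 8 * (m * (N * cV θ₀ + 121 * T * cV (1 / 2))) + 2048 * (m ^ 2 * A) →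
      ENNReal.ofReal B ≤ ENNReal.ofReal ((8 * cV θ₀ + 968 * cV (1 / 2) + 2048 * A) *
        (m * (m + N + T))) := by
    intro B hB
    refine ENNReal.ofReal_le_ofReal (hB.trans ?_)
    have n1 : 0 ≤ cV θ₀ * m * m := by positivity
    have n2 : 0 ≤ cV θ₀ * m * T := by positivity
    have n3 : 0 ≤ cV (1 / 2) * m * m := by positivity
    have n4 : 0 ≤ cV (1 / 2) * m * N := by positivity
    have n5 : 0 ≤ A * m * N := by positivity
    have n6 : 0 ≤ A * m * T := by positivity
    nlinarith
  have p1 : 0 ≤ m * (N * cV θ₀ + 121 * T * cV (1 / 2)) := by positivity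
  have p2 : 0 ≤ m ^ 2 * A := by positivity
  by_cases hx : |x₀| < 9 / 4
  · by_cases hq : 0 < 2 * γ + 2 * α - 1
    · obtain ⟨c, R, hR, hR0, hc⟩ := exists_c hγ hα hq hh (lt_of_le_of_lt hθ.2 hθ₀) hG
      refine (core_pos (c := c) hγ hα hθ hθ₀ hN hT' hg hgm hb (hA γ α x₀ hγ hα) hq hx hR hR0 ?_).trans
        (fin _ (by nlinarith))
      filter_upwards [hc] with x hx'
      refine hx'.congr' ?_
      have h0 : Filter.Tendsto (fun n => |R n * x|) Filter.atTop (nhds 0) := by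
        have := (hR0.mul_const x).abs
        simpa using this
      filter_upwards [h0.eventually_lt_const (by norm_num : (0 : ℝ) < 1 / 8)] with n hn
      refine (hgh _ ?_).symm
      have := abs_sub (R n * x) x₀
      linarith
    · exact (core_neg hγ hα hθ hθ₀ hN hT' hg hgm hb hA0 (hA γ α x₀ hγ hα) (hA γ α 0 hγ hα)
        (not_lt.mp hq)).trans (fin _ (by nlinarith))
  · exact (core_far hγ hα hθ hθ₀ hN hT' hg hgm hb (hA γ α x₀ hγ hα) (not_lt.mp hx)).trans
      (fin _ (by nlinarith))
end

section
variable {γ α : ℝ}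

lemma eSemi_eq {u : ℝ → ℝ} (hu : Measurable u) (x₀ : ℝ) :
    eSemi γ α u (ball1 x₀ 2) = ∫⁻ p : ℝ × ℝ, ENNReal.ofReal (bi x₀ p.1 * (bi x₀ p.2 *
      ((u p.1 - u p.2) ^ 2 * cknK γ α p.1 p.2))) := by
  have hK := cknK_meas γ α
  have hb := bi_meas x₀
  have hS : MeasurableSet (ball1 x₀ 2) := measurableSet_Ioo
  have hm : ∀ x, x ∈ ball1 x₀ 2 ↔ |x - x₀| < 2 := fun x => by
    unfold ball1; rw [Set.mem_Ioo, abs_lt]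
    constructor <;> rintro ⟨h1, h2⟩ <;> constructor <;> linarith
  have hmeas : Measurable (fun p : ℝ × ℝ => ENNReal.ofReal (bi x₀ p.1 * (bi x₀ p.2 *
      ((u p.1 - u p.2) ^ 2 * cknK γ α p.1 p.2)))) := by fun_prop
  rw [Measure.volume_eq_prod, lintegral_prod _ hmeas.aemeasurable]
  unfold eSemi
  rw [← lintegral_indicator hS]
  refine lintegral_congr fun x => ?_
  by_cases hx : |x - x₀| < 2
  · rw [Set.indicator_of_mem ((hm x).mpr hx), ← lintegral_indicator hS]
    refine lintegral_congr fun y => ?_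
    have b1 : bi x₀ x = 1 := Set.indicator_of_mem (by exact hx) _
    by_cases hy : |y - x₀| < 2
    · have b2 : bi x₀ y = 1 := Set.indicator_of_mem (by exact hy) _
      rw [Set.indicator_of_mem ((hm y).mpr hy)]
      simp only [b1, b2, one_mul]
    · have b2 : bi x₀ y = 0 := Set.indicator_of_notMem (by exact hy) _
      rw [Set.indicator_of_notMem (fun h => hy ((hm y).mp h))]
      simp only [b2, zero_mul, mul_zero, ENNReal.ofReal_zero]
  · have b1 : bi x₀ x = 0 := Set.indicator_of_notMem (by exact hx) _
    rw [Set.indicator_of_notMem (fun h => hx ((hm x).mp h))]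
    simp [b1]

lemma weak_congr {u u' F F' : ℝ → ℝ} {I : Set ℝ} (hw : IsWeakSol γ α u F I) (hu : u' =ᵐ[volume] u)
    (hF : ∀ᵐ x : ℝ, x ∈ I → F' x = F x) : IsWeakSol γ α u' F' I := by
  intro φ h1 h2 h3
  obtain ⟨i, e⟩ := hw φ h1 h2 h3
  have a1 : ∀ᵐ p : ℝ × ℝ, u' p.1 = u p.1 := by
    rw [Measure.volume_eq_prod]; exact Measure.quasiMeasurePreserving_fst.ae hu
  have a2 : ∀ᵐ p : ℝ × ℝ, u' p.2 = u p.2 := by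
    rw [Measure.volume_eq_prod]; exact Measure.quasiMeasurePreserving_snd.ae hu
  have hc : (fun q : ℝ × ℝ => (u q.1 - u q.2) * (φ q.1 - φ q.2) * cknK γ α q.1 q.2) =ᵐ[volume]
      (fun q : ℝ × ℝ => (u' q.1 - u' q.2) * (φ q.1 - φ q.2) * cknK γ α q.1 q.2) := by
    filter_upwards [a1, a2] with p p1 p2
    rw [p1, p2]
  refine ⟨i.congr hc, ?_⟩
  rw [← integral_congr_ae hc, e]
  refine integral_congr_ae ?_
  filter_upwards [hF] with x hx
  by_cases h : x ∈ I
  · rw [hx h]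
  · rw [image_eq_zero_of_notMem_tsupport (fun h' => h (h3 h')), mul_zero, mul_zero]

lemma eSup_spec {u : ℝ → ℝ} {S : Set ℝ} (hS : MeasurableSet S) {K : ℝ} (hK : ∀ x ∈ S, |u x| ≤ K) :
    eSup u S ≠ ⊤ ∧ ∀ᵐ x : ℝ, x ∈ S → |u x| ≤ (eSup u S).toReal := by
  have h1 : eSup u S ≤ ENNReal.ofReal K := by
    unfold eSup
    rw [eLpNorm_exponent_top]
    refine essSup_le_of_ae_le _ ?_
    refine (ae_restrict_iff' hS).mpr (ae_of_all _ fun x hx => ?_)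
    show ‖u x‖ₑ ≤ ENNReal.ofReal K
    rw [Real.enorm_eq_ofReal_abs]
    exact ENNReal.ofReal_le_ofReal (hK x hx)
  have h2 : eSup u S ≠ ⊤ := ne_top_of_le_ne_top ENNReal.ofReal_ne_top h1
  refine ⟨h2, ?_⟩
  have h3 : ∀ᵐ x ∂(volume.restrict S), ‖u x‖ₑ ≤ eSup u S := by
    unfold eSup
    rw [eLpNorm_exponent_top]
    exact enorm_ae_le_eLpNormEssSup u _
  filter_upwards [(ae_restrict_iff' hS).mp h3] with x hx hxS
  have := hx hxS
  rw [Real.enorm_eq_ofReal_abs] at this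
  exact (ENNReal.ofReal_le_iff_le_toReal h2).mp this

/-- good representative -/
lemma exists_rep {u : ℝ → ℝ} (hu : Measurable u) {S I : Set ℝ} (hS : MeasurableSet S)
    (hI : MeasurableSet I) {a K : ℝ} (ha : 0 ≤ a) (hK : ∀ x ∈ I, |u x| ≤ K) (hK0 : 0 ≤ K)
    (hb : ∀ᵐ x : ℝ, x ∈ S → |u x| ≤ a) :
    ∃ v : ℝ → ℝ, Measurable v ∧ (∀ x, |v x| ≤ K) ∧ (∀ x ∈ S, |v x| ≤ a) ∧
      ∀ᵐ x : ℝ, x ∈ I → v x = u x := by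
  refine ⟨({x | x ∈ I ∧ (x ∈ S → |u x| ≤ a)}).indicator u, ?_, ?_, ?_, ?_⟩
  · refine hu.indicator (hI.inter ?_)
    have : {x | x ∈ S → |u x| ≤ a} = Sᶜ ∪ {x | |u x| ≤ a} := by
      ext x; simp only [Set.mem_ofPred_eq, Set.mem_union, Set.mem_compl_iff]; tauto
    rw [show (fun x => x ∈ S → |u x| ≤ a) = (Sᶜ ∪ {x | |u x| ≤ a} : Set ℝ) from this]
    exact hS.compl.union (measurableSet_le (by fun_prop) measurable_const)
  · intro x
    unfold Set.indicator
    split_ifs with h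
    · exact hK x h.1
    · simpa using hK0
  · intro x hx
    unfold Set.indicator
    split_ifs with h
    · exact h.2 hx
    · simpa using ha
  · filter_upwards [hb] with x hx hxI
    have hmem : x ∈ {x | x ∈ I ∧ (x ∈ S → |u x| ≤ a)} := ⟨hxI, hx⟩
    exact Set.indicator_of_mem hmem u

lemma tail_le (hγ : γ ∈ Set.Ico (1 / 3 : ℝ) (1 / 2)) (hα : α ∈ Set.Ioo (0 : ℝ) (1 / 2)) {x₀ a K : ℝ}
    {u v : ℝ → ℝ} (ha : 0 ≤ a) (hv : Measurable v) (hK : ∀ x, |v x| ≤ K)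
    (hva : ∀ x ∈ ball1 x₀ 3, |v x| ≤ a) (huv : v =ᵐ[volume] u) :
    ENNReal.ofReal (∫ y, tw γ α x₀ y * |v y|) ≤ ENNReal.ofReal cT * ENNReal.ofReal a +
      eTail γ α u x₀ 3 := by
  have hi := tw_mul_int hγ hα x₀ hv hK
  obtain ⟨i0, b0⟩ := tw_int hγ hα x₀
  have hS : MeasurableSet {x : ℝ | 3 ≤ |x - x₀|} := measurableSet_le measurable_const (by fun_prop)
  have htm := tw_meas γ α x₀
  rw [ofReal_integral_eq_lintegral_ofReal hi
    (ae_of_all _ fun y => mul_nonneg (tw_nonneg _ _ _ _) (abs_nonneg _))]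
  have h1 : ∫⁻ y, ENNReal.ofReal (tw γ α x₀ y * |v y|) ≤
      ∫⁻ y, (ENNReal.ofReal (a * tw γ α x₀ y) + {x : ℝ | 3 ≤ |x - x₀|}.indicator (fun x =>
        ENNReal.ofReal (|u x| * |x - x₀| ^ (-(1 + 2 * γ)) * |x| ^ (-α))) y) := by
    refine lintegral_mono_ae ?_
    filter_upwards [huv] with y hy
    by_cases h : 3 ≤ |y - x₀|
    · rw [Set.indicator_of_mem (by exact h)]
      have h' : 11 / 4 ≤ |y - x₀| := by linarith
      have ht : tw γ α x₀ y = |y - x₀| ^ (-(1 + 2 * γ)) * |y| ^ (-α) :=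
        Set.indicator_of_mem (by exact h') _
      refine le_trans (ENNReal.ofReal_le_ofReal (le_of_eq ?_)) le_add_self
      rw [ht, hy]; ring
    · rw [Set.indicator_of_notMem (by exact h), add_zero, mul_comm a]
      refine ENNReal.ofReal_le_ofReal (mul_le_mul_of_nonneg_left ?_ (tw_nonneg _ _ _ _))
      refine hva y ?_
      have := abs_lt.mp (not_le.mp h)
      exact ⟨by linarith, by linarith⟩
  refine h1.trans ?_
  rw [lintegral_add_left (by fun_prop), lintegral_indicator hS]
  refine add_le_add ?_ ?_
  · rw [← ofReal_integral_eq_lintegral_ofReal (i0.const_mul a)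
      (ae_of_all _ fun y => mul_nonneg ha (tw_nonneg _ _ _ _)), integral_const_mul,
      ← ENNReal.ofReal_mul cT_nonneg]
    exact ENNReal.ofReal_le_ofReal (by nlinarith)
  · unfold eTail
    refine le_mul_of_one_le_left (by simp) ?_
    rw [ENNReal.one_le_ofReal]
    exact Real.one_le_rpow (by norm_num) (by linarith [hγ.1, hα.1])

lemma main_est {θ₀ : ℝ} (hθ₀ : θ₀ < 1) : ∃ C : ℝ, 0 ≤ C ∧ ∀ (γ α θ M x₀ a b K : ℝ) (f u : ℝ → ℝ),
    γ ∈ Set.Ico (1 / 3 : ℝ) (1 / 2) → α ∈ Set.Ioo (0 : ℝ) (1 / 2) → θ ∈ Set.Icc 0 θ₀ →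
    8 ≤ M → |x₀| ≤ M / 4 → 0 ≤ a → 0 ≤ b → Measurable f → Measurable u → (∀ x, |f x| ≤ K) →
    (∀ x, |u x| ≤ K) → (∀ x ∈ ball1 x₀ 3, |u x| ≤ a) → (∀ x ∈ ball1 x₀ 3, |f x| ≤ b) →
    IsWeakSol γ α u (fun x => f x * |x| ^ (-θ)) (Set.Ioo (-(2 * M)) (2 * M)) →
    ∫⁻ p : ℝ × ℝ, ENNReal.ofReal (bi x₀ p.1 * (bi x₀ p.2 * ((u p.1 - u p.2) ^ 2 *
      cknK γ α p.1 p.2))) ≤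
      ENNReal.ofReal (C * (a * (a + 4 * b + ∫ y, tw γ α x₀ y * |u y|))) := by
  obtain ⟨C, hC0, hC⟩ := core_all hθ₀
  refine ⟨C, hC0, ?_⟩
  intro γ α θ M x₀ a b K f u hγ hα hθ hM hx₀ ha hb hfm hum hfK huK hua hfb hw
  have hKK := cknK_meas γ α
  have hbm := bi_meas x₀
  have hK0 : 0 ≤ K := (abs_nonneg _).trans (huK 0)
  have hx00 := abs_nonneg x₀
  let F : ℝ → ℝ := fun x => f x * |x| ^ (-θ)
  have hFm : Measurable F := by simp only [F]; fun_prop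
  have hFb : ∀ δ > 0, ∃ C, ∀ x, δ ≤ |x| → |F x| ≤ C := fun δ hδ => by
    refine ⟨K * δ ^ (-θ), fun x hx => ?_⟩
    simp only [F]
    rw [abs_mul, abs_of_nonneg (by positivity : 0 ≤ |x| ^ (-θ))]
    exact mul_le_mul (hfK x) (Real.rpow_le_rpow_of_nonpos hδ hx (by linarith [hθ.1])) (by positivity) hK0
  let ε : ℕ → ℝ := fun n => 1 / ((|x₀| + 3) * 16 * (n + 1))
  have hε : ∀ n, 0 < ε n := fun n => by simp only [ε]; positivity
  have hεb : ∀ n, ε n * (|x₀| + 3) ≤ 1 / 16 := fun n => by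
    have h1 : (1 : ℝ) ≤ (n : ℝ) + 1 := by have : (0 : ℝ) ≤ n := n.cast_nonneg; linarith
    simp only [ε]
    rw [div_mul_eq_mul_div, one_mul, div_le_div_iff₀ (by positivity) (by norm_num)]
    nlinarith [mul_le_mul_of_nonneg_left h1 (by positivity : 0 ≤ (|x₀| + 3) * 16)]
  have hε1 : ∀ n, ε n ≤ 1 := fun n => by nlinarith [hεb n, hε n]
  have hεt : Filter.Tendsto ε Filter.atTop (nhdsWithin 0 (Set.Ioi 0)) := by
    refine tendsto_nhdsWithin_iff.mpr ⟨?_, Filter.Eventually.of_forall hε⟩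
    have := (tendsto_one_div_add_atTop_nhds_zero_nat (𝕜 := ℝ)).const_mul (1 / ((|x₀| + 3) * 16))
    rw [mul_zero] at this
    refine this.congr fun n => ?_
    simp only [ε]
    rw [one_div_mul_one_div]
  have hin : ∀ n x l, |x - x₀| ≤ 23 / 8 → l ∈ Set.Icc 1 (1 + ε n) → l * x ∈ ball1 x₀ 3 := by
    intro n x l hx hl
    have h1 : |x| ≤ |x₀| + 3 := by
      have := abs_sub_abs_le_abs_sub x x₀; linarith
    have h2 : |l * x - x₀| < 3 := by
      calc |l * x - x₀| = |(l - 1) * x + (x - x₀)| := by congr 1; ring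
        _ ≤ |(l - 1) * x| + |x - x₀| := abs_add_le _ _
        _ = (l - 1) * |x| + |x - x₀| := by rw [abs_mul, abs_of_nonneg (by linarith [hl.1])]
        _ ≤ ε n * (|x₀| + 3) + 23 / 8 := by
          have : l - 1 ≤ ε n := by linarith [hl.2]
          have := hε n
          gcongr
        _ < 3 := by linarith [hεb n]
    have := abs_lt.mp h2
    exact ⟨by linarith, by linarith⟩
  have hFl : ∀ x l B, 0 ≤ B → x ≠ 0 → 1 ≤ l → |f (l * x)| ≤ B → |F (l * x)| ≤ B * |x| ^ (-θ) := by
    intro x l B hB hx hl h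
    simp only [F]
    rw [abs_mul, abs_of_nonneg (by positivity : 0 ≤ |l * x| ^ (-θ))]
    refine mul_le_mul h (Real.rpow_le_rpow_of_nonpos (abs_pos.mpr hx) ?_ (by linarith [hθ.1]))
      (by positivity) hB
    rw [abs_mul, abs_of_nonneg (by linarith : 0 ≤ l)]
    exact le_mul_of_one_le_left (abs_nonneg _) hl
  have hAv := Av_tendsto hum huK
  have hest : ∀ n, ∫⁻ p : ℝ × ℝ, ENNReal.ofReal (bi x₀ p.1 * (bi x₀ p.2 *
      ((Av (ε n) u p.1 - Av (ε n) u p.2) ^ 2 * cknK γ α p.1 p.2))) ≤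
      ENNReal.ofReal (C * (a * (a + 4 * b + ∫ y, tw γ α x₀ y * |Av (ε n) u y|))) := by
    intro n
    have hL := Av_Lop hγ hα (hε n) (hε1 n) hum ⟨K, huK⟩ hFm hFb hw
    refine hC γ α θ x₀ a (4 * b) (4 * K) (Av (ε n) u) hγ hα hθ ha (by positivity)
      (Av_reg (hε n) hum huK) (fun x hx => Av_bdd (hε n) fun l hl => hua _ (hin n x l hx hl)) ?_ ?_
    · filter_upwards [hL, ae_ne_zero] with x hx hx0 hx1
      have h1 : |x| ≤ |x₀| + 3 := by
        have := abs_sub_abs_le_abs_sub x x₀; linarith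
      rw [hx (by nlinarith [hε1 n, hε n, abs_nonneg x]), mul_assoc]
      exact Fav_bdd hγ hα (hε n) (hε1 n) fun l hl =>
        hFl x l b hb hx0 hl.1 (hfb _ (hin n x l (by linarith) hl))
    · filter_upwards [hL, ae_ne_zero] with x hx hx0 hx1
      rw [hx (by nlinarith [hε1 n, hε n, abs_nonneg x]), mul_assoc]
      exact Fav_bdd hγ hα (hε n) (hε1 n) fun l hl => hFl x l K hK0 hx0 hl.1 (hfK _)
  have hTl : Filter.Tendsto (fun n => ∫ y, tw γ α x₀ y * |Av (ε n) u y|) Filter.atTop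
      (nhds (∫ y, tw γ α x₀ y * |u y|)) := by
    have htm := tw_meas γ α x₀
    refine tendsto_integral_of_dominated_convergence (fun y => tw γ α x₀ y * K) (fun n => ?_)
      ((tw_int hγ hα x₀).1.mul_const K) (fun n => ae_of_all _ fun y => ?_) ?_
    · have := Av_meas (hε n) hum
      have h2 : Measurable (fun y => tw γ α x₀ y * |Av (ε n) u y|) := by fun_prop
      exact h2.aestronglyMeasurable
    · rw [norm_mul, Real.norm_eq_abs, Real.norm_eq_abs, abs_abs, abs_of_nonneg (tw_nonneg _ _ _ _)]
      exact mul_le_mul_of_nonneg_left (Av_bdd (hε n) fun l _ => huK _) (tw_nonneg _ _ _ _)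
    · filter_upwards [hAv] with y hy
      exact ((hy.comp hεt).abs).const_mul _
  refine fatou_h (fun n => ?_) ?_ hest
    (ENNReal.tendsto_ofReal (((hTl.const_add (a + 4 * b)).const_mul a).const_mul C))
  · have := Av_meas (hε n) hum
    fun_prop
  · have a1 : ∀ᵐ p : ℝ × ℝ, Filter.Tendsto (fun ε => Av ε u p.1) (nhdsWithin 0 (Set.Ioi 0)) (nhds (u p.1)) := by
      rw [Measure.volume_eq_prod]; exact Measure.quasiMeasurePreserving_fst.ae hAv
    have a2 : ∀ᵐ p : ℝ × ℝ, Filter.Tendsto (fun ε => Av ε u p.2) (nhdsWithin 0 (Set.Ioi 0)) (nhds (u p.2)) := by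
      rw [Measure.volume_eq_prod]; exact Measure.quasiMeasurePreserving_snd.ae hAv
    filter_upwards [a1, a2] with p h1 h2
    have h3 := ENNReal.tendsto_ofReal (((((((h1.comp hεt).sub (h2.comp hεt)).pow 2).mul_const
      (cknK γ α p.1 p.2)).const_mul (bi x₀ p.2)).const_mul (bi x₀ p.1)))
    exact h3.liminf_eq.ge
end

/-- Caccioppoli-type energy estimate: for bounded weak solutions of
`𝓛_{γ,α} u = f |x|^{-θ}` in `(-2M,2M)` with finite tail, the localized seminorm on
`B_2(x₀)` is bounded by `C ‖u‖_∞ (‖u‖_∞ + ‖f‖_∞ + Tail)`, with `C` depending only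
on `θ₀`. -/
theorem stmt_8 (θ₀ : ℝ) (hθ₀ : θ₀ ∈ Set.Ioo (0 : ℝ) 1) :
    ∃ C : ℝ, 0 < C ∧
      ∀ (γ α θ M x₀ : ℝ) (f u : ℝ → ℝ),
        γ ∈ Set.Ico (1 / 3 : ℝ) (1 / 2) → α ∈ Set.Ioo (0 : ℝ) (1 / 2) →
        θ ∈ Set.Icc (0 : ℝ) θ₀ → 8 ≤ M → |x₀| ≤ M / 4 →
        Measurable f → (∃ Kf : ℝ, ∀ x ∈ Set.Ioo (-(2 * M)) (2 * M), |f x| ≤ Kf) →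
        Measurable u → (∃ Ku : ℝ, ∀ x : ℝ, |u x| ≤ Ku) →
        IsWeakSol γ α u (fun x => f x * |x| ^ (-θ)) (Set.Ioo (-(2 * M)) (2 * M)) →
        eTail γ α u x₀ 3 ≠ ⊤ →
        eSemi γ α u (ball1 x₀ 2) ≤
          ENNReal.ofReal C * eSup u (ball1 x₀ 3) *
            (eSup u (ball1 x₀ 3) + eSup f (ball1 x₀ 3) + eTail γ α u x₀ 3) := by
  obtain ⟨C, hC0, hC⟩ := main_est hθ₀.2
  have hcT := cT_nonneg
  refine ⟨(C + 1) * (5 + cT), by positivity, ?_⟩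
  intro γ α θ M x₀ f u hγ hα hθ hM hx₀ hfm hfK hum huK hw _
  obtain ⟨Kf, hKf⟩ := hfK
  obtain ⟨Ku, hKu⟩ := huK
  have hKf0 : 0 ≤ Kf := (abs_nonneg _).trans (hKf 0 ⟨by linarith, by linarith⟩)
  have hKu0 : 0 ≤ Ku := (abs_nonneg _).trans (hKu 0)
  have hS : MeasurableSet (ball1 x₀ 3) := measurableSet_Ioo
  have hx1 := abs_le.mp hx₀
  have hSI : ball1 x₀ 3 ⊆ Set.Ioo (-(2 * M)) (2 * M) := fun x hx =>
    ⟨by linarith [hx.1, hx1.1], by linarith [hx.2, hx1.2]⟩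
  obtain ⟨tu, bu⟩ := eSup_spec hS (fun x _ => hKu x)
  obtain ⟨tf, bf⟩ := eSup_spec hS (fun x hx => hKf x (hSI hx))
  obtain ⟨v, vm, vK, vS, vu⟩ := exists_rep hum hS MeasurableSet.univ ENNReal.toReal_nonneg
    (fun x _ => (hKu x).trans (le_max_right Kf Ku)) (hKu0.trans (le_max_right _ _)) bu
  obtain ⟨g, gm, gK, gS, gf⟩ := exists_rep hfm hS (measurableSet_Ioo (a := -(2 * M)) (b := 2 * M))
    ENNReal.toReal_nonneg (fun x hx => (hKf x hx).trans (le_max_left Kf Ku))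
    (hKu0.trans (le_max_right _ _)) bf
  have vu' : v =ᵐ[volume] u := by filter_upwards [vu] with x hx using hx trivial
  have hw' : IsWeakSol γ α v (fun x => g x * |x| ^ (-θ)) (Set.Ioo (-(2 * M)) (2 * M)) := by
    refine weak_congr hw vu' ?_
    filter_upwards [gf] with x hx hxI
    rw [hx hxI]
  have est := hC γ α θ M x₀ _ _ _ g v hγ hα hθ hM hx₀ ENNReal.toReal_nonneg ENNReal.toReal_nonneg
    gm vm gK vK vS gS hw'
  have tl := tail_le hγ hα ENNReal.toReal_nonneg vm vK vS vu'
  have e0 : eSemi γ α u (ball1 x₀ 2) = ∫⁻ p : ℝ × ℝ, ENNReal.ofReal (bi x₀ p.1 * (bi x₀ p.2 *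
      ((v p.1 - v p.2) ^ 2 * cknK γ α p.1 p.2))) := by
    rw [eSemi_eq hum]
    have a1 : ∀ᵐ p : ℝ × ℝ, v p.1 = u p.1 := by
      rw [Measure.volume_eq_prod]; exact Measure.quasiMeasurePreserving_fst.ae vu'
    have a2 : ∀ᵐ p : ℝ × ℝ, v p.2 = u p.2 := by
      rw [Measure.volume_eq_prod]; exact Measure.quasiMeasurePreserving_snd.ae vu'
    refine lintegral_congr_ae ?_
    filter_upwards [a1, a2] with p p1 p2
    rw [p1, p2]
  have hT0 : 0 ≤ ∫ y, tw γ α x₀ y * |v y| :=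
    integral_nonneg fun y => mul_nonneg (tw_nonneg _ _ _ _) (abs_nonneg _)
  have na : 0 ≤ (eSup u (ball1 x₀ 3)).toReal := ENNReal.toReal_nonneg
  have nb : 0 ≤ (eSup f (ball1 x₀ 3)).toReal := ENNReal.toReal_nonneg
  rw [ENNReal.ofReal_mul hC0, ENNReal.ofReal_mul na, ENNReal.ofReal_add (by positivity) hT0,
    ENNReal.ofReal_add na (by positivity), ENNReal.ofReal_mul (by norm_num),
    ENNReal.ofReal_toReal tu, ENNReal.ofReal_toReal tf] at est
  rw [ENNReal.ofReal_toReal tu] at tl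
  rw [e0]
  refine est.trans ?_
  set U := eSup u (ball1 x₀ 3)
  set V := eSup f (ball1 x₀ 3)
  set W := eTail γ α u x₀ 3
  have k1 : U + ENNReal.ofReal 4 * V + ENNReal.ofReal (∫ y, tw γ α x₀ y * |v y|) ≤
      ENNReal.ofReal (5 + cT) * (U + V + W) := by
    have c1 : ENNReal.ofReal (5 + cT) = 1 + ENNReal.ofReal 4 + ENNReal.ofReal cT := by
      rw [ENNReal.ofReal_add (by norm_num) hcT, show (5 : ℝ) = 1 + 4 by norm_num,
        ENNReal.ofReal_add (by norm_num) (by norm_num), ENNReal.ofReal_one]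
    rw [c1]
    calc _ ≤ U + ENNReal.ofReal 4 * V + (ENNReal.ofReal cT * U + W) := by gcongr
      _ ≤ (U + ENNReal.ofReal 4 * V + (ENNReal.ofReal cT * U + W)) +
          (V + ENNReal.ofReal 4 * U + ENNReal.ofReal 4 * W + ENNReal.ofReal cT * V +
            ENNReal.ofReal cT * W) := le_self_add
      _ = _ := by ring
  calc _ ≤ ENNReal.ofReal (C + 1) * (U * (ENNReal.ofReal (5 + cT) * (U + V + W))) := by
        gcongr
        linarith
    _ = _ := by
      rw [ENNReal.ofReal_mul (by positivity)]; ring
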